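/- A surface S has a boundary isolating curve if and only if S has nonempty boundary and there exist a compact set K ⊆ S and a connected component Z of S∖K such that U := closure(Z) is noncompact and the boundary of U — meaning the union of the topological frontier of U in S with U ∩ ∂S — consists of exactly one connected component, and that component is compact. -/

import Mathlib

open Set Topology unitInterval

noncomputable section

/-- A map is proper-continuous: continuous and the preimage of every compact set is compact. -/
def ProperCont {X Y : Type*} [TopologicalSpace X] [TopologicalSpace Y] (f : X → Y) : Prop :=
  Continuous f ∧ ∀ K : Set Y, IsCompact K → IsCompact (f ⁻¹' K)

/-- `f` and `g` are homotopic. -/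
def Htpc {X Y : Type*} [TopologicalSpace X] [TopologicalSpace Y] (f g : X → Y) : Prop :=
  ∃ H : X × I → Y, Continuous H ∧ (∀ x, H (x, 0) = f x) ∧ (∀ x, H (x, 1) = g x)

/-- `f` and `g` are properly homotopic: joined by a homotopy which is itself a proper map. -/
def PHtpc {X Y : Type*} [TopologicalSpace X] [TopologicalSpace Y] (f g : X → Y) : Prop :=
  ∃ H : X × I → Y, ProperCont H ∧ (∀ x, H (x, 0) = f x) ∧ (∀ x, H (x, 1) = g x)

/-- `φ` is a proper homotopy equivalence with proper homotopy inverse `ψ`. -/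
def IsPHEPair {X Y : Type*} [TopologicalSpace X] [TopologicalSpace Y]
    (φ : X → Y) (ψ : Y → X) : Prop :=
  ProperCont φ ∧ ProperCont ψ ∧ PHtpc (ψ ∘ φ) id ∧ PHtpc (φ ∘ ψ) id

/-- `φ` is a proper homotopy equivalence (admitting some proper homotopy inverse). -/
def IsPHE {X Y : Type*} [TopologicalSpace X] [TopologicalSpace Y] (φ : X → Y) : Prop :=
  ∃ ψ : Y → X, IsPHEPair φ ψ

/-- `X` and `Y` are properly homotopy equivalent. -/
def PHEquivalent (X Y : Type*) [TopologicalSpace X] [TopologicalSpace Y] : Prop :=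
  ∃ φ : X → Y, IsPHE φ

/-- The standard Möbius band, realized as a subset of `ℝ³`. -/
def MobiusBand : Set (ℝ × ℝ × ℝ) :=
  {p | ∃ u v : ℝ, |v| ≤ 1 / 2 ∧
    p = ((1 + v * Real.cos (u / 2)) * Real.cos u,
         (1 + v * Real.cos (u / 2)) * Real.sin u,
         v * Real.sin (u / 2))}

/-- A surface: a connected, orientable (no embedded Möbius band), second-countable, Hausdorff
topological 2-manifold, possibly with boundary (locally modeled on the closed half-plane). -/
structure IsSurface (S : Type*) [TopologicalSpace S] : Prop where
  connected : ConnectedSpace S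
  t2 : T2Space S
  secondCountable : SecondCountableTopology S
  locallyHalfPlane : ∀ x : S, ∃ (U : Set S) (V : Set {p : ℝ × ℝ // 0 ≤ p.2}),
    IsOpen U ∧ x ∈ U ∧ IsOpen V ∧ Nonempty (↥U ≃ₜ ↥V)
  orientable : ¬ ∃ f : ↥MobiusBand → S, IsEmbedding f

/-- The boundary of a surface: the set of points having no open neighborhood
homeomorphic to `ℝ²`. -/
def Bd (S : Type*) [TopologicalSpace S] : Set S :=
  {x | ¬ ∃ U : Set S, IsOpen U ∧ x ∈ U ∧ Nonempty (↥U ≃ₜ (ℝ × ℝ))}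

/-- The unit circle in the plane. -/
def Circ : Set (ℝ × ℝ) := {p | p.1 ^ 2 + p.2 ^ 2 = 1}

/-- A simple closed curve in `S`: the image of a topological embedding of the circle. -/
def IsSimpleClosedCurve {S : Type*} [TopologicalSpace S] (α : Set S) : Prop :=
  ∃ f : ↥Circ → S, IsEmbedding f ∧ range f = α

/-- A boundary isolating curve: a simple closed curve `α ⊆ S ∖ ∂S` such that `S ∖ α` has
exactly two connected components `Y` and `Z` with `Y ∩ ∂S ≠ ∅`, `Z ∩ ∂S = ∅`, and
`Z ∪ α` noncompact. -/
def IsBoundaryIsolating {S : Type*} [TopologicalSpace S] (α : Set S) : Prop :=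
  IsSimpleClosedCurve α ∧ α ∩ Bd S = ∅ ∧
  ∃ Y Z : Set S, Y ≠ Z ∧
    (∀ C : Set S, (∃ x ∈ αᶜ, C = connectedComponentIn αᶜ x) ↔ (C = Y ∨ C = Z)) ∧
    (Y ∩ Bd S).Nonempty ∧ Z ∩ Bd S = ∅ ∧ ¬ IsCompact (Z ∪ α)

/-- The open part of the parametrizing interval of an edge. -/
def edgeInt : Set I := {t : I | 0 < (t : ℝ) ∧ (t : ℝ) < 1}

/-- A graph: a connected, locally finite, Hausdorff, 1-dimensional CW complex, presented by a
closed discrete vertex set and a set of characteristic maps of edges. -/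
structure IsGraph (Γ : Type*) [TopologicalSpace Γ] : Prop where
  connected : ConnectedSpace Γ
  t2 : T2Space Γ
  cell_structure : ∃ (V : Set Γ) (E : Set C(I, Γ)),
    IsClosed V ∧ DiscreteTopology ↥V ∧
    (∀ e ∈ E, e 0 ∈ V ∧ e 1 ∈ V) ∧
    (∀ e ∈ E, IsEmbedding (fun t : ↥edgeInt => e t.1)) ∧
    (∀ e ∈ E, (⇑e '' edgeInt) ∩ V = ∅) ∧
    (∀ e ∈ E, ∀ e' ∈ E, e ≠ e' → (⇑e '' edgeInt) ∩ (⇑e' '' edgeInt) = ∅) ∧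
    (V ∪ ⋃ e ∈ E, ⇑e '' edgeInt) = univ ∧
    (∀ x : Γ, ∃ U : Set Γ, IsOpen U ∧ x ∈ U ∧ {e ∈ E | (range ⇑e ∩ U).Nonempty}.Finite) ∧
    (∀ A : Set Γ, (∀ e ∈ E, IsClosed (⇑e ⁻¹' A)) → IsClosed (A ∩ ⋃ e ∈ E, range ⇑e)) ∧
    (∀ v ∈ V, (∃ e ∈ E, v ∈ range ⇑e) ∨ (univ : Set Γ) = {v})

/-- A finite graph: a graph with finitely many cells, equivalently a compact graph. -/
def IsFiniteGraph (Γ : Type*) [TopologicalSpace Γ] : Prop :=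
  IsGraph Γ ∧ CompactSpace Γ

/-- A deformation retraction of `S` onto the subspace `A`. -/
def IsDeformationRetraction {S : Type*} [TopologicalSpace S] (H : S × I → S) (A : Set S) :
    Prop :=
  Continuous H ∧ (∀ x, H (x, 0) = x) ∧ (∀ x, H (x, 1) ∈ A) ∧ (∀ a ∈ A, H (a, 1) = a)

/-- A proper deformation retraction of `S` onto the subspace `A`. -/
def IsProperDeformationRetraction {S : Type*} [TopologicalSpace S] (H : S × I → S)
    (A : Set S) : Prop :=
  ProperCont H ∧ (∀ x, H (x, 0) = x) ∧ (∀ x, H (x, 1) ∈ A) ∧ (∀ a ∈ A, H (a, 1) = a)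

/-- An end of a space, recorded as a compatible choice of a connected component of the
complement of each compact set. -/
def IsEndFn {Γ : Type*} [TopologicalSpace Γ] (s : Set Γ → Set Γ) : Prop :=
  (∀ K : Set Γ, IsCompact K → ∃ x ∈ Kᶜ, s K = connectedComponentIn Kᶜ x) ∧
  (∀ K K' : Set Γ, IsCompact K → IsCompact K' → K ⊆ K' → s K' ⊆ s K)

/-- A proper map induces the identity on the space of ends. -/
def InducesIdOnEnds {Γ : Type*} [TopologicalSpace Γ] (g : Γ → Γ) : Prop :=
  ∀ s : Set Γ → Set Γ, IsEndFn s → ∀ K : Set Γ, IsCompact K →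
    ∃ K' : Set Γ, IsCompact K' ∧ K ⊆ K' ∧ g '' s K' ⊆ s K

/-- An isotopy between `f` and `g` relative to the set `B`: a homotopy each of whose time
slices is a homeomorphism fixing `B` pointwise. -/
def IsotopicRel {S : Type*} [TopologicalSpace S] (B : Set S) (f g : S → S) : Prop :=
  ∃ H : S × I → S, Continuous H ∧ (∀ x, H (x, 0) = f x) ∧ (∀ x, H (x, 1) = g x) ∧
    ∀ t : I, IsHomeomorph (fun x => H (x, t)) ∧ ∀ x ∈ B, H (x, t) = x

/-- An isotopy between `f` and `g`: a homotopy each of whose time slices is a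
homeomorphism. -/
def Isotopic {S : Type*} [TopologicalSpace S] (f g : S → S) : Prop :=
  ∃ H : S × I → S, Continuous H ∧ (∀ x, H (x, 0) = f x) ∧ (∀ x, H (x, 1) = g x) ∧
    ∀ t : I, IsHomeomorph (fun x => H (x, t))

/-- Representatives for the mapping class group of a surface: homeomorphisms fixing the
boundary pointwise, with the compact-open topology. -/
abbrev MCGRep (S : Type*) [TopologicalSpace S] :=
  {f : C(S, S) // IsHomeomorph ⇑f ∧ ∀ x ∈ Bd S, f x = x}

/-- The isotopy-rel-boundary relation on representatives. -/
def mcgRel (S : Type*) [TopologicalSpace S] (f g : MCGRep S) : Prop :=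
  IsotopicRel (Bd S) ⇑f.1 ⇑g.1

/-- The mapping class group `Map(S)` of a surface as a topological space: homeomorphisms
fixing the boundary pointwise, modulo isotopy rel boundary, with the quotient of the
compact-open topology. -/
abbrev MCG (S : Type*) [TopologicalSpace S] := Quot (mcgRel S)

/-- Representatives for the extended mapping class group: all homeomorphisms. -/
abbrev ExRep (S : Type*) [TopologicalSpace S] := {f : C(S, S) // IsHomeomorph ⇑f}

/-- The (free) isotopy relation on representatives. -/
def exRel (S : Type*) [TopologicalSpace S] (f g : ExRep S) : Prop :=
  Isotopic ⇑f.1 ⇑g.1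

/-- The extended mapping class group `ExMap(S)` as a topological space. -/
abbrev ExMCG (S : Type*) [TopologicalSpace S] := Quot (exRel S)

/-- Representatives for the mapping class group of a graph: proper homotopy equivalences
admitting a proper homotopy inverse, with the compact-open topology. -/
abbrev GphRep (Γ : Type*) [TopologicalSpace Γ] := {g : C(Γ, Γ) // IsPHE ⇑g}

/-- The proper homotopy relation on representatives. -/
def gphRel (Γ : Type*) [TopologicalSpace Γ] (g h : GphRep Γ) : Prop :=
  PHtpc ⇑g.1 ⇑h.1

/-- The mapping class group `Map(Γ)` of a graph as a topological space. -/
abbrev GphMCG (Γ : Type*) [TopologicalSpace Γ] := Quot (gphRel Γ)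

/-- Rotation of the unit circle by angle `a`. -/
def rotC (a : ℝ) (p : ↥Circ) : ↥Circ :=
  ⟨(p.1.1 * Real.cos a - p.1.2 * Real.sin a, p.1.1 * Real.sin a + p.1.2 * Real.cos a), by
    have h : p.1.1 ^ 2 + p.1.2 ^ 2 = 1 := p.2
    have h2 := Real.sin_sq_add_cos_sq a
    simp only [Circ, Set.mem_setOf_eq]
    nlinarith [h, h2]⟩

/-- Reflection of the unit circle (the standard orientation-reversing involution). -/
def circConj (p : ↥Circ) : ↥Circ :=
  ⟨(p.1.1, -p.1.2), by
    have h : p.1.1 ^ 2 + p.1.2 ^ 2 = 1 := p.2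
    simp only [Circ, Set.mem_setOf_eq]
    nlinarith [h]⟩

/-- The midpoint of the unit interval. -/
def ihalf : I := ⟨1 / 2, by norm_num [Set.mem_Icc]⟩

/-- `f` is the twist map determined by an embedded annular collar `e`:
`e(θ,t) ↦ e(θ + 2πt, t)` on the image of `e` and the identity elsewhere. -/
def IsTwistMap {S : Type*} [TopologicalSpace S] (e : ↥Circ × I → S) (f : S → S) : Prop :=
  IsEmbedding e ∧
  (∀ (θ : ↥Circ) (t : I), f (e (θ, t)) = e (rotC (2 * Real.pi * (t : ℝ)) θ, t)) ∧
  (∀ x, x ∉ range e → f x = x)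

/-- A Dehn twist about a compact boundary component of `S`. -/
def IsCptBdTwist {S : Type*} [TopologicalSpace S] (f : S → S) : Prop :=
  ∃ e : ↥Circ × I → S, IsTwistMap e f ∧
    (∃ x ∈ Bd S, range (fun θ : ↥Circ => e (θ, 0)) = connectedComponentIn (Bd S) x ∧
      IsCompact (connectedComponentIn (Bd S) x)) ∧
    (∀ (θ : ↥Circ) (t : I), (t : ℝ) ≠ 0 → e (θ, t) ∉ Bd S)

/-- The closed unit disk in the plane. -/
def ClosedDisk : Set (ℝ × ℝ) := {p | p.1 ^ 2 + p.2 ^ 2 ≤ 1}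

/-- A Dehn twist about a degenerate boundary chain: a twist supported in an annulus disjoint
from `∂S` whose core curve cuts off a piece homeomorphic to a closed disk with a nonempty
proper closed subset removed from its boundary circle. -/
def IsDegChainTwist {S : Type*} [TopologicalSpace S] (f : S → S) : Prop :=
  ∃ e : ↥Circ × I → S, IsTwistMap e f ∧ range e ∩ Bd S = ∅ ∧
    ∃ x ∈ (range fun θ : ↥Circ => e (θ, ihalf))ᶜ,
      ∃ J : Set (ℝ × ℝ), J ⊆ Circ ∧ IsClosed J ∧ J.Nonempty ∧ J ≠ Circ ∧
        Nonempty
          (↥(closure (connectedComponentIn (range fun θ : ↥Circ => e (θ, ihalf))ᶜ x)) ≃ₜ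
            ↥(ClosedDisk \ J))

/-- `f` is a finite composition of maps satisfying the predicate `P`. -/
def IsProductOf {S : Type*} [TopologicalSpace S] (P : (S → S) → Prop) (f : S → S) : Prop :=
  ∃ L : List (S → S), (∀ g ∈ L, P g) ∧ f = L.foldr (· ∘ ·) id

/-- The closed half-strip `[0,∞) × [0,1]`. -/
def HalfStrip : Set (ℝ × ℝ) := {p | 0 ≤ p.1 ∧ 0 ≤ p.2 ∧ p.2 ≤ 1}

/-- The closed strip `ℝ × [0,1]`. -/
def FullStrip : Set (ℝ × ℝ) := {p | 0 ≤ p.2 ∧ p.2 ≤ 1}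

/-- A closed annulus in the plane. -/
def AnnulusSet : Set (ℝ × ℝ) := {p | 1 ≤ p.1 ^ 2 + p.2 ^ 2 ∧ p.1 ^ 2 + p.2 ^ 2 ≤ 4}

/-- A surface is sporadic if it is homeomorphic to the closed disk, the half-strip, the
strip, or the annulus. -/
def IsSporadic (S : Type*) [TopologicalSpace S] : Prop :=
  Nonempty (S ≃ₜ ↥ClosedDisk) ∨ Nonempty (S ≃ₜ ↥HalfStrip) ∨
    Nonempty (S ≃ₜ ↥FullStrip) ∨ Nonempty (S ≃ₜ ↥AnnulusSet)

/-- A parametrization of a compact boundary component of `S` by the circle. -/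
def IsCptBdParam {S : Type*} [TopologicalSpace S] (β : ↥Circ → S) : Prop :=
  IsEmbedding β ∧ ∃ x ∈ Bd S, range β = connectedComponentIn (Bd S) x ∧
    IsCompact (range β)

/-- A proper parametrization of a noncompact boundary component of `S` by the line. -/
def IsNcptBdParam {S : Type*} [TopologicalSpace S] (β : ℝ → S) : Prop :=
  IsEmbedding β ∧ ProperCont β ∧ ∃ x ∈ Bd S, range β = connectedComponentIn (Bd S) x ∧
    ¬ IsCompact (range β)

/-- `g` fixes (up to homotopy, resp. proper homotopy, and preserving orientations) each
curve and line of the collection `B` of `φ'`-images of boundary components: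
membership in `Map(Γ, B)`. -/
def FixesBdryImages {S : Type*} [TopologicalSpace S] (G : Set S) (φ' : S → ↥G)
    (g : ↥G → ↥G) : Prop :=
  (∀ β : ↥Circ → S, IsCptBdParam β → Htpc (g ∘ φ' ∘ β) (φ' ∘ β)) ∧
  (∀ β : ℝ → S, IsNcptBdParam β → PHtpc (g ∘ φ' ∘ β) (φ' ∘ β))

/-- `g` preserves the collection `B` of `φ'`-images of boundary components, possibly
permuting its members and reversing orientations: membership in `Map*(Γ, B)`. -/
def PermutesBdryImages {S : Type*} [TopologicalSpace S] (G : Set S) (φ' : S → ↥G)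
    (g : ↥G → ↥G) : Prop :=
  (∀ β : ↥Circ → S, IsCptBdParam β → ∃ β' : ↥Circ → S, IsCptBdParam β' ∧
    (Htpc (g ∘ φ' ∘ β) (φ' ∘ β') ∨ Htpc (g ∘ φ' ∘ β) (φ' ∘ β' ∘ circConj))) ∧
  (∀ β : ℝ → S, IsNcptBdParam β → ∃ β' : ℝ → S, IsNcptBdParam β' ∧
    (PHtpc (g ∘ φ' ∘ β) (φ' ∘ β') ∨ PHtpc (g ∘ φ' ∘ β) (φ' ∘ β' ∘ (fun r : ℝ => -r))))

end

/-! ### Continuous logarithms on plane sets -/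

/-- `f` has a continuous logarithm on `K`. -/
def HasLog (f : ℂ → ℂ) (K : Set ℂ) : Prop :=
  ∃ l : ℂ → ℂ, ContinuousOn l K ∧ ∀ z ∈ K, Complex.exp (l z) = f z

namespace HasLog

variable {f g : ℂ → ℂ} {K K' : Set ℂ}

theorem mono (h : HasLog f K) (hK : K' ⊆ K) : HasLog f K' :=
  let ⟨l, hl, he⟩ := h
  ⟨l, hl.mono hK, fun z hz => he z (hK hz)⟩

theorem congr (h : HasLog f K) (hfg : ∀ z ∈ K, f z = g z) : HasLog g K :=
  let ⟨l, hl, he⟩ := h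
  ⟨l, hl, fun z hz => (he z hz).trans (hfg z hz)⟩

theorem mul (h : HasLog f K) (h' : HasLog g K) : HasLog (fun z => f z * g z) K :=
  let ⟨l, hl, he⟩ := h
  let ⟨l', hl', he'⟩ := h'
  ⟨fun z => l z + l' z, hl.add hl', fun z hz => by rw [Complex.exp_add, he z hz, he' z hz]⟩

theorem inv (h : HasLog f K) : HasLog (fun z => (f z)⁻¹) K :=
  let ⟨l, hl, he⟩ := h
  ⟨fun z => -l z, hl.neg, fun z hz => by rw [Complex.exp_neg, he z hz]⟩

theorem div (h : HasLog f K) (h' : HasLog g K) : HasLog (fun z => f z / g z) K :=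
  (h.mul h'.inv).congr fun _ _ => (div_eq_mul_inv _ _).symm

end HasLog

theorem ContinuousOn.piecewise_isClosed {X Y : Type*} [TopologicalSpace X] [TopologicalSpace Y]
    {A B : Set X} {f g : X → Y} (hA : IsClosed A) (hB : IsClosed B) (hf : ContinuousOn f A)
    (hg : ContinuousOn g B) (h : ∀ x ∈ A ∩ B, f x = g x) [∀ x, Decidable (x ∈ A)] :
    ContinuousOn (A.piecewise f g) (A ∪ B) := by
  refine ContinuousOn.union_of_isClosed ?_ ?_ hA hB
  · exact hf.congr fun x hx => piecewise_eq_of_mem _ _ _ hx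
  · refine hg.congr fun x hx => ?_
    by_cases hxA : x ∈ A
    · rw [piecewise_eq_of_mem _ _ _ hxA, h x ⟨hxA, hx⟩]
    · rw [piecewise_eq_of_notMem _ _ _ hxA]

/-- Logarithms which agree on the overlap of two closed sets glue. -/
theorem HasLog.union {f l l' : ℂ → ℂ} {A B : Set ℂ} (hA : IsClosed A) (hB : IsClosed B)
    (hl : ContinuousOn l A) (hl' : ContinuousOn l' B) (he : ∀ z ∈ A, Complex.exp (l z) = f z)
    (he' : ∀ z ∈ B, Complex.exp (l' z) = f z) (h : ∀ z ∈ A ∩ B, l z = l' z) :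
    HasLog f (A ∪ B) := by
  classical
  refine ⟨A.piecewise l l', hl.piecewise_isClosed hA hB hl' h, fun z hz => ?_⟩
  by_cases hzA : z ∈ A
  · rw [piecewise_eq_of_mem _ _ _ hzA, he z hzA]
  · rw [piecewise_eq_of_notMem _ _ _ hzA, he' z (hz.resolve_left hzA)]

/-- A continuous integer-valued function on a preconnected set is constant. -/
theorem IsPreconnected.eq_of_int_valued {X : Type*} [TopologicalSpace X] {K : Set X}
    (hK : IsPreconnected K) {u : X → ℝ} (hu : ContinuousOn u K)
    (hint : ∀ x ∈ K, ∃ n : ℤ, u x = n) {x y : X} (hx : x ∈ K) (hy : y ∈ K) : u x = u y := by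
  exact hK.constant_of_mapsTo (T := range ((↑) : ℤ → ℝ))
    Int.isClosedEmbedding_coe_real.isEmbedding.isDiscrete_range hu
    (fun z hz => let ⟨n, hn⟩ := hint z hz; ⟨n, hn.symm⟩) hx hy

/-- Two logarithms of the same function on a preconnected set differ by a constant. -/
theorem IsPreconnected.log_sub_const {X : Type*} [TopologicalSpace X] {K : Set X}
    (hK : IsPreconnected K) {l l' : X → ℂ} (hl : ContinuousOn l K) (hl' : ContinuousOn l' K)
    (he : ∀ z ∈ K, Complex.exp (l z) = Complex.exp (l' z)) :
    ∃ n : ℤ, ∀ z ∈ K, l z = l' z + n * (2 * Real.pi * Complex.I) := by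
  have h2 : (2 * Real.pi * Complex.I) ≠ 0 := Complex.two_pi_I_ne_zero
  have key : ∀ z ∈ K, ∃ n : ℤ, l z = l' z + n * (2 * Real.pi * Complex.I) := fun z hz =>
    Complex.exp_eq_exp_iff_exists_int.1 (he z hz)
  rcases K.eq_empty_or_nonempty with rfl | ⟨x, hx⟩
  · exact ⟨0, by simp⟩
  obtain ⟨n, hn⟩ := key x hx
  refine ⟨n, fun z hz => ?_⟩
  obtain ⟨m, hm⟩ := key z hz
  have := hK.eq_of_int_valued (u := fun z => ((l z - l' z) / (2 * Real.pi * Complex.I)).re)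
    (Complex.continuous_re.comp_continuousOn ((hl.sub hl').div_const _))
    (fun w hw => by
      obtain ⟨k, hk⟩ := key w hw
      exact ⟨k, by rw [hk]; simp [h2]⟩) hx hz
  rw [hm, hn] at this
  have h3 : (n : ℝ) = m := by simpa [h2] using this
  have h4 : n = m := by exact_mod_cast h3
  rw [hm, h4]

/-- A nonvanishing function on a simply connected space has a logarithm. -/
theorem exists_continuous_log {A : Type*} [TopologicalSpace A] [SimplyConnectedSpace A]
    [LocallyPathConnectedSpace A] {f : A → ℂ} (hf : Continuous f) (h0 : ∀ a, f a ≠ 0) :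
    ∃ l : A → ℂ, Continuous l ∧ ∀ a, Complex.exp (l a) = f a := by
  obtain ⟨a₀⟩ : Nonempty A := inferInstance
  obtain ⟨F, ⟨-, hF⟩, -⟩ := Complex.isCoveringMapOn_exp.existsUnique_continuousMap_lifts
    ⟨f, hf⟩ (a₀ := a₀) (e₀ := Complex.log (f a₀)) (Complex.exp_log (h0 a₀)) h0
  exact ⟨F, F.continuous, fun a => congrFun hF a⟩

theorem hasLog_one_sub {u : ℂ → ℂ} {K : Set ℂ} (hu : ContinuousOn u K) (h : ∀ z ∈ K, ‖u z‖ < 1) :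
    HasLog (fun z => 1 - u z) K := by
  have hs : ∀ z ∈ K, 1 - u z ∈ Complex.slitPlane := fun z hz => by
    left
    have := (Complex.abs_re_le_norm (u z)).trans_lt (h z hz)
    have := (abs_lt.1 this).2
    simpa using this
  exact ⟨fun z => Complex.log (1 - u z), (continuousOn_const.sub hu).clog hs, fun z hz =>
    Complex.exp_log (Complex.slitPlane_ne_zero (hs z hz))⟩

theorem hasLog_const {c : ℂ} (hc : c ≠ 0) (K : Set ℂ) : HasLog (fun _ => c) K :=
  ⟨fun _ => Complex.log c, continuousOn_const, fun _ _ => Complex.exp_log hc⟩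

theorem hasLog_sub_closedBall {p c : ℂ} {r : ℝ} (hp : p ∉ Metric.closedBall c r) :
    HasLog (fun z => z - p) (Metric.closedBall c r) := by
  by_cases hr : 0 ≤ r
  swap
  · exact ⟨0, by simp [Metric.closedBall_eq_empty.2 (not_le.1 hr)],
      by simp [Metric.closedBall_eq_empty.2 (not_le.1 hr)]⟩
  have hpc : r < ‖p - c‖ := by simpa [dist_eq_norm] using hp
  have hne : p - c ≠ 0 := by
    intro h; rw [h, norm_zero] at hpc; linarith
  refine ((hasLog_const (neg_ne_zero.2 hne) _).mul
    (hasLog_one_sub (u := fun z => (z - c) / (p - c)) (by fun_prop) fun z hz => ?_)).congr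
      fun z _ => ?_
  · rw [norm_div, div_lt_one (by linarith)]
    have : ‖z - c‖ ≤ r := by simpa [dist_eq_norm] using hz
    linarith
  · field_simp; ring

theorem hasLog_div_sub_of_far {p c : ℂ} {r : ℝ} (hp : p ∈ Metric.ball c r) :
    HasLog (fun z => (z - p) / (z - c)) {z | r ≤ dist z c} := by
  have hpc : ‖p - c‖ < r := by simpa [dist_eq_norm] using hp
  have hz0 : ∀ z ∈ {z | r ≤ dist z c}, z - c ≠ 0 := fun z hz h => by
    have : r ≤ ‖z - c‖ := by simpa [dist_eq_norm] using hz
    rw [h, norm_zero] at this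
    linarith [norm_nonneg (p - c)]
  refine (hasLog_one_sub (u := fun z => (p - c) / (z - c)) ?_ fun z hz => ?_).congr fun z hz => ?_
  · exact continuousOn_const.div (by fun_prop) hz0
  · have h1 : r ≤ ‖z - c‖ := by simpa [dist_eq_norm] using hz
    rw [norm_div, div_lt_one (by linarith [norm_nonneg (p - c)])]
    linarith
  · have := hz0 z hz
    field_simp; ring

theorem hasLog_moebius_of_far {p q c : ℂ} {r : ℝ} (hp : p ∈ Metric.ball c r)
    (hq : q ∈ Metric.ball c r) : HasLog (fun z => (z - p) / (z - q)) {z | r ≤ dist z c} := by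
  refine ((hasLog_div_sub_of_far hp).div (hasLog_div_sub_of_far hq)).congr fun z hz => ?_
  have : z - c ≠ 0 := fun h => by
    have h1 : r ≤ ‖z - c‖ := by simpa [dist_eq_norm] using hz
    have hpc : ‖p - c‖ < r := by simpa [dist_eq_norm] using hp
    rw [h, norm_zero] at h1
    linarith [norm_nonneg (p - c)]
  rw [div_div_div_cancel_right₀ this]

/-- Points in the same component of the complement are not separated by the logarithm. -/
theorem hasLog_of_mem_component {K : Set ℂ} (hK : IsClosed K) {p q : ℂ} (hq : q ∉ K)
    (hp : p ∈ connectedComponentIn Kᶜ q) : HasLog (fun z => (z - p) / (z - q)) K := by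
  have hloc : ∀ x ∉ K, ∃ r > 0, ∀ y ∈ Metric.ball x r, y ∉ K ∧
      HasLog (fun z => (z - y) / (z - x)) K := fun x hx => by
    obtain ⟨r, hr, hb⟩ := Metric.isOpen_iff.1 hK.isOpen_compl x hx
    refine ⟨r, hr, fun y hy => ⟨hb hy, (hasLog_div_sub_of_far hy).mono fun z hz => ?_⟩⟩
    by_contra h
    exact hb (Metric.mem_ball.2 (not_le.1 h)) hz
  set A : Set ℂ := {x | x ∉ K ∧ HasLog (fun z => (z - x) / (z - q)) K}
  set B : Set ℂ := {x | x ∉ K ∧ ¬ HasLog (fun z => (z - x) / (z - q)) K}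
  have trans : ∀ x y w, x ∉ K → y ∉ K → w ∉ K → HasLog (fun z => (z - x) / (z - y)) K →
      HasLog (fun z => (z - y) / (z - w)) K → HasLog (fun z => (z - x) / (z - w)) K :=
    fun x y w hx hy hw h h' => (h.mul h').congr fun z hz => by
      have : z - y ≠ 0 := sub_ne_zero.2 fun h => hy (h ▸ hz)
      field_simp
  have symm : ∀ x y, HasLog (fun z => (z - x) / (z - y)) K →
      HasLog (fun z => (z - y) / (z - x)) K :=
    fun x y h => h.inv.congr fun z hz => inv_div _ _
  have hA : IsOpen A := Metric.isOpen_iff.2 fun x hx => by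
    obtain ⟨r, hr, h⟩ := hloc x hx.1
    exact ⟨r, hr, fun y hy => ⟨(h y hy).1, trans y x q (h y hy).1 hx.1 hq (h y hy).2 hx.2⟩⟩
  have hB : IsOpen B := Metric.isOpen_iff.2 fun x hx => by
    obtain ⟨r, hr, h⟩ := hloc x hx.1
    exact ⟨r, hr, fun y hy => ⟨(h y hy).1, fun h' => hx.2
      (trans x y q hx.1 (h y hy).1 hq (symm _ _ (h y hy).2) h')⟩⟩
  have hsub : connectedComponentIn Kᶜ q ⊆ A := by
    refine isPreconnected_connectedComponentIn.subset_left_of_subset_union hA hB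
      (disjoint_left.2 fun x hx hx' => hx'.2 hx.2) (fun x hx => ?_)
      ⟨q, mem_connectedComponentIn hq, hq, ?_⟩
    · have hxK : x ∉ K := connectedComponentIn_subset _ _ hx
      by_cases h : HasLog (fun z => (z - x) / (z - q)) K
      · exact Or.inl ⟨hxK, h⟩
      · exact Or.inr ⟨hxK, h⟩
    · exact (hasLog_const one_ne_zero K).congr fun z hz =>
        (div_self (sub_ne_zero.2 fun h : z = q => hq (h ▸ hz))).symm
  exact (hsub hp).2

/-- The winding number obstruction. -/
theorem eq_zero_of_hasLog_frontier {P : Set ℂ} (hP : IsOpen P) (hb : Bornology.IsBounded P)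
    {x : ℂ} (hx : x ∈ P) {h : ℂ → ℂ} (hh : ContinuousOn h (closure P))
    (h0 : ∀ z ∈ closure P, h z ≠ 0) {k : ℤ}
    (hL : HasLog (fun z => (z - x) ^ k * h z) (frontier P)) : k = 0 := by
  classical
  obtain ⟨l, hl, he⟩ := hL
  obtain ⟨L, hLe⟩ := ContinuousMap.exists_restrict_eq (Y := ℂ) (isClosed_frontier (s := P))
    ⟨(frontier P).domRestrict l, hl.domRestrict⟩
  have hLl : ∀ z ∈ frontier P, L z = l z := fun z hz => congrArg (fun g => g ⟨z, hz⟩) hLe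
  set G : ℂ → ℂ := (closure P).piecewise (fun z => Complex.exp (L z) / h z) (fun z => (z - x) ^ k)
  have hcov : closure P ∪ Pᶜ = univ := by
    rw [eq_univ_iff_forall]; intro z
    by_cases hz : z ∈ P
    · exact Or.inl (subset_closure hz)
    · exact Or.inr hz
  have hzx : ∀ z ∈ Pᶜ, z - x ≠ 0 := fun z hz h => hz (sub_eq_zero.1 h ▸ hx)
  have hG : Continuous G := by
    rw [← continuousOn_univ, ← hcov]
    refine ContinuousOn.piecewise_isClosed isClosed_closure hP.isClosed_compl ?_ ?_ ?_
    · exact (Complex.continuous_exp.comp L.continuous).continuousOn.div hh h0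
    · exact ContinuousOn.zpow₀ (by fun_prop) k fun z hz => Or.inl (hzx z hz)
    · rintro z ⟨hz, hz'⟩
      have hzf : z ∈ frontier P := by rw [hP.frontier_eq]; exact ⟨hz, hz'⟩
      have := h0 z hz
      change Complex.exp (L z) / h z = _
      rw [hLl z hzf, he z hzf]
      field_simp
  have hG0 : ∀ z, G z ≠ 0 := fun z => by
    by_cases hz : z ∈ closure P
    · rw [show G z = _ from piecewise_eq_of_mem _ _ _ hz]
      exact div_ne_zero (Complex.exp_ne_zero _) (h0 z hz)
    · rw [show G z = _ from piecewise_eq_of_notMem _ _ _ hz]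
      exact zpow_ne_zero _ (hzx z fun h => hz (subset_closure h))
  obtain ⟨m, hm, hme⟩ := exists_continuous_log hG hG0
  obtain ⟨R, hR⟩ := hb.closure.subset_ball x
  have hR0 : 0 < R := by
    have := hR (subset_closure hx); simpa using this
  set c : ℝ → ℂ := fun t => x + R * Complex.exp (t * Complex.I)
  have hc : Continuous c := by fun_prop
  have hcG : ∀ t, G (c t) = (R * Complex.exp (t * Complex.I)) ^ k := fun t => by
    have : c t ∉ closure P := fun h => by
      have := hR h
      simp [c, Complex.norm_exp_ofReal_mul_I, abs_of_pos hR0] at this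
    rw [show G (c t) = _ from piecewise_eq_of_notMem _ _ _ this]
    simp [c]
  obtain ⟨n, hn⟩ := (isPreconnected_univ (α := ℝ)).log_sub_const (l := fun t => m (c t))
    (l' := fun t : ℝ => k * (Complex.log R + t * Complex.I)) (by fun_prop) (by fun_prop)
    fun t _ => by
      rw [hme, hcG, Complex.exp_int_mul, Complex.exp_add, Complex.exp_log]
      exact_mod_cast hR0.ne'
  have e0 := hn 0 trivial
  have e1 := hn (2 * Real.pi) trivial
  have : c 0 = c (2 * Real.pi) := by
    simp only [c]; push_cast; rw [Complex.exp_two_pi_mul_I]; simp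
  rw [← this, e0] at e1
  have h3 : (k : ℂ) * (2 * Real.pi * Complex.I) = 0 := by
    push_cast at e1
    linear_combination -e1
  have h4 := (mul_eq_zero.1 h3).resolve_right Complex.two_pi_I_ne_zero
  exact_mod_cast h4

theorem closure_connectedComponentIn_inter {X : Type*} [TopologicalSpace X] (F : Set X) (x : X) :
    closure (connectedComponentIn F x) ∩ F ⊆ connectedComponentIn F x := by
  rintro y ⟨hy, hyF⟩
  by_cases hx : x ∈ F
  · refine (isPreconnected_connectedComponentIn.subset_closure (t := insert y
      (connectedComponentIn F x)) (subset_insert _ _)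
      (insert_subset hy subset_closure)).subset_connectedComponentIn
      (mem_insert_of_mem _ (mem_connectedComponentIn hx))
      (insert_subset hyF (connectedComponentIn_subset _ _)) (mem_insert _ _)
  · simp [connectedComponentIn_eq_empty hx] at hy

/-- Points whose Moebius quotient has a logarithm lie in the same (bounded) component. -/
theorem mem_component_of_hasLog {K : Set ℂ} (hK : IsClosed K) {p q : ℂ} (hp : p ∉ K) (hq : q ∉ K)
    (hb : Bornology.IsBounded (connectedComponentIn Kᶜ p))
    (hL : HasLog (fun z => (z - p) / (z - q)) K) : q ∈ connectedComponentIn Kᶜ p := by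
  by_contra hne
  set P := connectedComponentIn Kᶜ p
  have hPo : IsOpen P := hK.isOpen_compl.connectedComponentIn
  have hfr : frontier P ⊆ K := fun z hz => by
    rw [hPo.frontier_eq] at hz
    by_contra h
    exact hz.2 (closure_connectedComponentIn_inter _ _ ⟨hz.1, h⟩)
  have hq' : q ∉ closure P := fun h => by
    by_cases hqP : q ∈ P
    · exact hne hqP
    · exact hq (hfr (by rw [hPo.frontier_eq]; exact ⟨h, hqP⟩))
  have := eq_zero_of_hasLog_frontier hPo hb (mem_connectedComponentIn hp)
    (h := fun z => (z - q)⁻¹) (k := 1)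
    (ContinuousOn.inv₀ (by fun_prop) fun z hz => sub_ne_zero.2 fun h => hq' (h ▸ hz))
    (fun z hz => inv_ne_zero (sub_ne_zero.2 fun h => hq' (h ▸ hz)))
    ((hL.mono hfr).congr fun z _ => by rw [zpow_one, div_eq_mul_inv])
  exact one_ne_zero this

/-- Nonvanishing functions have logarithms on arcs. -/
theorem hasLog_arc {γ : ℝ → ℂ} {a b : ℝ} (hab : a ≤ b) (hγ : ContinuousOn γ (Icc a b))
    (hinj : InjOn γ (Icc a b)) {f : ℂ → ℂ} (hf : ContinuousOn f (γ '' Icc a b))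
    (h0 : ∀ z ∈ γ '' Icc a b, f z ≠ 0) : HasLog f (γ '' Icc a b) := by
  obtain ⟨m, hm, hme⟩ := exists_continuous_log (A := ℝ)
    (f := IccExtend hab ((Icc a b).domRestrict (f ∘ γ)))
    ((hf.comp hγ (mapsTo_image _ _)).domRestrict.Icc_extend')
    (fun t => h0 _ (mem_image_of_mem _ (projIcc a b hab t).2))
  refine ⟨fun z => m (Function.invFunOn γ (Icc a b) z), ?_, ?_⟩
  · refine hm.comp_continuousOn ?_
    rw [continuousOn_iff_isClosed]
    intro t ht
    refine ⟨γ '' (t ∩ Icc a b), ?_, ?_⟩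
    · exact ((isCompact_Icc.inter_left ht).image_of_continuousOn
        (hγ.mono inter_subset_right)).isClosed
    · ext z; constructor
      · rintro ⟨hz, s, hs, rfl⟩
        rw [mem_preimage, hinj.leftInvOn_invFunOn hs] at hz
        exact ⟨⟨s, ⟨hz, hs⟩, rfl⟩, s, hs, rfl⟩
      · rintro ⟨⟨s, ⟨hz, hs⟩, rfl⟩, -⟩
        refine ⟨?_, s, hs, rfl⟩
        rw [mem_preimage, hinj.leftInvOn_invFunOn hs]
        exact hz
  · rintro _ ⟨s, hs, rfl⟩
    beta_reduce
    rw [hinj.leftInvOn_invFunOn hs, hme, IccExtend_of_mem _ _ hs]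
    rfl

/-! ### Charts and sides of closed sets in a surface -/

section Surface

variable {S : Type*} [TopologicalSpace S]

theorem isClosed_Bd : IsClosed (Bd S) := by
  rw [← isOpen_compl_iff, isOpen_iff_mem_nhds]
  intro x hx
  obtain ⟨U, hU, hxU, h⟩ := not_not.1 hx
  exact Filter.mem_of_superset (hU.mem_nhds hxU) fun y hy => not_not.2 ⟨U, hU, hy, h⟩

/-- Small charts around interior points. -/
theorem exists_chart {x : S} (hx : x ∉ Bd S) {N : Set S} (hN : N ∈ 𝓝 x) :
    ∃ φ : ℂ → S, IsOpenEmbedding φ ∧ φ 0 = x ∧ range φ ⊆ N := by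
  obtain ⟨U, hU, hxU, ⟨h⟩⟩ := not_not.1 hx
  set g : ℂ → S := fun z => (h.symm (Complex.equivRealProdCLM z) : S)
  have hg : IsOpenEmbedding g := hU.isOpenEmbedding_subtypeVal.comp
    (h.symm.isOpenEmbedding.comp Complex.equivRealProdCLM.toHomeomorph.isOpenEmbedding)
  obtain ⟨c, hc⟩ : ∃ c, g c = x :=
    ⟨Complex.equivRealProdCLM.symm (h ⟨x, hxU⟩), by simp [g]⟩
  have : g ⁻¹' N ∈ 𝓝 c := hg.continuous.continuousAt (hc.symm ▸ hN)
  obtain ⟨r, hr, hb⟩ := Metric.mem_nhds_iff.1 this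
  refine ⟨g ∘ OpenPartialHomeomorph.univBall c r, hg.comp
    ((OpenPartialHomeomorph.univBall c r).isOpenEmbedding (by simp)), by simp [hc], ?_⟩
  rintro _ ⟨z, rfl⟩
  refine hb ?_
  have := (OpenPartialHomeomorph.univBall c r).map_source (x := z) (by simp)
  rwa [OpenPartialHomeomorph.univBall_target c hr] at this

theorem IsPreconnected.subset_ball_of_disjoint_sphere {E : Type*} [PseudoMetricSpace E] {P : Set E}
    (hP : IsPreconnected P) {c : E} {R : ℝ} (hd : Disjoint P (Metric.sphere c R)) {x : E}
    (hx : x ∈ P) (hxR : x ∈ Metric.ball c R) : P ⊆ Metric.ball c R := by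
  refine hP.subset_left_of_subset_union Metric.isOpen_ball
    (v := (Metric.closedBall c R)ᶜ) Metric.isClosed_closedBall.isOpen_compl ?_ (fun z hz => ?_)
    ⟨x, hx, hxR⟩
  · exact disjoint_compl_right.mono_left Metric.ball_subset_closedBall
  · rcases lt_trichotomy (dist z c) R with h | h | h
    · exact Or.inl h
    · exact absurd h (disjoint_left.1 hd hz)
    · exact Or.inr fun h' => absurd (Metric.mem_closedBall.1 h') (not_le.2 h)

/-- `E` is a union of components of the complement of the closed set `X`. -/
def IsSide (E X : Set S) : Prop := IsOpen E ∧ Disjoint E X ∧ IsClosed (E ∪ X)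

theorem IsSide.compl {E X : Set S} (h : IsSide E X) : IsSide (E ∪ X)ᶜ X := by
  refine ⟨h.2.2.isOpen_compl, disjoint_left.2 fun x hx hx' => hx (Or.inr hx'), ?_⟩
  convert h.1.isClosed_compl using 1
  ext x
  have hd : x ∈ E → x ∉ X := fun hx => disjoint_left.1 h.2.1 hx
  by_cases h1 : x ∈ E <;> by_cases h2 : x ∈ X <;> simp_all

theorem IsSide.subset_of_isPreconnected {E X P : Set S} (h : IsSide E X) (hP : IsPreconnected P)
    (hPX : Disjoint P X) {x : S} (hx : x ∈ P) (hxE : x ∈ E) : P ⊆ E := by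
  refine hP.subset_left_of_subset_union h.1 h.2.2.isOpen_compl
    (disjoint_compl_right.mono_left subset_union_left) (fun z hz => ?_) ⟨x, hx, hxE⟩
  by_cases hzE : z ∈ E
  · exact Or.inl hzE
  · exact Or.inr fun h => h.elim hzE (disjoint_left.1 hPX hz)

/-- Surgery inside a chart: the part `X2` of a separating closed set is replaced by a set meeting
the rest in a preconnected set. -/
theorem IsSide.surgery {φ : ℂ → S} (hφ : IsOpenEmbedding φ) [T2Space S] {r : ℝ}
    {X1 X2 X' T E : Set S} (h1 : IsClosed X1) (h2 : IsClosed X2) (h' : IsClosed X')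
    (hX2 : X2 ⊆ φ '' Metric.closedBall 0 r) (h1' : X1 ⊆ X') (hT : IsPreconnected T)
    (hT1 : X1 ∩ X2 ⊆ T) (hT2 : T ⊆ X' ∩ φ '' Metric.closedBall 0 r) (hE : IsSide E (X1 ∪ X2)) :
    ∃ E', IsSide E' X' ∧
      E' \ φ '' Metric.closedBall 0 r = E \ (X' ∪ φ '' Metric.closedBall 0 r) := by
  set D := φ '' Metric.closedBall 0 r
  have hD : IsClosed D := ((isCompact_closedBall 0 r).image hφ.continuous).isClosed
  have hmemD : ∀ z, φ z ∈ D ↔ z ∈ Metric.closedBall 0 r := fun z => hφ.injective.mem_set_image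
  set R := r + 1
  have hrR : Metric.closedBall (0 : ℂ) r ⊆ Metric.ball 0 R :=
    Metric.closedBall_subset_ball (by simp [R])
  set K' : Set ℂ := (φ ⁻¹' X' ∩ Metric.closedBall 0 R) ∪ Metric.sphere 0 R
  set K : Set ℂ := (φ ⁻¹' (X1 ∪ X2) ∩ Metric.closedBall 0 R) ∪ Metric.sphere 0 R
  have hK' : IsClosed K' :=
    ((h'.preimage hφ.continuous).inter Metric.isClosed_closedBall).union Metric.isClosed_sphere
  have hK : IsClosed K := (((h1.union h2).preimage hφ.continuous).inter
    Metric.isClosed_closedBall).union Metric.isClosed_sphere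
  have hball : ∀ (L : Set ℂ) (_ : Metric.sphere 0 R ⊆ L) (z : ℂ), z ∈ Metric.ball 0 R → z ∉ L →
      connectedComponentIn Lᶜ z ⊆ Metric.ball 0 R := fun L hL z hz hzL =>
    isPreconnected_connectedComponentIn.subset_ball_of_disjoint_sphere
      (disjoint_left.2 fun w hw hw' => connectedComponentIn_subset _ _ hw (hL hw'))
      (mem_connectedComponentIn (F := Lᶜ) hzL) hz
  have hS' : Metric.sphere 0 R ⊆ K' := subset_union_right
  have hS : Metric.sphere 0 R ⊆ K := subset_union_right
  have notK' : ∀ z ∈ Metric.ball (0 : ℂ) R, (z ∉ K' ↔ φ z ∉ X') := fun z hz => by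
    have h1 : z ∈ Metric.closedBall (0 : ℂ) R := Metric.ball_subset_closedBall hz
    have h2 : z ∉ Metric.sphere (0 : ℂ) R := fun h => (Metric.mem_ball.1 hz).ne h
    simp only [K', mem_union, mem_inter_iff, mem_preimage]
    tauto
  have notK : ∀ z ∈ Metric.ball (0 : ℂ) R, (z ∉ K ↔ φ z ∉ X1 ∪ X2) := fun z hz => by
    have h1 : z ∈ Metric.closedBall (0 : ℂ) R := Metric.ball_subset_closedBall hz
    have h2 : z ∉ Metric.sphere (0 : ℂ) R := fun h => (Metric.mem_ball.1 hz).ne h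
    simp only [K, mem_union, mem_inter_iff, mem_preimage]
    tauto
  have far : ∀ p ∈ Metric.ball (0 : ℂ) R, p ∉ Metric.closedBall (0 : ℂ) r → p ∉ K' → p ∉ K :=
    fun p hp hpr hpK => (notK p hp).2 fun h => h.elim
      (fun h => (notK' p hp).1 hpK (h1' h)) (fun h => hpr ((hmemD p).1 (hX2 h)))
  have key : ∀ p q, p ∈ Metric.ball (0 : ℂ) R → p ∉ Metric.closedBall (0 : ℂ) r → p ∉ K' →
      q ∈ connectedComponentIn K'ᶜ p → q ∉ Metric.closedBall (0 : ℂ) r → φ p ∈ E → φ q ∈ E := by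
    intro p q hp hpr hpK hq hqr hpE
    have hqR := hball K' hS' p hp hpK hq
    have hqK : q ∉ K' := connectedComponentIn_subset _ _ hq
    obtain ⟨l, hl, hle⟩ := hasLog_of_mem_component hK' hpK hq
    obtain ⟨m, hm, hme⟩ := (hasLog_sub_closedBall hqr).div (hasLog_sub_closedBall hpr)
    have hTr : φ ⁻¹' T ⊆ Metric.closedBall 0 r := fun z hz => (hmemD z).1 (hT2 hz).2
    have hTK : φ ⁻¹' T ⊆ K' := fun z hz =>
      Or.inl ⟨(hT2 hz).1, Metric.ball_subset_closedBall (hrR (hTr hz))⟩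
    have hTp : IsPreconnected (φ ⁻¹' T) :=
      hT.preimage_of_isOpenMap hφ.injective hφ.isOpenMap fun x hx =>
        image_subset_range _ _ (hT2 hx).2
    obtain ⟨n, hn⟩ := hTp.log_sub_const (hl.mono hTK) (hm.mono hTr) fun z hz => by
      rw [hle z (hTK hz), hme z (hTr hz)]
    have hAK : (φ ⁻¹' X1 ∩ Metric.closedBall 0 R) ∪ Metric.sphere 0 R ⊆ K' :=
      union_subset_union_left _ (inter_subset_inter_left _ (preimage_mono h1'))
    have hBr : φ ⁻¹' X2 ⊆ Metric.closedBall 0 r := fun z hz => (hmemD z).1 (hX2 hz)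
    have hlog : HasLog (fun z => (z - q) / (z - p)) K := by
      refine (HasLog.union (A := (φ ⁻¹' X1 ∩ Metric.closedBall 0 R) ∪ Metric.sphere 0 R)
        (B := φ ⁻¹' X2) (l := l) (l' := fun z => m z + n * (2 * Real.pi * Complex.I))
        (((h1.preimage hφ.continuous).inter Metric.isClosed_closedBall).union
          Metric.isClosed_sphere) (h2.preimage hφ.continuous) (hl.mono hAK)
        ((hm.mono hBr).add continuousOn_const) (fun z hz => hle z (hAK hz))
        (fun z hz => ?_) ?_).mono ?_
      · rw [Complex.exp_add, hme z (hBr hz), Complex.exp_int_mul_two_pi_mul_I, mul_one]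
      · rintro z ⟨hz | hz, hz2⟩
        · exact hn z (hT1 ⟨hz.1, hz2⟩)
        · exact absurd hz (Metric.mem_ball.1 (hrR (hBr hz2))).ne
      · rintro z (⟨hz | hz, hz'⟩ | hz)
        · exact Or.inl (Or.inl ⟨hz, hz'⟩)
        · exact Or.inr hz
        · exact Or.inl (Or.inr hz)
    have hpK2 := far p hp hpr hpK
    have hpq := mem_component_of_hasLog hK (far q hqR hqr hqK) hpK2
      (Metric.isBounded_ball.subset (hball K hS q hqR (far q hqR hqr hqK))) hlog
    have hcomp : connectedComponentIn Kᶜ q ⊆ Metric.ball 0 R :=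
      hball K hS q hqR (far q hqR hqr hqK)
    refine hE.subset_of_isPreconnected (isPreconnected_connectedComponentIn.image φ
      hφ.continuous.continuousOn) (disjoint_left.2 ?_) (mem_image_of_mem φ hpq) hpE
      (mem_image_of_mem φ (mem_connectedComponentIn (F := Kᶜ) (far q hqR hqr hqK)))
    rintro _ ⟨w, hw, rfl⟩
    exact (notK w (hcomp hw)).1 (connectedComponentIn_subset _ _ hw)
  set A : Set ℂ := {z | z ∈ Metric.ball 0 R ∧ z ∉ K' ∧ ∃ p ∈ connectedComponentIn K'ᶜ z,
    p ∉ Metric.closedBall (0 : ℂ) r ∧ φ p ∈ E}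
  have hAcomp : ∀ z w, z ∈ Metric.ball 0 R → z ∉ K' → w ∈ connectedComponentIn K'ᶜ z →
      (w ∈ A ↔ z ∈ A) := fun z w hz hzK hw => by
    have e := connectedComponentIn_eq hw
    have hw' : w ∈ Metric.ball 0 R ∧ w ∉ K' :=
      ⟨hball K' hS' z hz hzK hw, connectedComponentIn_subset _ _ hw⟩
    simp only [A, mem_ofPred_eq, e]
    tauto
  have hAE : ∀ z, z ∉ Metric.closedBall (0 : ℂ) r → z ∈ A → φ z ∈ E := by
    rintro z hz ⟨hzR, hzK, p, hp, hpr, hpE⟩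
    refine key p z (hball K' hS' z hzR hzK hp) hpr (connectedComponentIn_subset _ _ hp) ?_ hz hpE
    rw [← connectedComponentIn_eq hp]
    exact mem_connectedComponentIn (F := K'ᶜ) hzK
  have hAo : IsOpen A := isOpen_iff_mem_nhds.2 fun z hz =>
    Filter.mem_of_superset (hK'.isOpen_compl.connectedComponentIn.mem_nhds
      (mem_connectedComponentIn (F := K'ᶜ) hz.2.1)) fun w hw => (hAcomp z w hz.1 hz.2.1 hw).2 hz
  refine ⟨(E \ (X' ∪ D)) ∪ φ '' A, ⟨?_, ?_, ?_⟩, ?_⟩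
  · exact (hE.1.sdiff (h'.union hD)).union (hφ.isOpenMap _ hAo)
  · refine disjoint_left.2 ?_
    rintro x (hx | ⟨z, hz, rfl⟩) hxX
    · exact hx.2 (Or.inl hxX)
    · exact (notK' z hz.1).1 hz.2.1 hxX
  · rw [← isOpen_compl_iff, isOpen_iff_mem_nhds]
    intro y hy
    have hyX : y ∉ X' := fun h => hy (Or.inr h)
    have hyE : y ∉ (E \ (X' ∪ D)) ∪ φ '' A := fun h => hy (Or.inl h)
    by_cases hyR : y ∈ φ '' Metric.ball 0 R
    · obtain ⟨z, hz, rfl⟩ := hyR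
      have hzK : z ∉ K' := (notK' z hz).2 hyX
      refine Filter.mem_of_superset ((hφ.isOpenMap _
        hK'.isOpen_compl.connectedComponentIn).mem_nhds
        (mem_image_of_mem φ (mem_connectedComponentIn (F := K'ᶜ) hzK))) ?_
      rintro _ ⟨w, hw, rfl⟩ hw'
      have hzA : z ∉ A := fun h => hyE (Or.inr ⟨z, h, rfl⟩)
      rcases hw' with (hw' | ⟨w', hw', e⟩) | hw'
      · exact hzA ⟨hz, hzK, w, hw, fun h => hw'.2 (Or.inr ((hmemD w).2 h)), hw'.1⟩
      · rw [hφ.injective e] at hw'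
        exact hzA ((hAcomp z w hz hzK hw).1 hw')
      · exact (notK' w (hball K' hS' z hz hzK hw)).1 (connectedComponentIn_subset _ _ hw) hw'
    · have hyD : y ∉ D := fun h => hyR (image_mono hrR h)
      have hyE' : y ∉ E := fun h => hyE (Or.inl ⟨h, fun h => h.elim hyX hyD⟩)
      have hyX12 : y ∉ E ∪ (X1 ∪ X2) := by
        rintro (h | h | h)
        · exact hyE' h
        · exact hyX (h1' h)
        · exact hyD (hX2 h)
      refine Filter.mem_of_superset (((hE.2.2.union h').union hD).isOpen_compl.mem_nhds
        (x := y) ?_) ?_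
      · rintro ((h | h) | h)
        exacts [hyX12 h, hyX h, hyD h]
      · rintro w hw ((hw' | ⟨z, hz, rfl⟩) | hw')
        · exact hw (Or.inl (Or.inl (Or.inl hw'.1)))
        · exact hw (Or.inl (Or.inl (Or.inl
            (hAE z (fun h => hw (Or.inr ((hmemD z).2 h))) hz))))
        · exact hw (Or.inl (Or.inr hw'))
  · ext x; constructor
    · rintro ⟨hx | ⟨z, hz, rfl⟩, hxD⟩
      · exact hx
      · exact ⟨hAE z (fun h => hxD ((hmemD z).2 h)) hz, fun h =>
          h.elim ((notK' z hz.1).1 hz.2.1) hxD⟩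
    · exact fun hx => ⟨Or.inl hx, fun h => hx.2 (Or.inr h)⟩

/-- `E` and `E'` agree outside a compact subset of `N`. -/
def SameOff (N E E' : Set S) : Prop := ∃ D, IsCompact D ∧ D ⊆ N ∧ ∀ x ∉ D, x ∈ E' ↔ x ∈ E

theorem SameOff.refl (N E : Set S) : SameOff N E E := ⟨∅, isCompact_empty, by simp, by simp⟩

theorem SameOff.trans {N E E' E'' : Set S} (h : SameOff N E E') (h' : SameOff N E' E'') :
    SameOff N E E'' := by
  obtain ⟨D, hD, hDN, hDE⟩ := h
  obtain ⟨D', hD', hDN', hDE'⟩ := h'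
  refine ⟨D ∪ D', hD.union hD', union_subset hDN hDN', fun x hx => ?_⟩
  rw [hDE' x fun h => hx (Or.inr h), hDE x fun h => hx (Or.inl h)]

/-- Surgery, recording only that the side is unchanged off a compact set. -/
theorem IsSide.surgery_sameOff {φ : ℂ → S} (hφ : IsOpenEmbedding φ) [T2Space S] {r : ℝ}
    {N X1 X2 X' T E C : Set S} (h1 : IsClosed X1) (h2 : IsClosed X2) (h' : IsClosed X')
    (hX2 : X2 ⊆ φ '' Metric.closedBall 0 r) (h1' : X1 ⊆ X') (hT : IsPreconnected T)
    (hT1 : X1 ∩ X2 ⊆ T) (hT2 : T ⊆ X' ∩ φ '' Metric.closedBall 0 r) (hE : IsSide E (X1 ∪ X2))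
    (hφN : range φ ⊆ N) (hC : IsCompact C) (hCN : C ⊆ N) (hX'C : X' ⊆ X1 ∪ X2 ∪ C) :
    ∃ E', IsSide E' X' ∧ SameOff N E E' := by
  obtain ⟨E', hE', he⟩ := hE.surgery hφ h1 h2 h' hX2 h1' hT hT1 hT2
  refine ⟨E', hE', φ '' Metric.closedBall 0 r ∪ C,
    ((isCompact_closedBall 0 r).image hφ.continuous).union hC,
    union_subset ((image_subset_range _ _).trans hφN) hCN, fun x hx => ?_⟩
  have hxD : x ∉ φ '' Metric.closedBall 0 r := fun h => hx (Or.inl h)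
  have := congrArg (x ∈ ·) he
  simp only [mem_sdiff, mem_union, hxD, not_false_eq_true, and_true, or_false, eq_iff_iff] at this
  rw [this, and_iff_left_iff_imp]
  intro hxE hxX
  rcases hX'C hxX with h | h
  · exact disjoint_left.1 hE.2.1 hxE h
  · exact hx (Or.inr h)

/-- A pendant arc can be removed from a closed set. -/
theorem IsSide.remove_arc [T2Space S] {N X E : Set S} (hN : IsOpen N) (hNB : Disjoint N (Bd S))
    (hX : IsClosed X) {γ : ℝ → S} {a b : ℝ} (hab : a ≤ b) (hγ : ContinuousOn γ (Icc a b))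
    (hinj : InjOn γ (Icc a b)) (hγN : γ '' Icc a b ⊆ N) (hγX : ∀ t ∈ Ioc a b, γ t ∉ X)
    (hE : IsSide E (X ∪ γ '' Icc a b)) : ∃ E', IsSide E' X ∧ SameOff N E E' := by
  have hch : ∀ x : S, ∃ φ : ℂ → S, x ∈ N → IsOpenEmbedding φ ∧ φ 0 = x ∧ range φ ⊆ N := fun x => by
    by_cases hx : x ∈ N
    · obtain ⟨φ, h⟩ := exists_chart (disjoint_left.1 hNB hx) (hN.mem_nhds hx)
      exact ⟨φ, fun _ => h⟩
    · exact ⟨fun _ => x, fun h => absurd h hx⟩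
  choose φ hφ using hch
  obtain ⟨t, ht0, htm, ⟨m, htm1⟩, htc⟩ := exists_monotone_Icc_subset_open_cover_Icc hab
    (c := fun s : Icc a b => (Icc a b).domRestrict γ ⁻¹' (φ (γ s) '' Metric.ball 0 1))
    (fun s => ((hφ (γ s) (hγN ⟨s, s.2, rfl⟩)).1.isOpenMap _ Metric.isOpen_ball).preimage
      hγ.domRestrict)
    (fun s _ => mem_iUnion.2 ⟨s, 0, by simp, (hφ (γ s) (hγN ⟨s, s.2, rfl⟩)).2.1⟩)
  have hcl : ∀ c d, a ≤ c → d ≤ b → IsClosed (γ '' Icc c d) := fun c d hc hd =>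
    (isCompact_Icc.image_of_continuousOn (hγ.mono (Icc_subset_Icc hc hd))).isClosed
  have main : ∀ n ≤ m, ∃ E', IsSide E' (X ∪ γ '' Icc a (t n)) ∧ SameOff N E E' := by
    intro n hn
    induction hn using Nat.decreasingInduction with
    | self => exact ⟨E, by rwa [htm1 m le_rfl], SameOff.refl _ _⟩
    | of_succ k hk ih =>
      obtain ⟨E', hE', hs⟩ := ih
      obtain ⟨s, hts⟩ := htc k
      have hle : (t k : ℝ) ≤ t (k + 1) := htm (Nat.le_succ k)
      have hkI := (t k).2
      have hk1I := (t (k + 1)).2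
      have hsplit : X ∪ γ '' Icc a (t (k + 1)) =
          (X ∪ γ '' Icc a (t k)) ∪ γ '' Icc (t k : ℝ) (t (k + 1)) := by
        rw [union_assoc, ← image_union, Icc_union_Icc_eq_Icc hkI.1 hle]
      rw [hsplit] at hE'
      have hφs := hφ (γ s) (hγN ⟨s, s.2, rfl⟩)
      have hsub : γ '' Icc (t k : ℝ) (t (k + 1)) ⊆ φ (γ s) '' Metric.closedBall 0 1 := by
        rintro _ ⟨u, hu, rfl⟩
        exact image_mono Metric.ball_subset_closedBall
          (hts (show (⟨u, hkI.1.trans hu.1, hu.2.trans hk1I.2⟩ : Icc a b) ∈ _ from hu))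
      have ⟨E'', hE'', hs'⟩ := hE'.surgery_sameOff (T := {γ (t k)}) hφs.1
        (hX.union (hcl _ _ le_rfl hkI.2))
        (hcl _ _ hkI.1 hk1I.2) (hX.union (hcl _ _ le_rfl hkI.2)) hsub le_rfl
        isPreconnected_singleton ?_ ?_ hφs.2.2 isCompact_empty (empty_subset _)
        (fun x hx => Or.inl (Or.inl hx))
      · exact ⟨E'', hE'', hs.trans hs'⟩
      · rintro _ ⟨hx, ⟨u, hu, rfl⟩⟩
        have huI : u ∈ Icc a b := ⟨hkI.1.trans hu.1, hu.2.trans hk1I.2⟩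
        rcases hx with hx | ⟨v, hv, hvu⟩
        · rcases huI.1.eq_or_lt with h | h
          · have : (t k : ℝ) = u := le_antisymm hu.1 (h ▸ hkI.1)
            rw [← this]; rfl
          · exact absurd hx (hγX u ⟨h, huI.2⟩)
        · have : v = u := hinj ⟨hv.1, hv.2.trans hkI.2⟩ huI hvu
          have : (t k : ℝ) = u := le_antisymm hu.1 (this ▸ hv.2)
          rw [← this]; rfl
      · rintro _ rfl
        exact ⟨Or.inr ⟨_, ⟨hkI.1, le_rfl⟩, rfl⟩, hsub ⟨_, ⟨le_rfl, hle⟩, rfl⟩⟩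
  obtain ⟨E', hE', hs⟩ := main 0 (Nat.zero_le _)
  rw [ht0, Icc_self, image_singleton] at hE'
  have hφs := hφ (γ a) (hγN ⟨a, ⟨le_rfl, hab⟩, rfl⟩)
  have hmem : γ a ∈ φ (γ a) '' Metric.closedBall 0 1 := ⟨0, by simp, hφs.2.1⟩
  obtain ⟨E'', hE'', hs'⟩ := hE'.surgery_sameOff (r := 1) (T := X ∩ {γ a}) hφs.1 hX
    isClosed_singleton hX (singleton_subset_iff.2 hmem) le_rfl
    (Set.Subsingleton.isPreconnected fun x hx y hy => hx.2.trans hy.2.symm) le_rfl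
    (fun x hx => ⟨hx.1, hx.2 ▸ hmem⟩) hφs.2.2 isCompact_empty (empty_subset _)
    (fun x hx => Or.inl (Or.inl hx))
  exact ⟨E'', hE'', hs.trans hs'⟩

/-- An arc in the interior does not separate a connected surface. -/
theorem IsSide.arc_eq [T2Space S] [PreconnectedSpace S] {E : Set S} {γ : ℝ → S} {a b : ℝ}
    (hab : a ≤ b) (hγ : ContinuousOn γ (Icc a b))
    (hinj : InjOn γ (Icc a b)) (hγB : Disjoint (γ '' Icc a b) (Bd S))
    (hE : IsSide E (γ '' Icc a b)) (hne : E.Nonempty) : E = (γ '' Icc a b)ᶜ := by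
  refine hE.2.1.subset_compl_right.antisymm fun y hy => ?_
  by_contra hyE
  obtain ⟨x, hx⟩ := hne
  have ⟨E', hE', D, hD, hDN, hDE⟩ := IsSide.remove_arc (N := (Bd S ∪ {x, y})ᶜ) (X := ∅) (E := E)
    (isClosed_Bd.union (by simp [Set.Finite.isClosed])).isOpen_compl
    (disjoint_compl_left.mono_right subset_union_left) isClosed_empty hab hγ hinj
    (fun z hz => ?_) (by simp) (by rwa [empty_union])
  · have hc : IsClopen E' := ⟨by simpa using hE'.2.2, hE'.1⟩
    have hxE : x ∈ E' := (hDE x fun h => hDN h (by simp)).2 hx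
    have : y ∈ E' := by
      rcases isClopen_iff.1 hc with h | h
      · exact absurd hxE (h ▸ notMem_empty x)
      · exact h ▸ mem_univ y
    exact hyE ((hDE y fun h => hDN h (by simp)).1 this)
  · rintro (h | rfl | rfl)
    · exact disjoint_left.1 hγB hz h
    · exact disjoint_left.1 hE.2.1 hx hz
    · exact hy hz

end Surface

/-! ### Local sectors at a vertex -/

/-- Logarithms on finitely many closed sets which agree on overlaps glue. -/
theorem HasLog.iUnion {ι : Type*} [Finite ι] {f : ℂ → ℂ} {A : ι → Set ℂ} {l : ι → ℂ → ℂ}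
    (hA : ∀ i, IsClosed (A i)) (hl : ∀ i, ContinuousOn (l i) (A i))
    (he : ∀ i, ∀ z ∈ A i, Complex.exp (l i z) = f z)
    (h : ∀ i j, ∀ z ∈ A i ∩ A j, l i z = l j z) : HasLog f (⋃ i, A i) := by
  classical
  set m : ℂ → ℂ := fun z => if h : ∃ i, z ∈ A i then l h.choose z else 0
  have hm : ∀ i, ∀ z ∈ A i, m z = l i z := fun i z hz => by
    have hex : ∃ i, z ∈ A i := ⟨i, hz⟩
    simp only [m, dif_pos hex]
    exact h _ _ z ⟨hex.choose_spec, hz⟩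
  refine ⟨m, (locallyFinite_of_finite A).continuousOn_iUnion hA fun i => (hl i).congr (hm i),
    fun z hz => ?_⟩
  obtain ⟨i, hi⟩ := mem_iUnion.1 hz
  rw [hm i z hi, he i z hi]

/-- `N` arcs in the unit disc issuing from the origin, ending on the closed set `K₀`. -/
structure IsStar {N : ℕ} (K₀ : Set ℂ) (T : Fin N → Set ℂ) (t : Fin N → ℂ) : Prop where
  closed_base : IsClosed K₀
  sphere_subset : Metric.sphere 0 1 ⊆ K₀
  closed_leg : ∀ k, IsClosed (T k)
  log_leg : ∀ k, ∀ f : ℂ → ℂ, ContinuousOn f (T k) → (∀ z ∈ T k, f z ≠ 0) → HasLog f (T k)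
  preconnected_leg : ∀ k, IsPreconnected (T k)
  zero_mem : ∀ k, 0 ∈ T k
  end_mem : ∀ k, t k ∈ T k
  end_sphere : ∀ k, t k ∈ Metric.sphere (0 : ℂ) 1
  leg_base : ∀ k, T k ∩ K₀ ⊆ {t k}
  leg_leg : ∀ k l, k ≠ l → T k ∩ T l ⊆ {0}

namespace IsStar

variable {N : ℕ} {K₀ : Set ℂ} {T : Fin N → Set ℂ} {t : Fin N → ℂ}

theorem isClosed (h : IsStar K₀ T t) : IsClosed (K₀ ∪ ⋃ k, T k) :=
  h.closed_base.union (isClosed_iUnion_of_finite h.closed_leg)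

theorem component_subset (h : IsStar K₀ T t) {x : ℂ} (hx : x ∈ Metric.ball (0 : ℂ) 1) :
    connectedComponentIn (K₀ ∪ ⋃ k, T k)ᶜ x ⊆ Metric.ball 0 1 := by
  by_cases hxK : x ∈ (K₀ ∪ ⋃ k, T k)ᶜ
  · refine isPreconnected_connectedComponentIn.subset_ball_of_disjoint_sphere
      (disjoint_left.2 fun w hw hw' => connectedComponentIn_subset _ _ hw
        (Or.inl (h.sphere_subset hw'))) (mem_connectedComponentIn hxK) hx
  · rw [connectedComponentIn_eq_empty hxK]
    exact empty_subset _

/-- `N` legs divide a small disc into at most `N` sectors. -/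
theorem sectors (h : IsStar K₀ T t) (hN : 0 < N) {δ : ℝ} (hδ1 : δ ≤ 1)
    (hδ : Disjoint (Metric.ball 0 δ) K₀) {x₀ : ℂ} {x : Fin N → ℂ}
    (hx₀ : x₀ ∈ Metric.ball 0 δ) (hx : ∀ j, x j ∈ Metric.ball 0 δ)
    (hx₀T : ∀ k, x₀ ∉ T k) (hxT : ∀ j k, x j ∉ T k) :
    (∃ j, x₀ ∈ connectedComponentIn (K₀ ∪ ⋃ k, T k)ᶜ (x j)) ∨
    ∃ i j, i ≠ j ∧ x i ∈ connectedComponentIn (K₀ ∪ ⋃ k, T k)ᶜ (x j) := by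
  by_contra! hcon
  obtain ⟨hcon0, hcon1⟩ := hcon
  have h2 : (2 * Real.pi * Complex.I) ≠ 0 := Complex.two_pi_I_ne_zero
  have hfar : K₀ ⊆ {z | δ ≤ dist z 0} := fun z hz => not_lt.1 fun h' =>
    disjoint_left.1 hδ (Metric.mem_ball.2 h') hz
  have hlam : ∀ j, ∃ l : ℂ → ℂ, ContinuousOn l K₀ ∧
      ∀ z ∈ K₀, Complex.exp (l z) = (z - x j) / (z - x₀) :=
    fun j => (hasLog_moebius_of_far (hx j) hx₀).mono hfar
  choose lam hlam hlame using hlam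
  have hmu : ∀ j k, ∃ l : ℂ → ℂ, ContinuousOn l (T k) ∧
      (∀ z ∈ T k, Complex.exp (l z) = (z - x j) / (z - x₀)) ∧
      l 0 = Complex.log ((0 - x j) / (0 - x₀)) := fun j k => by
    have hne : ∀ z ∈ T k, z - x₀ ≠ 0 := fun z hz h' => hx₀T k (sub_eq_zero.1 h' ▸ hz)
    have hne' : ∀ z ∈ T k, z - x j ≠ 0 := fun z hz h' => hxT j k (sub_eq_zero.1 h' ▸ hz)
    obtain ⟨l, hl, hle⟩ := h.log_leg k (fun z => (z - x j) / (z - x₀))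
      (ContinuousOn.div (by fun_prop) (by fun_prop) hne)
      (fun z hz => div_ne_zero (hne' z hz) (hne z hz))
    have h0 := h.zero_mem k
    refine ⟨fun z => l z + (Complex.log ((0 - x j) / (0 - x₀)) - l 0), hl.add continuousOn_const,
      fun z hz => ?_, by ring⟩
    rw [Complex.exp_add, Complex.exp_sub, Complex.exp_log
      (div_ne_zero (hne' 0 h0) (hne 0 h0)), hle 0 h0, div_self
      (div_ne_zero (hne' 0 h0) (hne 0 h0)), mul_one, hle z hz]
  choose mu hmu hmue hmu0 using hmu
  have hn : ∀ j k, t k ∈ K₀ → ∃ n : ℤ, lam j (t k) = mu j k (t k) + n * (2 * Real.pi * Complex.I) :=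
    fun j k hk => Complex.exp_eq_exp_iff_exists_int.1
      (by rw [hlame j _ hk, hmue j k _ (h.end_mem k)])
  have htK : ∀ k, t k ∈ K₀ := fun k => h.sphere_subset (h.end_sphere k)
  choose n hn using fun j k => hn j k (htK k)
  obtain ⟨g, hg, i, hi⟩ := Fintype.not_linearIndependent_iff.1 (show ¬ LinearIndependent ℤ
    (fun o : Option (Fin N) => o.elim (fun _ => (1 : ℤ)) n) from fun hli => by
      have := hli.fintype_card_le_finrank
      simp at this)
  simp only [Fintype.sum_option, Option.elim_none, Option.elim_some] at hg
  have hgk : ∀ k, ∑ j, g (some j) * n j k = - g none := fun k => by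
    have := congrFun hg k
    simp at this
    linarith
  obtain ⟨j, hj⟩ : ∃ j, g (some j) ≠ 0 := by
    by_contra! hz
    have := hgk ⟨0, hN⟩
    simp only [hz, zero_mul, Finset.sum_const_zero] at this
    rcases i with _ | i
    · exact hi (by linarith)
    · exact hi (hz i)
  set K := K₀ ∪ ⋃ k, T k
  have hlog : HasLog (fun z => ∏ j, ((z - x j) / (z - x₀)) ^ g (some j)) K := by
    have hexp : ∀ (m : Fin N → ℂ), Complex.exp (∑ j, g (some j) * m j) =
        ∏ j, Complex.exp (m j) ^ g (some j) := fun m => by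
      rw [Complex.exp_sum]
      exact Finset.prod_congr rfl fun j _ => Complex.exp_int_mul _ _
    have := HasLog.iUnion (ι := Option (Fin N)) (A := fun o => o.elim K₀ T)
      (f := fun z => ∏ j, ((z - x j) / (z - x₀)) ^ g (some j))
      (l := fun o => o.elim (fun z => ∑ j, g (some j) * lam j z)
        (fun k z => ∑ j, g (some j) * mu j k z + (- g none : ℤ) * (2 * Real.pi * Complex.I)))
      (by rintro (_ | k); exacts [h.closed_base, h.closed_leg k])
      (by
        rintro (_ | k)
        · exact continuousOn_finsetSum _ fun j _ => continuousOn_const.mul (hlam j)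
        · exact (continuousOn_finsetSum _ fun j _ =>
            continuousOn_const.mul (hmu j k)).add continuousOn_const)
      (by
        rintro (_ | k) z hz
        · simp only [Option.elim_none] at hz ⊢
          rw [hexp]
          exact Finset.prod_congr rfl fun j _ => by rw [hlame j z hz]
        · simp only [Option.elim_some] at hz ⊢
          rw [Complex.exp_add, hexp, Complex.exp_int_mul_two_pi_mul_I, mul_one]
          exact Finset.prod_congr rfl fun j _ => by rw [hmue j k z hz])
      (by
        have key : ∀ k, ∑ j, (g (some j) : ℂ) * lam j (t k) = ∑ j, g (some j) * mu j k (t k) +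
            (- g none : ℤ) * (2 * Real.pi * Complex.I) := fun k => by
          rw [← hgk k]
          push_cast
          rw [Finset.sum_mul, ← Finset.sum_add_distrib]
          exact Finset.sum_congr rfl fun j _ => by rw [hn j k]; ring
        rintro (_ | k) (_ | k') z ⟨hz, hz'⟩
        · rfl
        · obtain rfl : z = t k' := h.leg_base k' ⟨hz', hz⟩
          exact key k'
        · obtain rfl : z = t k := h.leg_base k ⟨hz, hz'⟩
          exact (key k).symm
        · by_cases hkk : k = k'
          · subst hkk; rfl
          · obtain rfl : z = 0 := h.leg_leg k k' hkk ⟨hz, hz'⟩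
            simp only [Option.elim_some, hmu0])
    refine this.mono ?_
    rintro z (hz | hz)
    · exact mem_iUnion.2 ⟨none, hz⟩
    · obtain ⟨k, hk⟩ := mem_iUnion.1 hz
      exact mem_iUnion.2 ⟨some k, hk⟩
  have hKc : IsClosed K := h.isClosed
  have hnotK : ∀ y ∈ Metric.ball 0 δ, (∀ k, y ∉ T k) → y ∉ K := by
    rintro y hy hyT (hyK | hyK)
    · exact disjoint_left.1 hδ hy hyK
    · obtain ⟨k, hk⟩ := mem_iUnion.1 hyK
      exact hyT k hk
  set P := connectedComponentIn Kᶜ (x j)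
  have hPo : IsOpen P := hKc.isOpen_compl.connectedComponentIn
  have hcl : ∀ y, y ∉ K → y ∉ P → y ∉ closure P := fun y hyK hyP hy =>
    hyP (closure_connectedComponentIn_inter _ _ ⟨hy, hyK⟩)
  have hfr : frontier P ⊆ K := fun z hz => by
    rw [hPo.frontier_eq] at hz
    by_contra hzK
    exact hcl z hzK hz.2 hz.1
  have hne : ∀ y, y ∉ K → y ∉ P → ∀ z ∈ closure P, z - y ≠ 0 := fun y hyK hyP z hz h' =>
    hcl y hyK hyP (sub_eq_zero.1 h' ▸ hz)
  have hx₀K := hnotK x₀ hx₀ hx₀T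
  have hxK := fun i => hnotK (x i) (hx i) (hxT i)
  refine hj (eq_zero_of_hasLog_frontier hPo
    (Metric.isBounded_ball.subset (h.component_subset (Metric.ball_subset_ball hδ1 (hx j))))
    (mem_connectedComponentIn (F := Kᶜ) (hxK j)) (h := fun z => (z - x₀)⁻¹ ^ g (some j) *
      ∏ i ∈ Finset.univ.erase j, ((z - x i) / (z - x₀)) ^ g (some i)) ?_ (fun z hz => ?_)
    ((hlog.mono hfr).congr fun z hz => ?_))
  · refine ContinuousOn.mul (ContinuousOn.zpow₀ (ContinuousOn.inv₀ (by fun_prop)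
      (hne x₀ hx₀K (hcon0 j))) _ fun z hz => Or.inl (inv_ne_zero (hne x₀ hx₀K (hcon0 j) z hz)))
      (continuousOn_finsetProd _ fun i hi => ?_)
    have hij := hne (x i) (hxK i) (hcon1 i j (Finset.ne_of_mem_erase hi))
    exact ContinuousOn.zpow₀ (ContinuousOn.div (by fun_prop) (by fun_prop)
      (hne x₀ hx₀K (hcon0 j))) _ fun z hz =>
        Or.inl (div_ne_zero (hij z hz) (hne x₀ hx₀K (hcon0 j) z hz))
  · refine mul_ne_zero (zpow_ne_zero _ (inv_ne_zero (hne x₀ hx₀K (hcon0 j) z hz)))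
      (Finset.prod_ne_zero_iff.2 fun i hi => zpow_ne_zero _ (div_ne_zero
        (hne (x i) (hxK i) (hcon1 i j (Finset.ne_of_mem_erase hi)) z hz)
        (hne x₀ hx₀K (hcon0 j) z hz)))
  · rw [← Finset.mul_prod_erase _ _ (Finset.mem_univ j), ← mul_assoc, div_eq_mul_inv, mul_zpow]

/-- A logarithm missing one leg and a logarithm missing another combine. -/
theorem log_combine (h : IsStar K₀ T t) {i j k : Fin N} (hij : i ≠ j) (hki : k ≠ i) (hkj : k ≠ j)
    {f : ℂ → ℂ} (h1 : HasLog f (K₀ ∪ ⋃ l ≠ i, T l)) (h2 : HasLog f (K₀ ∪ ⋃ l ≠ j, T l)) :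
    HasLog f (K₀ ∪ ⋃ l, T l) := by
  obtain ⟨l1, hl1, he1⟩ := h1
  obtain ⟨l2, hl2, he2⟩ := h2
  have sub : ∀ a b : Fin N, b ≠ a → T b ⊆ K₀ ∪ ⋃ l ≠ a, T l := fun a b hab z hz =>
    Or.inr (mem_iUnion₂.2 ⟨b, hab, hz⟩)
  have subS : ∀ a : Fin N, Metric.sphere 0 1 ⊆ K₀ ∪ ⋃ l ≠ a, T l := fun a z hz =>
    Or.inl (h.sphere_subset hz)
  obtain ⟨n, hn⟩ := (isPreconnected_sphere (E := ℂ) (by rw [Complex.rank_real_complex]; norm_num)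
    0 1).log_sub_const (hl1.mono (subS i)) (hl2.mono (subS j)) fun z hz => by
      rw [he1 z (subS i hz), he2 z (subS j hz)]
  obtain ⟨n', hn'⟩ := (h.preconnected_leg k).log_sub_const (hl1.mono (sub i k hki))
    (hl2.mono (sub j k hkj)) fun z hz => by
      rw [he1 z (sub i k hki hz), he2 z (sub j k hkj hz)]
  have e : (n : ℂ) * (2 * Real.pi * Complex.I) = n' * (2 * Real.pi * Complex.I) := by
    have e1 := hn _ (h.end_sphere k)
    have e2 := hn' _ (h.end_mem k)
    rw [e1] at e2
    exact add_left_cancel e2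
  have hc : IsClosed (⋃ l ≠ i, T l) := by
    rw [show (⋃ l ≠ i, T l) = ⋃ l ∈ {l | l ≠ i}, T l from rfl]
    exact (toFinite _).isClosed_biUnion fun l _ => h.closed_leg l
  refine (HasLog.union (l := l1) (l' := fun z => l2 z + n * (2 * Real.pi * Complex.I))
    (h.closed_base.union hc) (h.closed_leg i) hl1
    ((hl2.mono (sub j i hij)).add continuousOn_const) he1 (fun z hz => ?_) ?_).mono ?_
  · rw [Complex.exp_add, Complex.exp_int_mul_two_pi_mul_I, mul_one, he2 z (sub j i hij hz)]
  · rintro z ⟨hz | hz, hzi⟩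
    · obtain rfl : z = t i := h.leg_base i ⟨hzi, hz⟩
      exact hn _ (h.end_sphere i)
    · obtain ⟨l, hl, hz⟩ := mem_iUnion₂.1 hz
      obtain rfl : z = 0 := h.leg_leg l i hl ⟨hz, hzi⟩
      rw [e]
      exact hn' 0 (h.zero_mem k)
  · rintro z (hz | hz)
    · exact Or.inl (Or.inl hz)
    · obtain ⟨l, hl⟩ := mem_iUnion.1 hz
      by_cases hli : l = i
      · exact Or.inr (hli ▸ hl)
      · exact Or.inl (sub i l hli hl)

end IsStar

section Surface

variable {S : Type*} [TopologicalSpace S]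

/-- The initial part of an arc issuing from the centre of a chart. -/
theorem exists_leg [T2Space S] {φ : ℂ → S} (hφ : IsOpenEmbedding φ) {γ : ℝ → S}
    (hγ : ContinuousOn γ (Icc 0 1)) (h0 : γ 0 = φ 0) (h1 : γ 1 ∉ range φ) :
    ∃ (s : ℝ) (g : ℝ → ℂ), 0 < s ∧ s ≤ 1 ∧ ContinuousOn g (Icc 0 s) ∧
      (∀ u ∈ Icc 0 s, φ (g u) = γ u) ∧ (∀ u ∈ Ico 0 s, g u ∈ Metric.ball (0 : ℂ) 1) ∧
      g s ∈ Metric.sphere (0 : ℂ) 1 := by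
  set O := φ '' Metric.ball 0 1
  have hO : IsOpen O := hφ.isOpenMap _ Metric.isOpen_ball
  have hB : IsCompact (Icc 0 1 ∩ γ ⁻¹' Oᶜ) := by
    obtain ⟨u, hu, hu'⟩ := (continuousOn_iff_isClosed.1 hγ) Oᶜ hO.isClosed_compl
    rw [inter_comm, hu', inter_comm]
    exact isCompact_Icc.inter_right hu
  obtain ⟨s, ⟨hsI, hs⟩, hmin⟩ := hB.exists_isLeast
    ⟨1, by simp, fun h => h1 (image_subset_range _ _ h)⟩
  have hlt : ∀ u ∈ Ico 0 s, γ u ∈ O := fun u hu => by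
    by_contra h
    exact absurd (hmin ⟨⟨hu.1, hu.2.le.trans hsI.2⟩, h⟩) (not_le.2 hu.2)
  have hs0 : 0 < s := lt_of_le_of_ne hsI.1 fun h => hs (by
    rw [← h]
    exact ⟨0, by simp, h0.symm⟩)
  have hle : ∀ u ∈ Icc 0 s, γ u ∈ φ '' Metric.closedBall 0 1 := fun u hu => by
    have hm : MapsTo γ (Ico 0 s) (φ '' Metric.closedBall 0 1) := fun w hw =>
      image_mono Metric.ball_subset_closedBall (hlt w hw)
    have := hm.closure_of_continuousOn (by
      rw [closure_Ico hs0.ne]; exact hγ.mono (Icc_subset_Icc le_rfl hsI.2))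
    rw [closure_Ico hs0.ne,
      ((isCompact_closedBall (0 : ℂ) 1).image hφ.continuous).isClosed.closure_eq] at this
    exact this hu
  have hinv : ∀ u ∈ Icc 0 s, φ (Function.invFun φ (γ u)) = γ u := fun u hu => by
    obtain ⟨z, -, hz⟩ := hle u hu
    exact Function.invFun_eq ⟨z, hz⟩
  refine ⟨s, fun u => Function.invFun φ (γ u), hs0, hsI.2, ?_, hinv, fun u hu => ?_, ?_⟩
  · rw [hφ.isInducing.continuousOn_iff]
    exact (hγ.mono (Icc_subset_Icc le_rfl hsI.2)).congr hinv
  · obtain ⟨z, hz, e⟩ := hlt u hu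
    beta_reduce
    rwa [← e, Function.leftInverse_invFun hφ.injective]
  · obtain ⟨z, hz, e⟩ := hle s ⟨hs0.le, le_rfl⟩
    beta_reduce
    rw [← e, Function.leftInverse_invFun hφ.injective]
    refine le_antisymm hz (not_lt.1 fun h => hs ⟨z, h, e⟩)

theorem exists_star [T2Space S] {N : ℕ} {γ : Fin N → ℝ → S} {P : Set S} (hP : IsClosed P) {v : S}
    (hv : v ∉ Bd S) (hvP : v ∉ P) (hγ : ∀ k, ContinuousOn (γ k) (Icc 0 1))
    (hinj : ∀ k, InjOn (γ k) (Icc 0 1)) (h0 : ∀ k, γ k 0 = v)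
    (hd : ∀ k l, k ≠ l → ∀ s ∈ Icc (0 : ℝ) 1, ∀ u ∈ Icc (0 : ℝ) 1, γ k s = γ l u → s = 0) :
    ∃ (φ : ℂ → S) (K₀ : Set ℂ) (T : Fin N → Set ℂ) (t : Fin N → ℂ) (g : Fin N → ℝ → ℂ)
      (s : Fin N → ℝ), IsOpenEmbedding φ ∧ φ 0 = v ∧ IsStar K₀ T t ∧ 0 ∉ K₀ ∧
      (∀ z ∈ Metric.ball (0 : ℂ) 1, z ∈ K₀ ∪ ⋃ k, T k ↔ φ z ∈ P ∪ ⋃ k, γ k '' Icc 0 1) ∧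
      ∀ k, 0 < s k ∧ s k ≤ 1 ∧ ContinuousOn (g k) (Icc 0 (s k)) ∧
        (∀ u ∈ Icc 0 (s k), φ (g k u) = γ k u) ∧ T k = g k '' Icc 0 (s k) := by
  have hcl : ∀ k, ∀ a b : ℝ, 0 ≤ a → b ≤ 1 → IsClosed (γ k '' Icc a b) := fun k a b ha hb =>
    (isCompact_Icc.image_of_continuousOn ((hγ k).mono (Icc_subset_Icc ha hb))).isClosed
  have hends : ∀ k, γ k 1 ≠ v := fun k h => by
    have := hinj k (by simp) (by simp) (h.trans (h0 k).symm)
    norm_num at this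
  obtain ⟨φ, hφ, hφ0, hφN⟩ := exists_chart (N := (P ∪ range fun k => γ k 1)ᶜ) hv
    ((hP.union (finite_range _).isClosed).isOpen_compl.mem_nhds (by
      rintro (h | ⟨k, hk⟩)
      exacts [hvP h, hends k hk]))
  have hleg := fun k => exists_leg hφ (hγ k) ((h0 k).trans hφ0.symm)
    (fun h => hφN h (Or.inr ⟨k, rfl⟩))
  choose s g hs0 hs1 hg hφg hball hsph using hleg
  have hI : ∀ k, Icc 0 (s k) ⊆ Icc 0 1 := fun k => Icc_subset_Icc le_rfl (hs1 k)
  have hI' : ∀ k, Icc (s k) 1 ⊆ Icc 0 1 := fun k => Icc_subset_Icc (hs0 k).le le_rfl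
  have hginj : ∀ k, InjOn (g k) (Icc 0 (s k)) := fun k a ha b hb hab =>
    hinj k (hI k ha) (hI k hb) (by rw [← hφg k a ha, ← hφg k b hb, hab])
  have hg0 : ∀ k, g k 0 = 0 := fun k => hφ.injective (by
    rw [hφg k 0 ⟨le_rfl, (hs0 k).le⟩, h0, hφ0])
  set K₀ : Set ℂ := Metric.sphere 0 1 ∪
    (φ ⁻¹' (⋃ k, γ k '' Icc (s k) 1) ∩ Metric.closedBall 0 1)
  have hbK : ∀ z ∈ K₀, z ∈ Metric.ball (0 : ℂ) 1 → ∃ k, ∃ u ∈ Icc (s k) 1, γ k u = φ z := by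
    rintro z (hz | ⟨hz, -⟩) hz1
    · exact absurd hz (Metric.mem_ball.1 hz1).ne
    · obtain ⟨k, u, hu, e⟩ := mem_iUnion.1 hz
      exact ⟨k, u, hu, e⟩
  refine ⟨φ, K₀, fun k => g k '' Icc 0 (s k), fun k => g k (s k), g, s, hφ, hφ0, ?_, ?_, ?_,
    fun k => ⟨hs0 k, hs1 k, hg k, hφg k, rfl⟩⟩
  · constructor
    · exact Metric.isClosed_sphere.union (((isClosed_iUnion_of_finite fun k =>
        hcl k _ _ (hs0 k).le le_rfl).preimage hφ.continuous).inter Metric.isClosed_closedBall)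
    · exact subset_union_left
    · exact fun k => (isCompact_Icc.image_of_continuousOn (hg k)).isClosed
    · exact fun k f hf hf0 => hasLog_arc (hs0 k).le (hg k) (hginj k) hf hf0
    · exact fun k => isPreconnected_Icc.image _ (hg k)
    · exact fun k => ⟨0, ⟨le_rfl, (hs0 k).le⟩, hg0 k⟩
    · exact fun k => ⟨s k, ⟨(hs0 k).le, le_rfl⟩, rfl⟩
    · exact hsph
    · rintro k _ ⟨⟨u, hu, rfl⟩, hK⟩
      by_contra hne
      have hus : u < s k := lt_of_le_of_ne hu.2 fun h => hne (h ▸ rfl)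
      obtain ⟨l, w, hw, e⟩ := hbK _ hK (hball k u ⟨hu.1, hus⟩)
      rw [hφg k u hu] at e
      by_cases hkl : k = l
      · subst hkl
        have := hinj k (hI' k hw) (hI k hu) e
        exact absurd hw.1 (not_le.2 (this ▸ hus))
      · have := hd l k (Ne.symm hkl) w (hI' l hw) u (hI k hu) e
        exact absurd hw.1 (not_le.2 (this ▸ hs0 l))
    · rintro k l hkl _ ⟨⟨u, hu, rfl⟩, ⟨w, hw, e⟩⟩
      have : γ k u = γ l w := by rw [← hφg k u hu, ← hφg l w hw, e]
      rw [hd k l hkl u (hI k hu) w (hI l hw) this, hg0]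
      rfl
  · intro h
    obtain ⟨k, u, hu, e⟩ := hbK 0 h (by simp)
    rw [hφ0, ← h0 k] at e
    have := hinj k (hI' k hu) (by simp) e
    exact absurd hu.1 (not_le.2 (this ▸ hs0 k))
  · intro z hz
    constructor
    · rintro (h | h)
      · obtain ⟨k, u, hu, e⟩ := hbK z h hz
        exact Or.inr (mem_iUnion.2 ⟨k, u, hI' k hu, e⟩)
      · obtain ⟨k, u, hu, rfl⟩ := mem_iUnion.1 h
        exact Or.inr (mem_iUnion.2 ⟨k, u, hI k hu, (hφg k u hu).symm⟩)
    · rintro (h | h)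
      · exact absurd (Or.inl h) (hφN ⟨z, rfl⟩)
      · obtain ⟨k, u, hu, e⟩ := mem_iUnion.1 h
        rcases le_total u (s k) with hus | hus
        · refine Or.inr (mem_iUnion.2 ⟨k, u, ⟨hu.1, hus⟩, hφ.injective ?_⟩)
          rw [hφg k u ⟨hu.1, hus⟩, e]
        · exact Or.inl (Or.inr ⟨mem_iUnion.2 ⟨k, u, ⟨hus, hu.2⟩, e⟩,
            Metric.ball_subset_closedBall hz⟩)

/-- The data of `N` arcs issuing from `v`, disjoint from each other and from `P`. -/
structure IsFan {N : ℕ} (v : S) (γ : Fin N → ℝ → S) (P : Set S) : Prop where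
  closed : IsClosed P
  notMem_Bd : v ∉ Bd S
  notMem : v ∉ P
  cont : ∀ k, ContinuousOn (γ k) (Icc 0 1)
  inj : ∀ k, InjOn (γ k) (Icc 0 1)
  start : ∀ k, γ k 0 = v
  disj : ∀ k l, k ≠ l → ∀ s ∈ Icc (0 : ℝ) 1, ∀ u ∈ Icc (0 : ℝ) 1, γ k s = γ l u → s = 0

/-- Planar components inside a star map into a single component of the complement. -/
theorem mem_component_of_star {N : ℕ} {φ : ℂ → S} (hφ : IsOpenEmbedding φ) {K₀ : Set ℂ}
    {T : Fin N → Set ℂ} {t : Fin N → ℂ} (hst : IsStar K₀ T t) {X : Set S}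
    (hX : ∀ z ∈ Metric.ball (0 : ℂ) 1, z ∈ K₀ ∪ ⋃ k, T k ↔ φ z ∈ X) {x y : ℂ}
    (hx : x ∈ Metric.ball (0 : ℂ) 1) (hy : y ∈ connectedComponentIn (K₀ ∪ ⋃ k, T k)ᶜ x) :
    φ y ∈ connectedComponentIn Xᶜ (φ x) := by
  have hsub := hst.component_subset hx
  have hxK : x ∈ (K₀ ∪ ⋃ k, T k)ᶜ := connectedComponentIn_nonempty_iff.1 ⟨y, hy⟩
  refine (isPreconnected_connectedComponentIn.image φ
    hφ.continuous.continuousOn).subset_connectedComponentIn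
    (mem_image_of_mem φ (mem_connectedComponentIn hxK)) ?_ (mem_image_of_mem φ hy)
  rintro _ ⟨w, hw, rfl⟩
  exact fun h => connectedComponentIn_subset _ _ hw ((hX w (hsub hw)).2 h)

/-- Near `v`, a fan of `N` arcs has at most `N` local sides. -/
theorem IsFan.sectors [T2Space S] {N : ℕ} (hN : 0 < N) {γ : Fin N → ℝ → S} {P : Set S} {v : S}
    (hf : IsFan v γ P) : ∃ B ∈ 𝓝 v, ∀ (x₀ : S) (x : Fin N → S),
      x₀ ∈ B → (∀ j, x j ∈ B) → x₀ ∉ P ∪ ⋃ k, γ k '' Icc 0 1 →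
      (∀ j, x j ∉ P ∪ ⋃ k, γ k '' Icc 0 1) →
      (∃ j, x₀ ∈ connectedComponentIn (P ∪ ⋃ k, γ k '' Icc 0 1)ᶜ (x j)) ∨
      ∃ i j, i ≠ j ∧ x i ∈ connectedComponentIn (P ∪ ⋃ k, γ k '' Icc 0 1)ᶜ (x j) := by
  obtain ⟨φ, K₀, T, t, g, s, hφ, hφ0, hst, h0K, hX, -⟩ :=
    exists_star hf.closed hf.notMem_Bd hf.notMem hf.cont hf.inj hf.start hf.disj
  obtain ⟨δ, hδ, hδb⟩ := Metric.isOpen_iff.1 hst.closed_base.isOpen_compl 0 h0K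
  set δ' := min δ 1
  have hδ' : 0 < δ' := lt_min hδ one_pos
  have hδ1 : δ' ≤ 1 := min_le_right _ _
  have hb1 : Metric.ball (0 : ℂ) δ' ⊆ Metric.ball 0 1 := Metric.ball_subset_ball hδ1
  refine ⟨φ '' Metric.ball 0 δ', (hφ.isOpenMap _ Metric.isOpen_ball).mem_nhds
    ⟨0, by simpa, hφ0⟩, ?_⟩
  rintro x₀ x ⟨z₀, hz₀, rfl⟩ hx hx₀X hxX
  choose z hz hzx using hx
  obtain rfl : (fun j => φ (z j)) = x := funext hzx
  have hnot : ∀ w ∈ Metric.ball (0 : ℂ) δ', φ w ∉ P ∪ ⋃ k, γ k '' Icc 0 1 → ∀ k, w ∉ T k :=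
    fun w hw hwX k hk => hwX ((hX w (hb1 hw)).1 (Or.inr (mem_iUnion.2 ⟨k, hk⟩)))
  rcases hst.sectors hN hδ1 (disjoint_left.2 fun w hw hw' =>
    hδb (Metric.ball_subset_ball (min_le_left _ _) hw) hw') hz₀ hz (hnot _ hz₀ hx₀X)
    (fun j => hnot _ (hz j) (hxX j)) with ⟨j, hj⟩ | ⟨i, j, hij, h⟩
  · exact Or.inl ⟨j, mem_component_of_star hφ hst hX (hb1 (hz j)) hj⟩
  · exact Or.inr ⟨i, j, hij, mem_component_of_star hφ hst hX (hb1 (hz j)) h⟩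

theorem exists_common_pair {α : Type*} {X Y : Fin 3 → α} (hXY : ∀ i j, X i ≠ Y j)
    (h : ∀ (w₀ : α) (w : Fin 3 → α), w₀ ∈ range X ∪ range Y → (∀ j, w j ∈ range X ∪ range Y) →
      (∃ j, w₀ = w j) ∨ ∃ i j, i ≠ j ∧ w i = w j) : ∃ i j, i ≠ j ∧ X i = X j ∧ Y i = Y j := by
  have key : ∀ a b c, a ≠ b → a ≠ c → b ≠ c → Y a = Y b → X a = X c →
      ∃ i j, i ≠ j ∧ X i = X j ∧ Y i = Y j := fun a b c hab hac hbc hY hX => by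
    rcases h (Y c) ![X a, X b, Y a] (by simp) (by intro j; fin_cases j <;> simp) with
      ⟨j, hj⟩ | ⟨i, j, hij, e⟩
    · fin_cases j
      · exact absurd hj.symm (hXY _ _)
      · exact absurd hj.symm (hXY _ _)
      · exact ⟨a, c, hac, hX, hj.symm⟩
    · have hab' : X a = X b → ∃ i j, i ≠ j ∧ X i = X j ∧ Y i = Y j := fun e => ⟨a, b, hab, e, hY⟩
      fin_cases i <;> fin_cases j <;> simp at hij e <;>
        first
        | exact hab' e
        | exact hab' e.symm
        | exact absurd e (hXY _ _)
        | exact absurd e.symm (hXY _ _)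
  rcases h (X 0) Y (by simp) (by simp) with ⟨j, hj⟩ | ⟨i, j, hij, e⟩
  · exact absurd hj (hXY _ _)
  rcases h (Y 0) X (by simp) (by simp) with ⟨j, hj⟩ | ⟨i', j', hij', e'⟩
  · exact absurd hj.symm (hXY _ _)
  by_cases h1 : i' = i
  · subst h1
    by_cases h2 : j' = j
    · subst h2
      exact ⟨_, _, hij, e', e⟩
    · exact key _ _ _ hij hij' (Ne.symm h2) e e'
  · by_cases h2 : i' = j
    · subst h2
      by_cases h3 : j' = i
      · subst h3
        exact ⟨_, _, hij', e', e.symm⟩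
      · exact key _ _ _ (Ne.symm hij) hij' (Ne.symm h3) e.symm e'
    · by_cases h3 : j' = i
      · subst h3
        exact key _ _ _ hij (Ne.symm h1) (Ne.symm h2) e e'.symm
      · have h4 : j' = j := by omega
        subst h4
        exact key _ _ _ (Ne.symm hij) (Ne.symm h2) (Ne.symm h1) e.symm e'.symm

/-- Two sides cannot alternate around a vertex of degree three. -/
theorem IsFan.not_three [T2Space S] {γ : Fin 3 → ℝ → S} {P : Set S} {v : S} (hf : IsFan v γ P)
    {E : Set S} (hE : IsSide E (P ∪ ⋃ k, γ k '' Icc 0 1))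
    (hess : ∀ k, ∀ u ∈ Ioo (0 : ℝ) 1, γ k u ∈ closure E ∧
      γ k u ∈ closure (E ∪ (P ∪ ⋃ k, γ k '' Icc 0 1))ᶜ) : False := by
  obtain ⟨φ, K₀, T, t, g, s, hφ, hφ0, hst, h0K, hX, hg⟩ :=
    exists_star hf.closed hf.notMem_Bd hf.notMem hf.cont hf.inj hf.start hf.disj
  set X := P ∪ ⋃ k, γ k '' Icc 0 1
  obtain ⟨δ, hδ, hδb⟩ := Metric.isOpen_iff.1 hst.closed_base.isOpen_compl 0 h0K
  set δ' := min δ 1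
  have hδ' : 0 < δ' := lt_min hδ one_pos
  have hδ1 : δ' ≤ 1 := min_le_right _ _
  have hb1 : Metric.ball (0 : ℂ) δ' ⊆ Metric.ball 0 1 := Metric.ball_subset_ball hδ1
  have hbK : Disjoint (Metric.ball 0 δ') K₀ := disjoint_left.2 fun w hw hw' =>
    hδb (Metric.ball_subset_ball (min_le_left _ _) hw) hw'
  have hloc : ∀ k, ∃ p ε, 0 < ε ∧ Metric.ball p ε ⊆ Metric.ball 0 δ' ∧
      (∀ l, l ≠ k → Disjoint (Metric.ball p ε) (T l)) ∧
      φ p ∈ closure E ∧ φ p ∈ closure (E ∪ X)ᶜ := fun k => by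
    obtain ⟨hs0, hs1, hgc, hφg, hT⟩ := hg k
    have hg0 : g k 0 = 0 := hφ.injective (by rw [hφg 0 ⟨le_rfl, hs0.le⟩, hf.start, hφ0])
    have hnear : ∀ᶠ u in 𝓝[Icc 0 (s k)] 0, g k u ∈ Metric.ball (0 : ℂ) δ' :=
      (hgc 0 ⟨le_rfl, hs0.le⟩).eventually (by
        rw [hg0]; exact Metric.isOpen_ball.mem_nhds (by simpa))
    have hnear' : ∀ᶠ u in 𝓝[Ioo 0 (s k)] 0, g k u ∈ Metric.ball (0 : ℂ) δ' :=
      nhdsWithin_mono _ Ioo_subset_Icc_self hnear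
    have : (𝓝[Ioo 0 (s k)] (0 : ℝ)).NeBot :=
      mem_closure_iff_nhdsWithin_neBot.1 (by rw [closure_Ioo hs0.ne]; exact ⟨le_rfl, hs0.le⟩)
    obtain ⟨u, hu, huI⟩ := (hnear'.and self_mem_nhdsWithin).exists
    have huI' : u ∈ Icc 0 (s k) := Ioo_subset_Icc_self huI
    have hne : g k u ≠ 0 := fun h => by
      have := hf.inj k ⟨huI.1.le, huI.2.le.trans hs1⟩ (by simp)
        (by rw [← hφg u huI', h, hφ0, hf.start] : γ k u = γ k 0)
      exact absurd this huI.1.ne'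
    have hcl : IsClosed (⋃ l ≠ k, T l) := by
      rw [show (⋃ l ≠ k, T l) = ⋃ l ∈ {l | l ≠ k}, T l from rfl]
      exact (toFinite _).isClosed_biUnion fun l _ => hst.closed_leg l
    obtain ⟨ε, hε, hεb⟩ := Metric.isOpen_iff.1 (Metric.isOpen_ball.inter hcl.isOpen_compl)
      (g k u) ⟨hu, fun h => by
        obtain ⟨l, hl, hz⟩ := mem_iUnion₂.1 h
        exact hne (hst.leg_leg l k hl ⟨hz, hT ▸ mem_image_of_mem _ huI'⟩)⟩
    refine ⟨g k u, ε, hε, fun z hz => (hεb hz).1, fun l hl => disjoint_left.2 fun z hz hz' =>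
      (hεb hz).2 (mem_iUnion₂.2 ⟨l, hl, hz'⟩), ?_⟩
    rw [hφg u huI']
    exact hess k u ⟨huI.1, huI.2.trans_le hs1⟩
  choose p ε hε hpδ hpT hpE hpE' using hloc
  have hnb : ∀ k, φ '' Metric.ball (p k) (ε k) ∈ 𝓝 (φ (p k)) := fun k =>
    (hφ.isOpenMap _ Metric.isOpen_ball).mem_nhds ⟨p k, Metric.mem_ball_self (hε k), rfl⟩
  have hx : ∀ k, ∃ z ∈ Metric.ball (p k) (ε k), φ z ∈ E := fun k => by
    obtain ⟨_, ⟨z, hz, rfl⟩, hzE⟩ := mem_closure_iff_nhds.1 (hpE k) _ (hnb k)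
    exact ⟨z, hz, hzE⟩
  have hy : ∀ k, ∃ z ∈ Metric.ball (p k) (ε k), φ z ∈ (E ∪ X)ᶜ := fun k => by
    obtain ⟨_, ⟨z, hz, rfl⟩, hzE⟩ := mem_closure_iff_nhds.1 (hpE' k) _ (hnb k)
    exact ⟨z, hz, hzE⟩
  choose x hxb hxE using hx
  choose y hyb hyE using hy
  set K := K₀ ∪ ⋃ k, T k
  have hKc : IsClosed K := hst.isClosed
  have hxK : ∀ k, x k ∉ K := fun k h =>
    disjoint_left.1 hE.2.1 (hxE k) ((hX _ (hb1 (hpδ k (hxb k)))).1 h)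
  have hyK : ∀ k, y k ∉ K := fun k h => hyE k (Or.inr ((hX _ (hb1 (hpδ k (hyb k)))).1 h))
  have hsame : ∀ z w, z ∉ K → connectedComponentIn Kᶜ z = connectedComponentIn Kᶜ w →
      z ∈ connectedComponentIn Kᶜ w := fun z w hz h => h ▸ mem_connectedComponentIn hz
  have hnxy : ∀ i j, y j ∉ connectedComponentIn Kᶜ (x i) := fun i j h => by
    have := mem_component_of_star hφ hst hX (hb1 (hpδ i (hxb i))) h
    refine hyE j (Or.inl (hE.subset_of_isPreconnected isPreconnected_connectedComponentIn
      (disjoint_left.2 fun z hz => connectedComponentIn_subset _ _ hz)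
      (mem_connectedComponentIn (fun h => disjoint_left.1 hE.2.1 (hxE i) h)) (hxE i) this))
  have hmem : ∀ C ∈ range (fun k => connectedComponentIn Kᶜ (x k)) ∪
      range (fun k => connectedComponentIn Kᶜ (y k)), ∃ z ∈ Metric.ball (0 : ℂ) δ',
        z ∉ K ∧ C = connectedComponentIn Kᶜ z := by
    rintro _ (⟨k, rfl⟩ | ⟨k, rfl⟩)
    exacts [⟨x k, hpδ k (hxb k), hxK k, rfl⟩, ⟨y k, hpδ k (hyb k), hyK k, rfl⟩]
  obtain ⟨i, j, hij, ex, ey⟩ := exists_common_pair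
    (X := fun k => connectedComponentIn Kᶜ (x k)) (Y := fun k => connectedComponentIn Kᶜ (y k))
    (fun i j h => hnxy i j (hsame _ _ (hyK j) h.symm)) (fun w₀ w h₀ h => by
      obtain ⟨z₀, hz₀, hz₀K, rfl⟩ := hmem _ h₀
      choose z hz hzK e using fun j => hmem _ (h j)
      rcases hst.sectors (by norm_num) hδ1 hbK hz₀ hz
        (fun k hk => hz₀K (Or.inr (mem_iUnion.2 ⟨k, hk⟩)))
        (fun j k hk => hzK j (Or.inr (mem_iUnion.2 ⟨k, hk⟩))) with ⟨j, hj⟩ | ⟨i, j, hij, h⟩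
      · exact Or.inl ⟨j, by rw [e j, connectedComponentIn_eq hj]⟩
      · exact Or.inr ⟨i, j, hij, by rw [e i, e j, connectedComponentIn_eq h]⟩)
  have hfar : ∀ k, HasLog (fun z => (z - x k) / (z - y k)) (K₀ ∪ ⋃ l ≠ k, T l) := fun k => by
    refine (hasLog_moebius_of_far (hxb k) (hyb k)).mono ?_
    rintro z (hz | hz)
    · exact not_lt.1 fun h => disjoint_left.1 hbK (hpδ k (Metric.mem_ball.2 h)) hz
    · obtain ⟨l, hl, hz⟩ := mem_iUnion₂.1 hz
      exact not_lt.1 fun h => disjoint_left.1 (hpT k l hl) (Metric.mem_ball.2 h) hz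
  have hsub : ∀ k, (K₀ ∪ ⋃ l ≠ k, T l) ⊆ K := fun k => union_subset_union_right _
    (iUnion_mono fun l => iUnion_subset fun _ => le_rfl)
  have hfi : HasLog (fun z => (z - x i) / (z - y i)) (K₀ ∪ ⋃ l ≠ j, T l) := by
    have h1 := (hasLog_of_mem_component hKc (hxK j) (hsame _ _ (hxK i) ex)).mono (hsub j)
    have h2 := (hasLog_of_mem_component hKc (hyK i) (hsame _ _ (hyK j) ey.symm)).mono (hsub j)
    refine ((h1.mul (hfar j)).mul h2).congr fun z hz => ?_
    have hzx : ∀ k, z - x k ≠ 0 := fun k h => hxK k (sub_eq_zero.1 h ▸ hsub j hz)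
    have hzy : ∀ k, z - y k ≠ 0 := fun k h => hyK k (sub_eq_zero.1 h ▸ hsub j hz)
    have a1 := hzx j
    have a2 := hzy i
    have a3 := hzy j
    field_simp
  obtain ⟨k, hki, hkj⟩ : ∃ k : Fin 3, k ≠ i ∧ k ≠ j :=
    (by decide : ∀ i j : Fin 3, i ≠ j → ∃ k, k ≠ i ∧ k ≠ j) i j hij
  exact hnxy i i (mem_component_of_hasLog hKc (hxK i) (hyK i)
    (Metric.isBounded_ball.subset (hst.component_subset (hb1 (hpδ i (hxb i)))))
    (hst.log_combine hij hki hkj (hfar i) hfi))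

end Surface

/-! ### Edges -/

section Edges

variable {S : Type*}

/-- The affine reparametrization of `[a, b]` by the unit interval. -/
def reparam (γ : ℝ → S) (a b : ℝ) : ℝ → S := fun t => γ (a + (b - a) * t)

@[simp] theorem reparam_zero (γ : ℝ → S) (a b : ℝ) : reparam γ a b 0 = γ a := by simp [reparam]

@[simp] theorem reparam_one (γ : ℝ → S) (a b : ℝ) : reparam γ a b 1 = γ b := by simp [reparam]

theorem affine_mem_Icc {a b t : ℝ} (hab : a ≤ b) (ht : t ∈ Icc (0 : ℝ) 1) :
    a + (b - a) * t ∈ Icc a b := by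
  have h1 := mul_nonneg (sub_nonneg.2 hab) ht.1
  have h2 := mul_le_mul_of_nonneg_left ht.2 (sub_nonneg.2 hab)
  constructor <;> linarith

theorem affine_mem_Ioo {a b t : ℝ} (hab : a < b) (ht : t ∈ Ioo (0 : ℝ) 1) :
    a + (b - a) * t ∈ Ioo a b := by
  have h1 := mul_pos (sub_pos.2 hab) ht.1
  have h2 := mul_lt_mul_of_pos_left ht.2 (sub_pos.2 hab)
  constructor <;> linarith

theorem affine_mem_uIcc {a b t : ℝ} (ht : t ∈ Icc (0 : ℝ) 1) :
    a + (b - a) * t ∈ uIcc a b := by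
  rcases le_total a b with h | h
  · rw [uIcc_of_le h]
    exact affine_mem_Icc h ht
  · rw [uIcc_of_ge h]
    have := affine_mem_Icc h ⟨sub_nonneg.2 ht.2, sub_le_self 1 ht.1⟩
    convert this using 1
    ring

theorem exists_affine {a b s : ℝ} (hs : s ∈ uIcc a b) :
    ∃ t ∈ Icc (0 : ℝ) 1, a + (b - a) * t = s := by
  rw [← segment_eq_uIcc, segment_eq_image'] at hs
  obtain ⟨t, ht, rfl⟩ := hs
  exact ⟨t, ht, by simp [mul_comm]⟩

theorem reparam_image (γ : ℝ → S) (a b : ℝ) : reparam γ a b '' Icc 0 1 = γ '' uIcc a b := by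
  ext x
  constructor
  · rintro ⟨t, ht, rfl⟩
    exact ⟨_, affine_mem_uIcc ht, rfl⟩
  · rintro ⟨s, hs, rfl⟩
    obtain ⟨t, ht, rfl⟩ := exists_affine hs
    exact ⟨t, ht, rfl⟩

theorem reparam_image_of_le (γ : ℝ → S) {a b : ℝ} (hab : a ≤ b) :
    reparam γ a b '' Icc 0 1 = γ '' Icc a b := by
  rw [reparam_image, uIcc_of_le hab]

theorem InjOn.reparam {γ : ℝ → S} {a b : ℝ} (hab : a ≠ b) (h : InjOn γ (uIcc a b)) :
    InjOn (reparam γ a b) (Icc 0 1) := fun s hs t ht e => by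
  have := h (affine_mem_uIcc hs) (affine_mem_uIcc ht) e
  exact mul_left_cancel₀ (sub_ne_zero.2 hab.symm) (add_left_cancel this)

theorem reverse_image (γ : ℝ → S) : reparam γ 1 0 '' Icc 0 1 = γ '' Icc 0 1 := by
  rw [reparam_image, uIcc_of_ge zero_le_one]

/-- Concatenation of two edges. -/
noncomputable def concat (α β : ℝ → S) : ℝ → S := fun t => if t ≤ 1 / 2 then α (2 * t) else β (2 * t - 1)

theorem concat_of_le (α β : ℝ → S) {t : ℝ} (ht : t ≤ 1 / 2) : concat α β t = α (2 * t) :=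
  if_pos ht

theorem concat_of_lt (α β : ℝ → S) {t : ℝ} (ht : 1 / 2 < t) : concat α β t = β (2 * t - 1) :=
  if_neg (not_le.2 ht)

@[simp] theorem concat_zero (α β : ℝ → S) : concat α β 0 = α 0 := by simp [concat]

@[simp] theorem concat_one (α β : ℝ → S) : concat α β 1 = β 1 := by norm_num [concat]

theorem concat_image {α β : ℝ → S} (h : α 1 = β 0) :
    concat α β '' Icc 0 1 = α '' Icc 0 1 ∪ β '' Icc 0 1 := by
  ext x
  constructor
  · rintro ⟨t, ht, rfl⟩
    rcases le_or_gt t (1 / 2) with h' | h'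
    · rw [concat_of_le _ _ h']
      exact Or.inl ⟨_, ⟨by linarith [ht.1], by linarith⟩, rfl⟩
    · rw [concat_of_lt _ _ h']
      exact Or.inr ⟨_, ⟨by linarith, by linarith [ht.2]⟩, rfl⟩
  · rintro (⟨t, ht, rfl⟩ | ⟨t, ht, rfl⟩)
    · refine ⟨t / 2, ⟨by linarith [ht.1], by linarith [ht.2]⟩, ?_⟩
      rw [concat_of_le _ _ (by linarith [ht.2])]
      congr 1
      ring
    · rcases ht.1.eq_or_lt with rfl | h0
      · refine ⟨1 / 2, by norm_num, ?_⟩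
        rw [concat_of_le _ _ le_rfl, ← h]
        norm_num
      · refine ⟨(t + 1) / 2, ⟨by linarith, by linarith [ht.2]⟩, ?_⟩
        rw [concat_of_lt _ _ (by linarith)]
        congr 1
        ring

theorem iUnion_thirds_eq {N : ℕ} (γ : Fin N → ℝ → S) (P : Set S) :
    (P ∪ ⋃ k, γ k '' Icc (1 / 3) 1) ∪ ⋃ k, (fun t => γ k (t / 3)) '' Icc 0 1 =
      P ∪ ⋃ k, γ k '' Icc 0 1 := by
  rw [union_assoc, ← iUnion_union_distrib]
  congr 2
  ext k : 1
  have e : (fun t : ℝ => t / 3) '' Icc 0 1 = Icc 0 (1 / 3) := by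
    ext t
    constructor
    · rintro ⟨u, hu, rfl⟩
      constructor <;> linarith [hu.1, hu.2]
    · exact fun ht => ⟨3 * t, by constructor <;> linarith [ht.1, ht.2], by ring⟩
  rw [← image_image (γ k) (fun t => t / 3), e, ← image_union]
  congr 1
  ext t
  simp only [mem_Icc, mem_union]
  constructor
  · rintro (h | h) <;> constructor <;> linarith [h.1, h.2]
  · rintro ⟨h1, h2⟩
    rcases le_total t (1 / 3) with h | h
    · exact Or.inr ⟨h1, h⟩
    · exact Or.inl ⟨h, h2⟩

variable [TopologicalSpace S]

/-- An arc or a loop, parametrized by the unit interval. -/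
def IsEdge (γ : ℝ → S) : Prop := ContinuousOn γ (Icc 0 1) ∧
  ∀ s ∈ Icc (0 : ℝ) 1, ∀ t ∈ Icc (0 : ℝ) 1, s < t → γ s = γ t → s = 0 ∧ t = 1

theorem isEdge_of_injOn {γ : ℝ → S} (hγ : ContinuousOn γ (Icc 0 1)) (h : InjOn γ (Icc 0 1)) :
    IsEdge γ :=
  ⟨hγ, fun _ hs _ ht hst e => absurd (h hs ht e) hst.ne⟩

namespace IsEdge

variable {γ δ : ℝ → S}

theorem congr (h : IsEdge γ) (he : EqOn δ γ (Icc 0 1)) : IsEdge δ :=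
  ⟨h.1.congr he, fun s hs t ht hst e => h.2 s hs t ht hst (by rwa [← he hs, ← he ht])⟩

theorem injOn (h : IsEdge γ) (h01 : γ 0 ≠ γ 1) : InjOn γ (Icc 0 1) := fun s hs t ht e => by
  rcases lt_trichotomy s t with hst | hst | hst
  · obtain ⟨rfl, rfl⟩ := h.2 s hs t ht hst e
    exact absurd e h01
  · exact hst
  · obtain ⟨rfl, rfl⟩ := h.2 t ht s hs hst e.symm
    exact absurd e.symm h01

theorem eq_of_mem_Ioo (h : IsEdge γ) {s t : ℝ} (hs : s ∈ Ioo (0 : ℝ) 1) (ht : t ∈ Icc (0 : ℝ) 1)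
    (e : γ s = γ t) : s = t := by
  rcases lt_trichotomy s t with hst | hst | hst
  · exact absurd (h.2 s (Ioo_subset_Icc_self hs) t ht hst e).1 hs.1.ne'
  · exact hst
  · exact absurd (h.2 t ht s (Ioo_subset_Icc_self hs) hst e.symm).2 hs.2.ne

theorem isCompact_image (h : IsEdge γ) : IsCompact (γ '' Icc 0 1) :=
  isCompact_Icc.image_of_continuousOn h.1

theorem isClosed_image [T2Space S] (h : IsEdge γ) : IsClosed (γ '' Icc 0 1) :=
  h.isCompact_image.isClosed

theorem isClosed_image_Icc [T2Space S] (h : IsEdge γ) {a b : ℝ} (ha : 0 ≤ a) (hb : b ≤ 1) :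
    IsClosed (γ '' Icc a b) :=
  (isCompact_Icc.image_of_continuousOn (h.1.mono (Icc_subset_Icc ha hb))).isClosed

theorem injOn_Icc (h : IsEdge γ) {a b : ℝ} (ha : 0 ≤ a) (hb : b ≤ 1) (hab : 0 < a ∨ b < 1) :
    InjOn γ (Icc a b) := fun s hs t ht e => by
  have hI : Icc a b ⊆ Icc 0 1 := Icc_subset_Icc ha hb
  rcases lt_trichotomy s t with hst | hst | hst
  · obtain ⟨rfl, rfl⟩ := h.2 s (hI hs) t (hI ht) hst e
    rcases hab with h | h
    · exact absurd hs.1 (not_le.2 h)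
    · exact absurd ht.2 (not_le.2 h)
  · exact hst
  · obtain ⟨rfl, rfl⟩ := h.2 t (hI ht) s (hI hs) hst e.symm
    rcases hab with h | h
    · exact absurd ht.1 (not_le.2 h)
    · exact absurd hs.2 (not_le.2 h)

end IsEdge

theorem ContinuousOn.reparam {γ : ℝ → S} {a b : ℝ} (h : ContinuousOn γ (uIcc a b)) :
    ContinuousOn (reparam γ a b) (Icc 0 1) :=
  ContinuousOn.comp h (by fun_prop) fun _ ht => affine_mem_uIcc ht

theorem IsEdge.reparam {γ : ℝ → S} (h : IsEdge γ) {a b : ℝ} (ha : 0 ≤ a) (hab : a < b)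
    (hb : b ≤ 1) : IsEdge (reparam γ a b) := by
  have hI : Icc a b ⊆ Icc 0 1 := Icc_subset_Icc ha hb
  refine ⟨ContinuousOn.reparam (by rw [uIcc_of_le hab.le]; exact h.1.mono hI),
    fun s hs t ht hst e => ?_⟩
  have hs' := affine_mem_Icc hab.le hs
  have ht' := affine_mem_Icc hab.le ht
  have hlt : a + (b - a) * s < a + (b - a) * t := by
    have := mul_lt_mul_of_pos_left hst (sub_pos.2 hab)
    linarith
  obtain ⟨e1, e2⟩ := h.2 _ (hI hs') _ (hI ht') hlt e
  have h1 : (b - a) * s = 0 := le_antisymm (by linarith) (mul_nonneg (sub_pos.2 hab).le hs.1)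
  have h2 : (b - a) * (1 - t) = 0 := le_antisymm (by nlinarith)
    (mul_nonneg (sub_pos.2 hab).le (sub_nonneg.2 ht.2))
  have h3 := (sub_pos.2 hab).ne'
  constructor
  · simpa [h3] using h1
  · have := (mul_eq_zero.1 h2).resolve_left h3
    linarith

theorem IsEdge.reverse {γ : ℝ → S} (h : IsEdge γ) : IsEdge (_root_.reparam γ 1 0) := by
  refine ⟨ContinuousOn.reparam (by rw [uIcc_of_ge zero_le_one]; exact h.1),
    fun s hs t ht hst e => ?_⟩
  have := h.2 (1 + (0 - 1) * t) ⟨by linarith [ht.2], by linarith [ht.1]⟩ (1 + (0 - 1) * s)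
    ⟨by linarith [hs.2], by linarith [hs.1]⟩ (by linarith) e.symm
  constructor <;> linarith

theorem IsEdge.concat {α β : ℝ → S} (hα : IsEdge α) (hβ : IsEdge β) (hα' : α 0 ≠ α 1)
    (hβ' : β 0 ≠ β 1) (h : α 1 = β 0)
    (hd : ∀ s ∈ Icc (0 : ℝ) 1, ∀ t ∈ Icc (0 : ℝ) 1, α s = β t → (s = 1 ∧ t = 0) ∨ (s = 0 ∧ t = 1)) :
    IsEdge (concat α β) := by
  have hαi := hα.injOn hα'
  have hβi := hβ.injOn hβ'
  constructor
  · refine ContinuousOn.if (fun t ht => ?_) ?_ ?_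
    · have : t = 1 / 2 := by
        have := frontier_le_subset_eq continuous_id continuous_const ht.2
        simpa using this
      subst this
      norm_num [h]
    · refine hα.1.comp (by fun_prop) fun t ht => ?_
      have h2 : t ≤ 1 / 2 := closure_minimal (fun _ h => h) isClosed_Iic ht.2
      exact ⟨by linarith [ht.1.1], by linarith⟩
    · refine hβ.1.comp (by fun_prop) fun t ht => ?_
      have h2 : t ∈ closure {t : ℝ | 1 / 2 < t} := by simpa only [not_le] using ht.2
      have h2 : 1 / 2 ≤ t := closure_lt_subset_le continuous_const continuous_id h2
      exact ⟨by linarith, by linarith [ht.1.2]⟩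
  · intro s hs t ht hst e
    rcases le_or_gt s (1 / 2) with h1 | h1
    · rw [concat_of_le _ _ h1] at e
      have hs' : 2 * s ∈ Icc (0 : ℝ) 1 := ⟨by linarith [hs.1], by linarith⟩
      rcases le_or_gt t (1 / 2) with h2 | h2
      · rw [concat_of_le _ _ h2] at e
        have := hαi hs' ⟨by linarith [ht.1], by linarith⟩ e
        linarith
      · rw [concat_of_lt _ _ h2] at e
        rcases hd _ hs' _ ⟨by linarith, by linarith [ht.2]⟩ e with ⟨-, h3⟩ | ⟨h3, h4⟩
        · linarith
        · constructor <;> linarith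
    · have h2 : 1 / 2 < t := h1.trans hst
      rw [concat_of_lt _ _ h1, concat_of_lt _ _ h2] at e
      have := hβi ⟨by linarith, by linarith [hs.2]⟩ ⟨by linarith, by linarith [ht.2]⟩ e
      linarith

theorem IsSide.of_closure_disjoint {E X A : Set S} (hE : IsSide E (X ∪ A)) (hX : IsClosed X)
    (h : Disjoint (closure E) A) : IsSide E X := by
  refine ⟨hE.1, hE.2.1.mono_right subset_union_left, isClosed_of_closure_subset ?_⟩
  rw [closure_union, hX.closure_eq]
  rintro x (hx | hx)
  · rcases closure_minimal subset_union_left hE.2.2 hx with h' | h' | h'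
    exacts [Or.inl h', Or.inr h', absurd h' (disjoint_left.1 h hx)]
  · exact Or.inr hx

/-- An edge with the same side locally on both sides can be removed. -/
theorem IsSide.remove_edge [T2Space S] {N X E : Set S} (hN : IsOpen N) (hNB : Disjoint N (Bd S))
    (hX : IsClosed X) {γ : ℝ → S} (hγ : IsEdge γ) (hγN : γ '' Icc 0 1 ⊆ N)
    (hd : ∀ t ∈ Ioo (0 : ℝ) 1, γ t ∉ X) (hE : IsSide E (X ∪ γ '' Icc 0 1)) {u : ℝ}
    (hu : u ∈ Ioo (0 : ℝ) 1)
    (hess : ¬ (γ u ∈ closure E ∧ γ u ∈ closure (E ∪ (X ∪ γ '' Icc 0 1))ᶜ)) :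
    ∃ E', IsSide E' X ∧ SameOff N E E' := by
  have hsub : ∀ F : Set S, γ u ∉ closure F → ∃ u₁ u₂, 0 < u₁ ∧ u₁ < u ∧ u < u₂ ∧ u₂ < 1 ∧
      ∀ t ∈ Ioo u₁ u₂, γ t ∉ closure F := fun F hF => by
    have h1 : ∀ᶠ t in 𝓝 u, γ t ∉ closure F :=
      ((hγ.1.continuousAt (Icc_mem_nhds hu.1 hu.2)).eventually
        (isClosed_closure.isOpen_compl.mem_nhds hF))
    obtain ⟨ε, hε, hb⟩ := Metric.eventually_nhds_iff.1 (h1.and (Ioo_mem_nhds hu.1 hu.2))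
    have h2 := (hb (y := u - ε / 2) (by rw [Real.dist_eq, abs_lt]; constructor <;> linarith)).2
    have h3 := (hb (y := u + ε / 2) (by rw [Real.dist_eq, abs_lt]; constructor <;> linarith)).2
    exact ⟨u - ε / 2, u + ε / 2, h2.1, by linarith, by linarith, h3.2, fun t ht =>
      (hb (by rw [Real.dist_eq, abs_lt]; constructor <;> linarith [ht.1, ht.2])).1⟩
  have hcut : ∀ u₁ u₂ : ℝ, 0 < u₁ → u₁ < u → u < u₂ → u₂ < 1 →
      X ∪ γ '' Icc 0 1 = (X ∪ γ '' Icc 0 u₁ ∪ γ '' Icc u₂ 1) ∪ γ '' Ioo u₁ u₂ := by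
    intro u₁ u₂ h1 h2 h3 h4
    rw [union_assoc, union_assoc, ← image_union, ← image_union]
    congr 2
    ext t
    simp only [mem_Icc, mem_union, mem_Ioo]
    constructor
    · rintro ⟨h5, h6⟩
      by_cases h7 : t ≤ u₁
      · exact Or.inl ⟨h5, h7⟩
      · by_cases h8 : u₂ ≤ t
        · exact Or.inr (Or.inl ⟨h8, h6⟩)
        · exact Or.inr (Or.inr ⟨not_le.1 h7, not_le.1 h8⟩)
    · rintro (h | h | h) <;> constructor <;> linarith
  have hfin : ∀ (u₁ u₂ : ℝ) (E₁ : Set S), 0 < u₁ → u₁ < u → u < u₂ → u₂ < 1 →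
      IsSide E₁ (X ∪ γ '' Icc 0 u₁ ∪ γ '' Icc u₂ 1) → ∃ E', IsSide E' X ∧ SameOff N E₁ E' := by
    intro u₁ u₂ E₁ h1 h2 h3 h4 hE₁
    have hcl1 : IsClosed (γ '' Icc 0 u₁) := hγ.isClosed_image_Icc le_rfl (by linarith)
    have himg : (fun t => γ (1 - t)) '' Icc 0 (1 - u₂) = γ '' Icc u₂ 1 := by
      rw [← image_image γ (fun t => 1 - t), image_const_sub_Icc]
      simp
    obtain ⟨E₂, hE₂, hs₂⟩ := IsSide.remove_arc (γ := fun t => γ (1 - t)) (a := 0) (b := 1 - u₂)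
      (X := X ∪ γ '' Icc 0 u₁) (E := E₁) hN hNB (hX.union hcl1) (by linarith)
      (hγ.1.comp (by fun_prop) fun t ht => ⟨by linarith [ht.2], by linarith [ht.1]⟩)
      (fun s hs t ht e => by
        have := hγ.injOn_Icc (a := u₂) (b := 1) (by linarith) le_rfl (Or.inl (by linarith))
          ⟨by linarith [hs.2], by linarith [hs.1]⟩ ⟨by linarith [ht.2], by linarith [ht.1]⟩ e
        linarith)
      (by rw [himg]; exact (image_mono (Icc_subset_Icc (by linarith) le_rfl)).trans hγN)
      (fun t ht => by
        have htI : 1 - t ∈ Ioo (0 : ℝ) 1 := ⟨by linarith [ht.2], by linarith [ht.1]⟩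
        rintro (h | ⟨w, hw, e⟩)
        · exact hd _ htI h
        · have := hγ.eq_of_mem_Ioo htI ⟨hw.1, by linarith [hw.2]⟩ e.symm
          linarith [ht.2, hw.2])
      (by rw [himg]; exact hE₁)
    obtain ⟨E₃, hE₃, hs₃⟩ := hE₂.remove_arc hN hNB hX h1.le
      (hγ.1.mono (Icc_subset_Icc le_rfl (by linarith)))
      (hγ.injOn_Icc le_rfl (by linarith) (Or.inr (by linarith)))
      ((image_mono (Icc_subset_Icc le_rfl (by linarith))).trans hγN)
      (fun t ht => hd t ⟨ht.1, by linarith [ht.2]⟩)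
    exact ⟨E₃, hE₃, hs₂.trans hs₃⟩
  have hclX : ∀ u₁ u₂ : ℝ, 0 < u₁ → u₁ < u → u < u₂ → u₂ < 1 →
      IsClosed (X ∪ γ '' Icc 0 u₁ ∪ γ '' Icc u₂ 1) := fun u₁ u₂ h1 h2 h3 h4 =>
    (hX.union (hγ.isClosed_image_Icc le_rfl (by linarith))).union
      (hγ.isClosed_image_Icc (by linarith) le_rfl)
  rw [not_and_or] at hess
  rcases hess with h | h
  · obtain ⟨u₁, u₂, h1, h2, h3, h4, h5⟩ := hsub _ h
    refine hfin u₁ u₂ E h1 h2 h3 h4 (IsSide.of_closure_disjoint (A := γ '' Ioo u₁ u₂)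
      (by rw [← hcut u₁ u₂ h1 h2 h3 h4]; exact hE) (hclX u₁ u₂ h1 h2 h3 h4) ?_)
    refine disjoint_left.2 ?_
    rintro _ hx ⟨t, ht, rfl⟩
    exact h5 t ht hx
  · obtain ⟨u₁, u₂, h1, h2, h3, h4, h5⟩ := hsub _ h
    have := IsSide.of_closure_disjoint (A := γ '' Ioo u₁ u₂)
      (by rw [← hcut u₁ u₂ h1 h2 h3 h4]; exact hE.compl) (hclX u₁ u₂ h1 h2 h3 h4)
      (disjoint_left.2 (by
        rintro _ hx ⟨t, ht, rfl⟩
        exact h5 t ht hx))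
    obtain ⟨E', hE', hs⟩ := hfin u₁ u₂ _ h1 h2 h3 h4 this.compl
    refine ⟨E', hE', SameOff.trans ⟨γ '' Icc 0 1, hγ.isCompact_image, hγN, fun x hx => ?_⟩ hs⟩
    have hdis : x ∈ E → x ∉ X ∪ γ '' Icc 0 1 := fun h => disjoint_left.1 hE.2.1 h
    have e1 : x ∉ γ '' Icc 0 u₁ := fun h => hx (image_mono (Icc_subset_Icc le_rfl (by linarith)) h)
    have e2 : x ∉ γ '' Icc u₂ 1 := fun h => hx (image_mono (Icc_subset_Icc (by linarith) le_rfl) h)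
    simp only [mem_compl_iff, mem_union] at hdis ⊢
    tauto

/-- `N` arcs issuing from `v`, which may also share their other endpoints. -/
structure IsSpider {N : ℕ} (v : S) (γ : Fin N → ℝ → S) (P : Set S) : Prop where
  closed : IsClosed P
  notMem_Bd : v ∉ Bd S
  notMem : v ∉ P
  cont : ∀ k, ContinuousOn (γ k) (Icc 0 1)
  inj : ∀ k, InjOn (γ k) (Icc 0 1)
  start : ∀ k, γ k 0 = v
  disj : ∀ k l, k ≠ l → ∀ s ∈ Icc (0 : ℝ) 1, ∀ u ∈ Icc (0 : ℝ) 1, γ k s = γ l u → s = 0 ∨ s = 1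

namespace IsSpider

variable {N : ℕ} {v : S} {γ : Fin N → ℝ → S} {P : Set S}

theorem isFan [T2Space S] (h : IsSpider v γ P) :
    IsFan v (fun k t => γ k (t / 3)) (P ∪ ⋃ k, γ k '' Icc (1 / 3) 1) := by
  have hI : ∀ t ∈ Icc (0 : ℝ) 1, t / 3 ∈ Icc (0 : ℝ) 1 := fun t ht =>
    ⟨by linarith [ht.1], by linarith [ht.2]⟩
  refine ⟨h.closed.union (isClosed_iUnion_of_finite fun k =>
    (isCompact_Icc.image_of_continuousOn ((h.cont k).mono
      (Icc_subset_Icc (by norm_num) le_rfl))).isClosed), h.notMem_Bd, ?_,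
    fun k => (h.cont k).comp (by fun_prop) hI, fun k s hs t ht e => ?_, fun k => ?_,
    fun k l hkl s hs u hu e => ?_⟩
  · rintro (h' | h')
    · exact h.notMem h'
    · obtain ⟨k, t, ht, e⟩ := mem_iUnion.1 h'
      rw [← h.start k] at e
      have := h.inj k ⟨by linarith [ht.1], ht.2⟩ (by simp) e
      linarith [ht.1]
  · have := h.inj k (hI s hs) (hI t ht) e
    linarith
  · simp [h.start]
  · rcases h.disj k l hkl _ (hI s hs) _ (hI u hu) e with h' | h'
    · linarith
    · linarith [hs.2]

theorem sectors [T2Space S] (h : IsSpider v γ P) (hN : 0 < N) :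
    ∃ B ∈ 𝓝 v, ∀ (x₀ : S) (x : Fin N → S),
      x₀ ∈ B → (∀ j, x j ∈ B) → x₀ ∉ P ∪ ⋃ k, γ k '' Icc 0 1 →
      (∀ j, x j ∉ P ∪ ⋃ k, γ k '' Icc 0 1) →
      (∃ j, x₀ ∈ connectedComponentIn (P ∪ ⋃ k, γ k '' Icc 0 1)ᶜ (x j)) ∨
      ∃ i j, i ≠ j ∧ x i ∈ connectedComponentIn (P ∪ ⋃ k, γ k '' Icc 0 1)ᶜ (x j) := by
  have := h.isFan.sectors hN
  rwa [iUnion_thirds_eq] at this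

theorem not_three [T2Space S] {γ : Fin 3 → ℝ → S} (h : IsSpider v γ P) {E : Set S}
    (hE : IsSide E (P ∪ ⋃ k, γ k '' Icc 0 1))
    (hess : ∀ k, ∀ u ∈ Ioo (0 : ℝ) 1, γ k u ∈ closure E ∧
      γ k u ∈ closure (E ∪ (P ∪ ⋃ k, γ k '' Icc 0 1))ᶜ) : False := by
  refine h.isFan.not_three (E := E) (by rwa [iUnion_thirds_eq]) fun k u hu => ?_
  rw [iUnion_thirds_eq]
  exact hess k (u / 3) ⟨by linarith [hu.1], by linarith [hu.2]⟩

end IsSpider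

end Edges

/-! ### Systems of edges -/

section Systems

variable {S : Type*}

/-- The endpoint of an edge of a family. -/
def endp {ι : Type*} (γ : ι → ℝ → S) (e : ι × Bool) : S := γ e.1 (if e.2 then 1 else 0)

/-- The union of a family of edges. -/
def support {ι : Type*} (γ : ι → ℝ → S) : Set S := ⋃ i, γ i '' Icc 0 1

theorem support_comp {ι κ : Type*} (f : κ ≃ ι) (γ : ι → ℝ → S) :
    support (fun k => γ (f k)) = support γ := f.surjective.iUnion_comp fun i => γ i '' Icc 0 1

theorem support_eq_union {ι : Type*} (γ : ι → ℝ → S) (i : ι) :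
    support γ = support (fun j : {j // j ≠ i} => γ j) ∪ γ i '' Icc 0 1 := by
  ext x
  simp only [support, mem_union, mem_iUnion]
  constructor
  · rintro ⟨j, hj⟩
    by_cases h : j = i
    · exact Or.inr (h ▸ hj)
    · exact Or.inl ⟨⟨j, h⟩, hj⟩
  · rintro (⟨j, hj⟩ | hi)
    exacts [⟨j, hj⟩, ⟨i, hi⟩]

/-- The initial half of an edge, seen from one of its ends. -/
noncomputable def leg {ι : Type*} (γ : ι → ℝ → S) (e : ι × Bool) (t : ℝ) : S :=
  γ e.1 (if e.2 then 1 - t / 2 else t / 2)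

/-- The part of the edges away from the vertex `v`. -/
def rest {ι : Type*} (γ : ι → ℝ → S) (v : S) : Set S :=
  ⋃ i, γ i '' {t ∈ Icc (0 : ℝ) 1 | (γ i 0 = v → 1 / 2 ≤ t) ∧ (γ i 1 = v → t ≤ 1 / 2)}

theorem leg_param_mem (b : Bool) {t : ℝ} (ht : t ∈ Icc (0 : ℝ) 1) :
    (if b then 1 - t / 2 else t / 2) ∈ Icc (0 : ℝ) 1 := by
  cases b <;> constructor <;> simp <;> linarith [ht.1, ht.2]

theorem rest_union {ι : Type*} {γ : ι → ℝ → S} {N : ℕ} {v : S} {f : Fin N → ι × Bool} (hfv : ∀ e, endp γ e = v → e ∈ range f) :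
    rest γ v ∪ ⋃ k, leg γ (f k) '' Icc 0 1 = support γ := by
  refine Subset.antisymm (union_subset (iUnion_mono fun i => image_mono fun t ht => ht.1)
    (iUnion_subset fun k => ?_)) (iUnion_subset fun i => ?_)
  · rintro _ ⟨t, ht, rfl⟩
    exact mem_iUnion.2 ⟨(f k).1, _, leg_param_mem _ ht, rfl⟩
  · rintro _ ⟨t, ht, rfl⟩
    by_cases h0 : γ i 0 = v ∧ t < 1 / 2
    · obtain ⟨k, hk⟩ := hfv (i, false) (by simpa [endp] using h0.1)
      refine Or.inr (mem_iUnion.2 ⟨k, 2 * t, ⟨by linarith [ht.1], by linarith⟩, ?_⟩)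
      simp [leg, hk]
    by_cases h1 : γ i 1 = v ∧ 1 / 2 < t
    · obtain ⟨k, hk⟩ := hfv (i, true) (by simpa [endp] using h1.1)
      refine Or.inr (mem_iUnion.2 ⟨k, 2 * (1 - t), ⟨by linarith [ht.2], by linarith⟩, ?_⟩)
      simp [leg, hk]
    · exact Or.inl (mem_iUnion.2 ⟨i, t, ⟨ht, fun e => not_lt.1 fun h' => h0 ⟨e, h'⟩,
        fun e => not_lt.1 fun h' => h1 ⟨e, h'⟩⟩, rfl⟩)

variable [TopologicalSpace S]

/-- A family of edges in `V` which meet only at endpoints, with all degrees at most three. -/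
structure IsSystem {ι : Type*} (V : Set S) (γ : ι → ℝ → S) : Prop where
  edge : ∀ i, IsEdge (γ i)
  subset : ∀ i, γ i '' Icc 0 1 ⊆ V
  disj : ∀ i j, i ≠ j → ∀ s ∈ Icc (0 : ℝ) 1, ∀ t ∈ Icc (0 : ℝ) 1, γ i s = γ j t → s = 0 ∨ s = 1
  degree : ∀ v, {e : ι × Bool | endp γ e = v}.ncard ≤ 3

/-- A side of `X` containing the end of `V` but not the point `c`. -/
structure IsSep (V : Set S) (c : S) (E X : Set S) : Prop where
  side : IsSide E X
  notMem : c ∉ E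
  exhaust : ∃ K, IsCompact K ∧ V \ K ⊆ E

theorem IsSep.of_sameOff {V : Set S} {c : S} (hc : c ∉ V) {E E' X X' : Set S} (h : IsSep V c E X)
    (hE' : IsSide E' X') (hs : SameOff V E E') : IsSep V c E' X' := by
  obtain ⟨D, hD, hDV, hs⟩ := hs
  obtain ⟨K, hK, hKE⟩ := h.exhaust
  exact ⟨hE', fun h' => h.notMem ((hs c fun h => hc (hDV h)).1 h'), K ∪ D, hK.union hD,
    fun x hx => (hs x fun h => hx.2 (Or.inr h)).2 (hKE ⟨hx.1, fun h => hx.2 (Or.inl h)⟩)⟩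

/-- There is a separating system of `n` edges. -/
def HasSep (V : Set S) (c : S) (n : ℕ) : Prop :=
  ∃ (γ : Fin n → ℝ → S) (E : Set S), IsSystem V γ ∧ IsSep V c E (support γ)

theorem IsSystem.of_injective {ι κ : Type*} [Finite ι] {V : Set S} {γ : ι → ℝ → S}
    {δ : κ → ℝ → S} (h : IsSystem V γ) (hedge : ∀ i, IsEdge (δ i))
    (hsub : ∀ i, δ i '' Icc 0 1 ⊆ V)
    (hdisj : ∀ i j, i ≠ j → ∀ s ∈ Icc (0 : ℝ) 1, ∀ t ∈ Icc (0 : ℝ) 1, δ i s = δ j t →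
      s = 0 ∨ s = 1) {f : κ × Bool → ι × Bool} (hf : Function.Injective f)
    (he : ∀ e, endp γ (f e) = endp δ e) : IsSystem V δ :=
  ⟨hedge, hsub, hdisj, fun v => (ncard_le_ncard_of_injOn f (fun e (h : endp δ e = v) =>
    (he e).trans h) hf.injOn (toFinite _)).trans (h.degree v)⟩

theorem IsSystem.comp {ι κ : Type*} [Finite ι] {V : Set S} {γ : ι → ℝ → S} (h : IsSystem V γ)
    {f : κ → ι} (hf : Function.Injective f) : IsSystem V fun k => γ (f k) :=
  h.of_injective (fun _ => h.edge _) (fun _ => h.subset _)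
    (fun _ _ hij => h.disj _ _ (hf.ne hij)) (f := Prod.map f id)
    (hf.prodMap Function.injective_id) fun _ => rfl

theorem HasSep.of_system {ι : Type*} [Finite ι] {V : Set S} {c : S} {γ : ι → ℝ → S} {E : Set S}
    (h : IsSystem V γ) (hE : IsSep V c E (support γ)) : HasSep V c (Nat.card ι) := by
  let f := (Finite.equivFin ι).symm
  exact ⟨fun k => γ (f k), E, h.comp f.injective, by rwa [support_comp f]⟩

theorem card_ne {ι : Type*} [Finite ι] (i : ι) : Nat.card {j // j ≠ i} < Nat.card ι :=
  Finite.card_subtype_lt (x := i) (by simp)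

namespace IsSystem

variable {ι : Type*} [Finite ι] {V : Set S} {γ : ι → ℝ → S}

theorem isClosed_support [T2Space S] (h : IsSystem V γ) : IsClosed (support γ) :=
  isClosed_iUnion_of_finite fun i => (h.edge i).isClosed_image

/-- In a minimal separating system, every edge has different sides locally. -/
theorem essential [T2Space S] (h : IsSystem V γ) (hV : IsOpen V) (hVB : Disjoint V (Bd S)) {c : S}
    (hc : c ∉ V) {E : Set S} (hE : IsSep V c E (support γ)) (hmin : ∀ m < Nat.card ι, ¬ HasSep V c m)
    (i : ι) {u : ℝ} (hu : u ∈ Ioo (0 : ℝ) 1) :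
    γ i u ∈ closure E ∧ γ i u ∈ closure (E ∪ support γ)ᶜ := by
  by_contra hcon
  have h' : IsSystem V fun j : {j // j ≠ i} => γ j := h.comp Subtype.val_injective
  have hs := support_eq_union γ i
  obtain ⟨E', hE', hs'⟩ := IsSide.remove_edge hV hVB h'.isClosed_support (h.edge i) (h.subset i)
    (fun t ht hx => by
      obtain ⟨j, s, hs, e⟩ := mem_iUnion.1 hx
      rcases h.disj i j (Ne.symm j.2) t (Ioo_subset_Icc_self ht) s hs e.symm with h0 | h1
      exacts [ht.1.ne' h0, ht.2.ne h1]) (by rw [← hs]; exact hE.side) hu (by rwa [← hs])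
  exact hmin _ (card_ne i) (HasSep.of_system h' (hE.of_sameOff hc hE' hs'))

theorem isSpider [T2Space S] (h : IsSystem V γ) (hVB : Disjoint V (Bd S)) {N : ℕ} {v : S}
    {f : Fin N → ι × Bool} (hf : Function.Injective f) (hN : 0 < N) (hfv : ∀ k, endp γ (f k) = v) :
    IsSpider v (fun k => leg γ (f k)) (rest γ v) := by
  have hendp : ∀ e : ι × Bool, endp γ e ∈ V := fun e => h.subset e.1 ⟨_, by
    cases e.2 <;> simp, rfl⟩
  refine ⟨isClosed_iUnion_of_finite fun i => (IsCompact.image_of_continuousOn ?_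
      ((h.edge i).1.mono fun t ht => ht.1)).isClosed,
    fun hb => disjoint_left.1 hVB (hfv ⟨0, hN⟩ ▸ hendp _) hb, ?_, fun k => ?_, fun k => ?_,
    fun k => ?_, fun k l hkl s hs u hu e => ?_⟩
  · refine isCompact_Icc.of_isClosed_subset ?_ (fun t ht => ht.1)
    refine isClosed_Icc.inter ((?_ : IsClosed {t : ℝ | γ i 0 = v → 1 / 2 ≤ t}).inter
      (?_ : IsClosed {t : ℝ | γ i 1 = v → t ≤ 1 / 2}))
    · by_cases h' : γ i 0 = v
      · simp only [h', forall_const]; exact isClosed_Ici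
      · simp [h']
    · by_cases h' : γ i 1 = v
      · simp only [h', forall_const]; exact isClosed_Iic
      · simp [h']
  · intro hv
    obtain ⟨i, t, ⟨ht, h0, h1⟩, e⟩ := mem_iUnion.1 hv
    have h01 : t = 0 ∨ t = 1 := by
      by_contra! hne
      have htI : t ∈ Ioo (0 : ℝ) 1 := ⟨lt_of_le_of_ne ht.1 hne.1.symm, lt_of_le_of_ne ht.2 hne.2⟩
      have hk := hfv ⟨0, hN⟩
      rw [← e] at hk
      have hp : (if (f ⟨0, hN⟩).2 then 1 else 0) ∈ Icc (0 : ℝ) 1 := by split_ifs <;> simp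
      by_cases hi : i = (f ⟨0, hN⟩).1
      · subst hi
        have := (h.edge _).eq_of_mem_Ioo htI hp hk.symm
        split_ifs at this
        exacts [hne.2 this, hne.1 this]
      · rcases h.disj _ _ hi _ ht _ hp hk.symm with h' | h'
        exacts [hne.1 h', hne.2 h']
    rcases h01 with rfl | rfl
    · linarith [h0 e]
    · linarith [h1 e]
  · refine (h.edge _).1.comp (Continuous.continuousOn ?_) fun t ht => leg_param_mem _ ht
    cases (f k).2 <;> simp <;> fun_prop
  · intro s hs t ht e
    unfold leg at e
    cases hb : (f k).2 <;> simp only [hb, if_true, Bool.false_eq_true, if_false] at e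
    · have := (h.edge _).injOn_Icc (a := 0) (b := 1 / 2) le_rfl (by norm_num)
        (Or.inr (by norm_num)) ⟨by linarith [hs.1], by linarith [hs.2]⟩
        ⟨by linarith [ht.1], by linarith [ht.2]⟩ e
      linarith
    · have := (h.edge _).injOn_Icc (a := 1 / 2) (b := 1) (by norm_num) le_rfl
        (Or.inl (by norm_num)) ⟨by linarith [hs.2], by linarith [hs.1]⟩
        ⟨by linarith [ht.2], by linarith [ht.1]⟩ e
      linarith
  · rw [← hfv k]
    unfold leg endp
    cases (f k).2 <;> simp
  · by_contra! hne
    have hs0 : s ∈ Ioo (0 : ℝ) 1 := ⟨lt_of_le_of_ne hs.1 hne.1.symm, lt_of_le_of_ne hs.2 hne.2⟩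
    have hs' : (if (f k).2 then 1 - s / 2 else s / 2) ∈ Ioo (0 : ℝ) 1 := by
      cases (f k).2 <;> constructor <;> simp <;> linarith [hs0.1, hs0.2]
    have hu' := leg_param_mem (f l).2 hu
    by_cases hi : (f k).1 = (f l).1
    · have hb : (f k).2 ≠ (f l).2 := fun hb => hkl (hf (Prod.ext hi hb))
      unfold leg at e
      rw [hi] at e
      have := (h.edge _).eq_of_mem_Ioo hs' hu' e
      cases hb1 : (f k).2 <;> cases hb2 : (f l).2 <;> simp [hb1, hb2] at hb this <;>
        linarith [hs0.1, hs0.2, hu.1, hu.2]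
    · rcases h.disj _ _ hi _ (Ioo_subset_Icc_self hs') _ hu' e with h' | h'
      exacts [hs'.1.ne' h', hs'.2.ne h']

end IsSystem

end Systems

section Orientation

variable {S : Type*}

/-- An edge traversed forwards or backwards. -/
def orient (γ : ℝ → S) (b : Bool) (t : ℝ) : S := γ (if b then t else 1 - t)

theorem orient_param_mem (b : Bool) {t : ℝ} (ht : t ∈ Icc (0 : ℝ) 1) :
    (if b then t else 1 - t) ∈ Icc (0 : ℝ) 1 := by
  cases b <;> constructor <;> simp <;> linarith [ht.1, ht.2]

theorem orient_image (γ : ℝ → S) (b : Bool) : orient γ b '' Icc 0 1 = γ '' Icc 0 1 := by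
  ext x
  constructor
  · rintro ⟨t, ht, rfl⟩
    exact ⟨_, orient_param_mem b ht, rfl⟩
  · rintro ⟨t, ht, rfl⟩
    refine ⟨_, orient_param_mem b ht, ?_⟩
    cases b <;> simp [orient]

theorem IsEdge.orient [TopologicalSpace S] {γ : ℝ → S} (h : IsEdge γ) (b : Bool) :
    IsEdge (orient γ b) := by
  cases b
  · refine h.reverse.congr fun t _ => ?_
    simp only [_root_.orient, _root_.reparam, Bool.false_eq_true, if_false]
    ring_nf
  · exact h.congr fun t _ => by simp [_root_.orient]

end Orientation

namespace IsSystem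

variable {S : Type*} [TopologicalSpace S] {ι : Type*} [Finite ι] {V : Set S}
  {γ : ι → ℝ → S} {c : S} {E : Set S}

/-- Two edges can be joined at a vertex of degree two. -/
theorem exists_join (h : IsSystem V γ) {i j : ι} (hij : i ≠ j) {b b' : Bool}
    (hv : ∀ a, endp γ a = endp γ (i, b) ↔ a = (i, b) ∨ a = (j, b')) :
    ∃ δ : {k // k ≠ j} → ℝ → S, IsSystem V δ ∧ support δ = support γ := by
  classical
  have hjv : endp γ (j, b') = endp γ (i, b) := (hv _).2 (Or.inr rfl)
  set α := orient (γ i) b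
  set β := orient (γ j) !b'
  have hα1 : α 1 = endp γ (i, b) := by cases b <;> simp [α, orient, endp]
  have hα0 : α 0 = endp γ (i, !b) := by cases b <;> simp [α, orient, endp]
  have hβ0 : β 0 = endp γ (i, b) := by rw [← hjv]; cases b' <;> simp [β, orient, endp]
  have hβ1 : β 1 = endp γ (j, !b') := by cases b' <;> simp [β, orient, endp]
  have hα01 : α 0 ≠ endp γ (i, b) := fun e => by
    rcases (hv _).1 (hα0.symm.trans e) with e | e
    · cases b <;> simp at e
    · exact hij (congrArg Prod.fst e)
  have hβ01 : β 1 ≠ endp γ (i, b) := fun e => by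
    rcases (hv _).1 (hβ1.symm.trans e) with e | e
    · exact hij (congrArg Prod.fst e).symm
    · cases b' <;> simp at e
  have hpar : ∀ (b : Bool) (s : ℝ), (if b then s else 1 - s) = 0 ∨ (if b then s else 1 - s) = 1 →
      s = 0 ∨ s = 1 := fun b s hs => by
    cases b <;> simp at hs
    · rcases hs with hs | hs
      exacts [Or.inr (by linarith), Or.inl hs]
    · exact hs
  have hαe : IsEdge α := (h.edge i).orient b
  have hβe : IsEdge β := (h.edge j).orient _
  have hαβ : α 1 = β 0 := hα1.trans hβ0.symm
  have hcat : IsEdge (concat α β) := by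
    refine hαe.concat hβe (hα1 ▸ hα01) (hβ0 ▸ hβ01.symm) hαβ fun s hs t ht e => ?_
    have h1 := hpar _ _ (h.disj i j hij _ (orient_param_mem b hs) _ (orient_param_mem _ ht) e)
    have h2 := hpar _ _ (h.disj j i hij.symm _ (orient_param_mem _ ht) _
      (orient_param_mem _ hs) e.symm)
    rcases h1 with rfl | rfl <;> rcases h2 with rfl | rfl
    · exact absurd (e.trans hβ0) hα01
    · exact Or.inr ⟨rfl, rfl⟩
    · exact Or.inl ⟨rfl, rfl⟩
    · exact absurd (e.symm.trans hα1) hβ01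
  have himg : concat α β '' Icc 0 1 = γ i '' Icc 0 1 ∪ γ j '' Icc 0 1 := by
    rw [concat_image hαβ, orient_image, orient_image]
  set δ : {k // k ≠ j} → ℝ → S := fun k => if k.1 = i then concat α β else γ k with hδ
  have hδi : ∀ k, k.1 = i → δ k = concat α β := fun k hk => by simp [δ, hk]
  have hδk : ∀ k, k.1 ≠ i → δ k = γ k := fun k hk => by simp [δ, hk]
  refine ⟨δ, h.of_injective (fun k => ?_) (fun k => ?_) (fun k l hkl s hs t ht e => ?_)
    (f := fun a => if a.1.1 = i then (if a.2 then (j, !b') else (i, !b)) else (a.1.1, a.2))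
    ?_ ?_, ?_⟩
  · by_cases hk : k.1 = i
    · rwa [hδi k hk]
    · rw [hδk k hk]
      exact h.edge _
  · by_cases hk : k.1 = i
    · rw [hδi k hk, himg]
      exact union_subset (h.subset _) (h.subset _)
    · rw [hδk k hk]
      exact h.subset _
  · by_cases hk : k.1 = i
    · have hl : l.1 ≠ i := fun hl => hkl (Subtype.ext (hk.trans hl.symm))
      rw [hδi k hk, hδk l hl] at e
      have hmid : γ l t ≠ endp γ (i, b) := fun e' => by
        have hb : endp γ (i, b) = γ i (if b then 1 else 0) := rfl
        have := h.disj l i hl t ht _ (by split_ifs <;> simp) (e'.trans hb)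
        have hex : ∃ d : Bool, endp γ (l.1, d) = endp γ (i, b) := by
          rcases this with rfl | rfl
          exacts [⟨false, by simpa [endp] using e'⟩, ⟨true, by simpa [endp] using e'⟩]
        obtain ⟨d, hd⟩ := hex
        rcases (hv _).1 hd with e | e
        exacts [hl (congrArg Prod.fst e), l.2 (congrArg Prod.fst e)]
      rcases le_or_gt s (1 / 2) with hs' | hs'
      · rw [concat_of_le α β hs'] at e
        have hs2 : 2 * s ∈ Icc (0 : ℝ) 1 := ⟨by linarith [hs.1], by linarith⟩
        rcases hpar _ _ (h.disj i l hl.symm _ (orient_param_mem b hs2) t ht e) with h0 | h1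
        · exact Or.inl (by linarith)
        · rw [h1, hα1] at e
          exact (hmid e.symm).elim
      · rw [concat_of_lt α β hs'] at e
        have hs2 : 2 * s - 1 ∈ Icc (0 : ℝ) 1 := ⟨by linarith, by linarith [hs.2]⟩
        rcases hpar _ _ (h.disj j l l.2.symm _ (orient_param_mem _ hs2) t ht e) with h0 | h1
        · linarith
        · exact Or.inr (by linarith)
    · rw [hδk k hk] at e
      have ht' : δ l t ∈ δ l '' Icc 0 1 := ⟨t, ht, rfl⟩
      by_cases hl : l.1 = i
      · rw [hδi l hl, himg] at ht'
        rw [hδi l hl] at e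
        rcases ht' with ⟨u, hu, e'⟩ | ⟨u, hu, e'⟩
        · exact h.disj _ _ hk s hs u hu (e.trans e'.symm)
        · exact h.disj _ _ k.2 s hs u hu (e.trans e'.symm)
      · rw [hδk l hl] at e
        exact h.disj _ _ (fun h' => hkl (Subtype.ext h')) s hs t ht e
  · rintro ⟨⟨k, hk⟩, d⟩ ⟨⟨l, hl⟩, d'⟩ e
    by_cases h1 : k = i <;> by_cases h2 : l = i <;> cases d <;> cases d' <;>
      simp_all [Prod.ext_iff]
    all_goals first | exact hk e.1.symm | exact hl e.1.symm
  · rintro ⟨k, d⟩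
    by_cases hk : k.1 = i
    · simp only [hk, if_true]
      have : endp δ (k, d) = concat α β (if d then 1 else 0) := by simp [endp, hδi k hk]
      rw [this]
      cases d
      · simp [hα0]
      · simp [hβ1]
    · simp only [hk, if_false]
      simp [endp, hδk k hk]
  · ext x
    simp only [support, mem_iUnion]
    constructor
    · rintro ⟨k, hk⟩
      by_cases hki : k.1 = i
      · rw [hδi k hki, himg] at hk
        exact hk.elim (fun hk => ⟨_, hk⟩) fun hk => ⟨_, hk⟩
      · rw [hδk k hki] at hk
        exact ⟨_, hk⟩
    · rintro ⟨k, hk⟩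
      have hi : δ ⟨i, hij⟩ '' Icc 0 1 = γ i '' Icc 0 1 ∪ γ j '' Icc 0 1 := by
        rw [hδi _ rfl, himg]
      by_cases hki : k = i
      · exact ⟨⟨i, hij⟩, hi ▸ Or.inl (hki ▸ hk)⟩
      by_cases hkj : k = j
      · exact ⟨⟨i, hij⟩, hi ▸ Or.inr (hkj ▸ hk)⟩
      · exact ⟨⟨k, hkj⟩, by rwa [hδk _ hki]⟩

variable [T2Space S]

theorem essential_endp (h : IsSystem V γ) (hV : IsOpen V) (hVB : Disjoint V (Bd S))
    (hc : c ∉ V) (hE : IsSep V c E (support γ)) (hmin : ∀ m < Nat.card ι, ¬ HasSep V c m)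
    (i : ι) {u : ℝ} (hu : u ∈ Icc (0 : ℝ) 1) :
    γ i u ∈ closure E ∧ γ i u ∈ closure (E ∪ support γ)ᶜ := by
  have h1 : γ i u ∈ closure (γ i '' Ioo 0 1) := by
    refine ContinuousWithinAt.mem_closure_image
      (((h.edge i).1 u hu).mono Ioo_subset_Icc_self) ?_
    rwa [closure_Ioo zero_ne_one]
  constructor
  · refine closure_minimal ?_ isClosed_closure h1
    rintro _ ⟨t, ht, rfl⟩
    exact (h.essential hV hVB hc hE hmin i ht).1
  · refine closure_minimal ?_ isClosed_closure h1
    rintro _ ⟨t, ht, rfl⟩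
    exact (h.essential hV hVB hc hE hmin i ht).2

/-- In a minimal separating system, every vertex has exactly two ends. -/
theorem exists_other_end (h : IsSystem V γ) (hV : IsOpen V) (hVB : Disjoint V (Bd S))
    (hc : c ∉ V) (hE : IsSep V c E (support γ)) (hmin : ∀ m < Nat.card ι, ¬ HasSep V c m)
    (e : ι × Bool) : ∃ e', e' ≠ e ∧ ∀ a, endp γ a = endp γ e ↔ a = e ∨ a = e' := by
  set v := endp γ e
  set A : Set (ι × Bool) := {a | endp γ a = v}
  have heA : e ∈ A := rfl
  have hfin : A.Finite := toFinite _
  have h3 : A.ncard ≤ 3 := h.degree v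
  have h0 : A.ncard ≠ 0 := fun h0 => by
    rw [ncard_eq_zero hfin] at h0
    exact (h0 ▸ heA : e ∈ (∅ : Set (ι × Bool)))
  have hspider : ∀ N, A.ncard = N → ∃ f : Fin N → ι × Bool,
      IsSpider v (fun k => leg γ (f k)) (rest γ v) ∧
      rest γ v ∪ ⋃ k, leg γ (f k) '' Icc 0 1 = support γ := fun N hN => by
    let g : Fin N ≃ A := (Finite.equivFinOfCardEq (by rw [← hN]; rfl)).symm
    have hg : ∀ a, endp γ a = v → a ∈ range fun k => (g k : ι × Bool) := fun a ha =>
      ⟨g.symm ⟨a, ha⟩, by simp⟩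
    exact ⟨fun k => g k, h.isSpider hVB (Subtype.val_injective.comp g.injective)
      (by omega) fun k => (g k).2, rest_union hg⟩
  have hcases : A.ncard = 1 ∨ A.ncard = 2 ∨ A.ncard = 3 := by omega
  rcases hcases with h1 | h2 | h3
  · exfalso
    obtain ⟨f, hf, hfX⟩ := hspider 1 h1
    obtain ⟨B, hB, hsec⟩ := hf.sectors one_pos
    rw [hfX] at hsec
    have hv : v ∈ closure E ∧ v ∈ closure (E ∪ support γ)ᶜ := by
      refine h.essential_endp hV hVB hc hE hmin e.1 ?_
      split_ifs <;> simp
    obtain ⟨x, hxB, hxE⟩ := mem_closure_iff_nhds.1 hv.1 B hB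
    obtain ⟨y, hyB, hyE⟩ := mem_closure_iff_nhds.1 hv.2 B hB
    have hxX : x ∉ support γ := disjoint_left.1 hE.side.2.1 hxE
    have hyX : y ∉ support γ := fun hy => hyE (Or.inr hy)
    rcases hsec x (fun _ => y) hxB (fun _ => hyB) hxX (fun _ => hyX) with ⟨-, hj⟩ | ⟨i, j, hij, -⟩
    · refine hyE (Or.inl (hE.side.subset_of_isPreconnected isPreconnected_connectedComponentIn
        (disjoint_left.2 fun z hz => connectedComponentIn_subset _ _ hz) hj hxE
        (mem_connectedComponentIn hyX)))
    · exact hij (Subsingleton.elim _ _)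
  · obtain ⟨a, b, hab, hA⟩ := ncard_eq_two.1 h2
    have hmem : ∀ x, endp γ x = v ↔ x = a ∨ x = b := fun x => by
      rw [← mem_singleton_iff (b := b), ← mem_insert_iff, ← hA]; rfl
    rcases (hmem e).1 rfl with he | he
    · exact ⟨b, he ▸ hab.symm, he ▸ hmem⟩
    · exact ⟨a, he ▸ hab, fun x => (hmem x).trans (by rw [he, or_comm])⟩
  · exfalso
    obtain ⟨f, hf, hfX⟩ := hspider 3 h3
    refine hf.not_three (E := E) (by rw [hfX]; exact hE.side) fun k u hu => ?_
    rw [hfX]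
    refine h.essential hV hVB hc hE hmin _ ?_
    cases (f k).2 <;> constructor <;> simp <;> linarith [hu.1, hu.2]

theorem end_eq_of_minimal (h : IsSystem V γ) (hV : IsOpen V) (hVB : Disjoint V (Bd S))
    (hc : c ∉ V) (hE : IsSep V c E (support γ)) (hmin : ∀ m < Nat.card ι, ¬ HasSep V c m)
    (i : ι) (b : Bool) (a : ι × Bool) : endp γ a = endp γ (i, b) ↔ a.1 = i := by
  obtain ⟨⟨j, b'⟩, hne, hv⟩ := h.exists_other_end hV hVB hc hE hmin (i, b)
  by_cases hij : i = j
  · subst hij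
    rw [hv]
    rcases a with ⟨k, d⟩
    simp only [Prod.mk.injEq, ne_eq, true_and] at hne ⊢
    cases d <;> cases b <;> cases b' <;> simp_all
  · obtain ⟨δ, hδ, hs⟩ := h.exists_join hij hv
    exact absurd (HasSep.of_system hδ (hs ▸ hE)) (hmin _ (card_ne j))

/-- A minimal separating system consists of loops. -/
theorem loop_of_minimal (h : IsSystem V γ) (hV : IsOpen V) (hVB : Disjoint V (Bd S))
    (hc : c ∉ V) (hE : IsSep V c E (support γ)) (hmin : ∀ m < Nat.card ι, ¬ HasSep V c m)
    (i : ι) : γ i 0 = γ i 1 := by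
  simpa [endp] using (h.end_eq_of_minimal hV hVB hc hE hmin i true (i, false)).2 rfl

/-- The loops of a minimal separating system are disjoint. -/
theorem disjoint_of_minimal (h : IsSystem V γ) (hV : IsOpen V) (hVB : Disjoint V (Bd S))
    (hc : c ∉ V) (hE : IsSep V c E (support γ)) (hmin : ∀ m < Nat.card ι, ¬ HasSep V c m)
    {i j : ι} (hij : i ≠ j) : Disjoint (γ i '' Icc 0 1) (γ j '' Icc 0 1) := by
  rw [disjoint_left]
  rintro _ ⟨s, hs, rfl⟩ ⟨t, ht, e⟩
  have hend : ∀ k, ∀ s : ℝ, s = 0 ∨ s = 1 → ∃ d, endp γ (k, d) = γ k s := fun k s hs => by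
    rcases hs with rfl | rfl
    exacts [⟨false, by simp [endp]⟩, ⟨true, by simp [endp]⟩]
  obtain ⟨d, hd⟩ := hend i s (h.disj i j hij s hs t ht e.symm)
  obtain ⟨d', hd'⟩ := hend j t (h.disj j i hij.symm t ht s hs e)
  exact hij ((h.end_eq_of_minimal hV hVB hc hE hmin i d (j, d')).1 (hd'.trans (e.trans hd.symm))).symm

end IsSystem

/-! ### Loops -/

section CirclePoints

/-- The standard parametrization of the circle. -/
noncomputable def circPoint (t : ℝ) : Circ :=
  ⟨(Real.cos (2 * Real.pi * t), Real.sin (2 * Real.pi * t)), Real.cos_sq_add_sin_sq _⟩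

theorem continuous_circPoint : Continuous circPoint := by
  unfold circPoint
  fun_prop

theorem circPoint_eq {s t : ℝ} (hs : s ∈ Icc (0 : ℝ) 1) (ht : t ∈ Icc (0 : ℝ) 1) (hst : s < t)
    (h : circPoint s = circPoint t) : s = 0 ∧ t = 1 := by
  have h' := congrArg Subtype.val h
  simp only [circPoint, Prod.mk.injEq] at h'
  obtain ⟨n, hn⟩ := Real.Angle.angle_eq_iff_two_pi_dvd_sub.1 (Real.Angle.cos_sin_inj h'.1 h'.2)
  have hn' : s - t = n := by
    have := Real.pi_pos
    apply mul_left_cancel₀ (two_pi_ne_zero' : (2 * Real.pi) ≠ 0)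
    linarith
  have h1 : (n : ℝ) < 0 := by linarith
  have h2 : (-1 : ℝ) ≤ n := by linarith [hs.1, ht.2]
  have h3 : n = -1 := by
    have h1' : n < 0 := by exact_mod_cast h1
    have h2' : -1 ≤ n := by exact_mod_cast h2
    omega
  rw [h3] at hn'
  push_cast at hn'
  constructor <;> linarith [hs.1, ht.2]
where
  two_pi_ne_zero' : (2 * Real.pi) ≠ 0 := by positivity

theorem circPoint_zero_eq_one : circPoint 0 = circPoint 1 := by
  simp [circPoint]

theorem exists_circPoint (p : Circ) : ∃ t ∈ Icc (0 : ℝ) 1, circPoint t = p := by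
  obtain ⟨⟨x, y⟩, h⟩ := p
  have h' : x ^ 2 + y ^ 2 = 1 := h
  set z : ℂ := ⟨x, y⟩
  have hz : ‖z‖ = 1 := by
    rw [Complex.norm_eq_sqrt_sq_add_sq, Real.sqrt_eq_one]
    exact h'
  have hz0 : z ≠ 0 := fun h => by rw [h, norm_zero] at hz; exact zero_ne_one hz
  have hpi := Real.pi_pos
  have hc : Real.cos (Complex.arg z) = x := by rw [Complex.cos_arg hz0, hz, div_one]
  have hs : Real.sin (Complex.arg z) = y := by rw [Complex.sin_arg, hz, div_one]
  have hm : ∀ a : ℝ, 2 * Real.pi * (a / (2 * Real.pi)) = a := fun a => by field_simp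
  rcases le_or_gt 0 (Complex.arg z) with h0 | h0
  · refine ⟨Complex.arg z / (2 * Real.pi), ⟨by positivity, ?_⟩, Subtype.ext ?_⟩
    · rw [div_le_one (by positivity)]
      linarith [Complex.arg_le_pi z]
    · simp only [circPoint, hm, hc, hs]
  · refine ⟨(Complex.arg z + 2 * Real.pi) / (2 * Real.pi), ⟨?_, ?_⟩, Subtype.ext ?_⟩
    · have := Complex.neg_pi_lt_arg z
      apply div_nonneg <;> linarith
    · rw [div_le_one (by positivity)]
      linarith
    · simp only [circPoint, hm, Real.cos_add_two_pi, Real.sin_add_two_pi, hc, hs]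

end CirclePoints

section Loops

variable {S : Type*} [TopologicalSpace S]

/-- A closed edge. -/
structure IsLoop (γ : ℝ → S) : Prop where
  edge : IsEdge γ
  closed : γ 0 = γ 1

theorem IsSimpleClosedCurve.exists_loop {α : Set S} (h : IsSimpleClosedCurve α) :
    ∃ γ, IsLoop γ ∧ γ '' Icc 0 1 = α := by
  obtain ⟨f, hf, rfl⟩ := h
  refine ⟨fun t => f (circPoint t), ⟨⟨(hf.continuous.comp continuous_circPoint).continuousOn,
    fun s hs t ht hst e => circPoint_eq hs ht hst (hf.injective e)⟩,
    congrArg f circPoint_zero_eq_one⟩, ?_⟩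
  ext x
  constructor
  · rintro ⟨t, -, rfl⟩
    exact ⟨_, rfl⟩
  · rintro ⟨p, rfl⟩
    obtain ⟨t, ht, rfl⟩ := exists_circPoint p
    exact ⟨t, ht, rfl⟩

theorem isCompact_Circ : IsCompact Circ := by
  have : Circ = (fun t => (circPoint t : ℝ × ℝ)) '' Icc 0 1 := by
    ext p
    constructor
    · intro hp
      obtain ⟨t, ht, e⟩ := exists_circPoint ⟨p, hp⟩
      exact ⟨t, ht, congrArg Subtype.val e⟩
    · rintro ⟨t, -, rfl⟩
      exact (circPoint t).2
  rw [this]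
  exact isCompact_Icc.image (continuous_subtype_val.comp continuous_circPoint)

namespace IsLoop

variable {γ : ℝ → S}

theorem isSimpleClosedCurve [T2Space S] (h : IsLoop γ) : IsSimpleClosedCurve (γ '' Icc 0 1) := by
  choose θ hθ hθe using exists_circPoint
  have key : ∀ s ∈ Icc (0 : ℝ) 1, ∀ t ∈ Icc (0 : ℝ) 1, circPoint s = circPoint t ↔ γ s = γ t := by
    have : ∀ s ∈ Icc (0 : ℝ) 1, ∀ t ∈ Icc (0 : ℝ) 1, s < t →
        (circPoint s = circPoint t ↔ γ s = γ t) := fun s hs t ht hst => by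
      constructor
      · intro e
        obtain ⟨rfl, rfl⟩ := circPoint_eq hs ht hst e
        exact h.closed
      · intro e
        obtain ⟨rfl, rfl⟩ := h.edge.2 s hs t ht hst e
        exact circPoint_zero_eq_one
    intro s hs t ht
    rcases lt_trichotomy s t with hst | rfl | hst
    · exact this s hs t ht hst
    · simp
    · rw [eq_comm, this t ht s hs hst, eq_comm]
  have : CompactSpace Circ := isCompact_iff_compactSpace.1 isCompact_Circ
  have hq : IsQuotientMap fun t : Icc (0 : ℝ) 1 => circPoint t :=
    (continuous_circPoint.comp continuous_subtype_val).isClosedMap.isQuotientMap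
      (continuous_circPoint.comp continuous_subtype_val)
      fun p => ⟨⟨θ p, hθ p⟩, hθe p⟩
  have hγ : ∀ t ∈ Icc (0 : ℝ) 1, γ (θ (circPoint t)) = γ t := fun t ht =>
    (key _ (hθ _) t ht).1 (hθe _)
  refine ⟨fun p => γ (θ p), (Continuous.isClosedEmbedding ?_ ?_).isEmbedding, ?_⟩
  · rw [hq.continuous_iff]
    have : Continuous fun t : Icc (0 : ℝ) 1 => γ t := continuousOn_iff_continuous_domRestrict.1 h.edge.1
    exact this.congr fun t => (hγ t t.2).symm
  · intro p q e
    rw [← hθe p, ← hθe q]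
    exact (key _ (hθ p) _ (hθ q)).2 e
  · ext x
    constructor
    · rintro ⟨p, rfl⟩
      exact ⟨_, hθ p, rfl⟩
    · rintro ⟨t, ht, rfl⟩
      exact ⟨circPoint t, hγ t ht⟩

theorem exists_rebase (h : IsLoop γ) {x : S} (hx : x ∈ γ '' Icc 0 1) :
    ∃ δ, IsLoop δ ∧ δ 0 = x ∧ δ '' Icc 0 1 = γ '' Icc 0 1 := by
  obtain ⟨a, ha, rfl⟩ := hx
  by_cases h01 : a = 0 ∨ a = 1
  · refine ⟨γ, h, ?_, rfl⟩
    rcases h01 with rfl | rfl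
    exacts [rfl, h.closed]
  push Not at h01
  have ha' : a ∈ Ioo (0 : ℝ) 1 := ⟨lt_of_le_of_ne ha.1 h01.1.symm, lt_of_le_of_ne ha.2 h01.2⟩
  have h0 : γ a ≠ γ 0 := fun e => h01.1 (h.edge.eq_of_mem_Ioo ha' (by simp) e)
  have h1 : γ a ≠ γ 1 := fun e => h01.2 (h.edge.eq_of_mem_Ioo ha' (by simp) e)
  refine ⟨concat (reparam γ a 1) (reparam γ 0 a), ⟨?_, by simp⟩, by simp, ?_⟩
  · refine (h.edge.reparam ha.1 ha'.2 le_rfl).concat (h.edge.reparam le_rfl ha'.1 ha.2)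
      (by simpa) (by simpa using h0.symm) (by simpa using h.closed.symm) fun s hs t ht e => ?_
    have hs' := affine_mem_Icc ha.2 hs
    have ht' := affine_mem_Icc ha.1 ht
    simp only [reparam] at e
    rcases (ht'.2.trans hs'.1).eq_or_lt with h' | h'
    · refine Or.inr ⟨?_, ?_⟩
      · have : (1 - a) * s = 0 := by linarith [hs'.1, ht'.2]
        exact (mul_eq_zero.1 this).resolve_left (sub_ne_zero.2 ha'.2.ne')
      · have : a * (t - 1) = 0 := by linarith [hs'.1, ht'.2]
        linarith [(mul_eq_zero.1 this).resolve_left ha'.1.ne']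
    · obtain ⟨e0, e1⟩ := h.edge.2 _ ⟨ht'.1, ht'.2.trans ha.2⟩ _ ⟨ha.1.trans hs'.1, hs'.2⟩ h' e.symm
      refine Or.inl ⟨?_, ?_⟩
      · have : (1 - a) * (s - 1) = 0 := by linarith
        linarith [(mul_eq_zero.1 this).resolve_left (sub_ne_zero.2 ha'.2.ne')]
      · have : a * t = 0 := by linarith
        exact (mul_eq_zero.1 this).resolve_left ha'.1.ne'
  · rw [concat_image (by simpa using h.closed.symm), reparam_image_of_le _ ha.2,
      reparam_image_of_le _ ha.1, ← image_union, union_comm, Icc_union_Icc_eq_Icc ha.1 ha.2]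

variable [T2Space S]

/-- A loop in the frontier of each of its nonempty sides. -/
theorem subset_closure_side [PreconnectedSpace S] (h : IsLoop γ)
    (hB : Disjoint (γ '' Icc 0 1) (Bd S)) {E : Set S} (hE : IsSide E (γ '' Icc 0 1))
    (hne : E.Nonempty) : γ '' Icc 0 1 ⊆ closure E := fun x hx => by
  by_contra hxE
  obtain ⟨δ, hδ, rfl, hδi⟩ := h.exists_rebase hx
  rw [← hδi] at hB hE
  have hopen : IsOpen (closure E)ᶜ := isClosed_closure.isOpen_compl
  have h0 : ∀ᶠ t in 𝓝[Icc (0 : ℝ) 1] 0, δ t ∈ (closure E)ᶜ :=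
    (hδ.edge.1 0 (by simp)).eventually_mem (hopen.mem_nhds hxE)
  have h1 : ∀ᶠ t in 𝓝[Icc (0 : ℝ) 1] 1, δ t ∈ (closure E)ᶜ :=
    (hδ.edge.1 1 (by simp)).eventually_mem (hopen.mem_nhds (hδ.closed ▸ hxE))
  obtain ⟨r0, hr0, h0⟩ := Metric.mem_nhdsWithin_iff.1 h0
  obtain ⟨r1, hr1, h1⟩ := Metric.mem_nhdsWithin_iff.1 h1
  set r := min (min r0 r1 / 2) (1 / 4)
  have hr : 0 < r := by positivity
  have hrr0 : r < r0 := by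
    have := min_le_left (min r0 r1 / 2) (1 / 4)
    have := min_le_left r0 r1
    linarith
  have hrr1 : r < r1 := by
    have := min_le_left (min r0 r1 / 2) (1 / 4)
    have := min_le_right r0 r1
    linarith
  have hr4 : r ≤ 1 / 4 := min_le_right _ _
  have hend : ∀ t ∈ Icc (0 : ℝ) r ∪ Icc (1 - r) 1, δ t ∉ closure E := by
    rintro t (ht | ht)
    · refine h0 ⟨?_, ht.1, by linarith [ht.2]⟩
      rw [Metric.mem_ball, Real.dist_eq, abs_lt]
      constructor <;> linarith [ht.1, ht.2]
    · refine h1 ⟨?_, by linarith [ht.1], ht.2⟩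
      rw [Metric.mem_ball, Real.dist_eq, abs_lt]
      constructor <;> linarith [ht.1, ht.2]
  have hX : δ '' Icc 0 1 = δ '' Icc r (1 - r) ∪ δ '' (Icc 0 r ∪ Icc (1 - r) 1) := by
    rw [← image_union]
    congr 1
    ext t
    constructor
    · intro ht
      by_cases h2 : t ≤ r
      · exact Or.inr (Or.inl ⟨ht.1, h2⟩)
      by_cases h3 : 1 - r ≤ t
      · exact Or.inr (Or.inr ⟨h3, ht.2⟩)
      · exact Or.inl ⟨by linarith, by linarith⟩
    · rintro (ht | ht | ht) <;> constructor <;> linarith [ht.1, ht.2]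
  have hmid : Icc r (1 - r) ⊆ Icc (0 : ℝ) 1 := Icc_subset_Icc hr.le (by linarith)
  have hE' : IsSide E (δ '' Icc r (1 - r)) := by
    refine IsSide.of_closure_disjoint (A := δ '' (Icc 0 r ∪ Icc (1 - r) 1)) (by rwa [← hX])
      (hδ.edge.isClosed_image_Icc hr.le (by linarith)) ?_
    rw [disjoint_left]
    rintro _ hz ⟨t, ht, rfl⟩
    exact hend t ht hz
  have hEq := IsSide.arc_eq (by linarith) (hδ.edge.1.mono hmid)
    (hδ.edge.injOn_Icc hr.le (by linarith) (Or.inl hr)) (hB.mono_left (image_mono hmid)) hE' hne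
  refine hxE (subset_closure (hEq ▸ ?_))
  rintro ⟨t, ht, e⟩
  have := hδ.edge.eq_of_mem_Ioo ⟨by linarith [ht.1], by linarith [ht.2]⟩ (by simp) e
  linarith [ht.1]

theorem not_three_sides [PreconnectedSpace S] (h : IsLoop γ) (hB : Disjoint (γ '' Icc 0 1) (Bd S))
    {E₀ E₁ E₂ : Set S} (h0 : IsSide E₀ (γ '' Icc 0 1)) (h1 : IsSide E₁ (γ '' Icc 0 1))
    (h2 : IsSide E₂ (γ '' Icc 0 1)) (n0 : E₀.Nonempty) (n1 : E₁.Nonempty) (n2 : E₂.Nonempty)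
    (h01 : Disjoint E₀ E₁) (h02 : Disjoint E₀ E₂) (h12 : Disjoint E₁ E₂) : False := by
  set f : Fin 2 → Unit × Bool := ![((), false), ((), true)]
  have hsys : IsSystem (Bd S)ᶜ fun _ : Unit => γ :=
    ⟨fun _ => h.edge, fun _ => hB.subset_compl_right, fun i j hij => absurd rfl hij, fun v =>
      (ncard_le_ncard (subset_univ _) (toFinite _)).trans (by simp)⟩
  have hf : Function.Injective f := by decide
  have hend : ∀ e : Unit × Bool, endp (fun _ => γ) e = γ 0 := by
    rintro ⟨-, b⟩
    cases b
    · simp [endp]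
    · simpa [endp] using h.closed.symm
  have hsp := hsys.isSpider disjoint_compl_left hf two_pos (fun k => hend _)
  have hX := rest_union (γ := fun _ : Unit => γ) (v := γ 0) (f := f) (by
    rintro ⟨⟨⟩, b⟩ -
    cases b
    exacts [⟨0, rfl⟩, ⟨1, rfl⟩])
  obtain ⟨B, hBn, hsec⟩ := hsp.sectors two_pos
  have hsupp : support (fun _ : Unit => γ) = γ '' Icc 0 1 := iUnion_const _
  rw [hX, hsupp] at hsec
  have hpt : ∀ {E : Set S}, IsSide E (γ '' Icc 0 1) → E.Nonempty → ∃ x ∈ B, x ∈ E :=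
    fun hE hn => mem_closure_iff_nhds.1 (h.subset_closure_side hB hE hn ⟨0, by simp, rfl⟩) B hBn
  have hsep : ∀ {E E' : Set S} {x y : S}, IsSide E (γ '' Icc 0 1) → IsSide E' (γ '' Icc 0 1) →
      Disjoint E E' → x ∈ E → y ∈ E' → x ∉ connectedComponentIn (γ '' Icc 0 1)ᶜ y :=
    fun hE hE' hd hx hy hxy => disjoint_left.1 hd (hE.subset_of_isPreconnected
      isPreconnected_connectedComponentIn
      (disjoint_left.2 fun z hz => connectedComponentIn_subset _ _ hz) hxy hx
      (mem_connectedComponentIn (disjoint_left.1 hE'.2.1 hy))) hy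
  obtain ⟨x0, b0, e0⟩ := hpt h0 n0
  obtain ⟨x1, b1, e1⟩ := hpt h1 n1
  obtain ⟨x2, b2, e2⟩ := hpt h2 n2
  rcases hsec x0 ![x1, x2] b0 (by intro j; fin_cases j <;> assumption)
    (disjoint_left.1 h0.2.1 e0) (by
      intro j
      fin_cases j
      exacts [disjoint_left.1 h1.2.1 e1, disjoint_left.1 h2.2.1 e2]) with ⟨j, hj⟩ | ⟨i, j, hij, hj⟩
  · fin_cases j
    exacts [hsep h0 h1 h01 e0 e1 hj, hsep h0 h2 h02 e0 e2 hj]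
  · fin_cases i <;> fin_cases j <;> first
      | exact hij rfl
      | exact hsep h1 h2 h12 e1 e2 hj
      | exact hsep h2 h1 h12.symm e2 e1 hj

/-- Both sides of a separating loop are connected. -/
theorem isPreconnected_side [PreconnectedSpace S] (h : IsLoop γ)
    (hB : Disjoint (γ '' Icc 0 1) (Bd S)) {E : Set S} (hE : IsSide E (γ '' Icc 0 1))
    (hne : (E ∪ γ '' Icc 0 1)ᶜ.Nonempty) : IsPreconnected E := by
  rw [isPreconnected_iff_subset_of_disjoint]
  intro u v hu hv huv hE0
  by_contra! hcon
  have aux : ∀ u v : Set S, IsOpen u → IsOpen v → E ⊆ u ∪ v → E ∩ (u ∩ v) = ∅ →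
      IsSide (E ∩ u) (γ '' Icc 0 1) := fun u v hu hv huv hE0 => by
    refine ⟨hE.1.inter hu, hE.2.1.mono_left inter_subset_left, ?_⟩
    have : E ∩ u ∪ γ '' Icc 0 1 = (E ∩ v)ᶜ ∩ (E ∪ γ '' Icc 0 1) := by
      ext x
      constructor
      · rintro (⟨hx, hxu⟩ | hx)
        · exact ⟨fun hxv => (hE0 ▸ ⟨hx, hxu, hxv.2⟩ : x ∈ (∅ : Set S)), Or.inl hx⟩
        · exact ⟨fun hxv => disjoint_left.1 hE.2.1 hxv.1 hx, Or.inr hx⟩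
      · rintro ⟨hx, hx' | hx'⟩
        · rcases huv hx' with h' | h'
          exacts [Or.inl ⟨hx', h'⟩, absurd ⟨hx', h'⟩ hx]
        · exact Or.inr hx'
    rw [this]
    exact (hE.1.inter hv).isClosed_compl.inter hE.2.2
  obtain ⟨⟨x, hxE, hxu⟩, y, hyE, hyv⟩ := (⟨not_subset.1 hcon.1, not_subset.1 hcon.2⟩ :
    (∃ x ∈ E, x ∉ u) ∧ ∃ y ∈ E, y ∉ v)
  refine h.not_three_sides hB (aux u v hu hv huv hE0)
    (aux v u hv hu (by rwa [union_comm]) (by rwa [inter_comm v u])) hE.compl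
    ⟨y, hyE, (huv hyE).resolve_right hyv⟩ ⟨x, hxE, (huv hxE).resolve_left hxu⟩ hne ?_ ?_ ?_
  · rw [disjoint_left]
    rintro z ⟨hz, hzu⟩ ⟨-, hzv⟩
    exact (hE0 ▸ ⟨hz, hzu, hzv⟩ : z ∈ (∅ : Set S))
  · exact disjoint_left.2 fun z hz hz' => hz' (Or.inl hz.1)
  · exact disjoint_left.2 fun z hz hz' => hz' (Or.inl hz.1)

end IsLoop

theorem IsBoundaryIsolating.exists_isolated_end [T2Space S] [PreconnectedSpace S] {α : Set S}
    (h : IsBoundaryIsolating α) :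
    (Bd S).Nonempty ∧ ∃ K : Set S, IsCompact K ∧ ∃ x ∈ Kᶜ,
        ∃ U BU : Set S, U = closure (connectedComponentIn Kᶜ x) ∧
          BU = frontier U ∪ (U ∩ Bd S) ∧
          ¬ IsCompact U ∧ IsConnected BU ∧ IsCompact BU := by
  obtain ⟨hα, hαB, Y, Z, hYZ, hcomp, hY, hZ, hZc⟩ := h
  obtain ⟨γ, hγ, rfl⟩ := hα.exists_loop
  have hB : Disjoint (γ '' Icc 0 1) (Bd S) := disjoint_iff_inter_eq_empty.2 hαB
  have hcl := hγ.edge.isClosed_image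
  set α := γ '' Icc 0 1
  obtain ⟨y, hy, rfl⟩ := (hcomp Y).2 (Or.inl rfl)
  obtain ⟨z, hz, rfl⟩ := (hcomp Z).2 (Or.inr rfl)
  set Y := connectedComponentIn αᶜ y
  set Z := connectedComponentIn αᶜ z
  have hcov : ∀ x ∉ α, x ∈ Y ∨ x ∈ Z := fun x hx => by
    rcases (hcomp _).1 ⟨x, hx, rfl⟩ with h | h
    · exact Or.inl (h ▸ mem_connectedComponentIn hx)
    · exact Or.inr (h ▸ mem_connectedComponentIn hx)
  have hYα : Y ⊆ αᶜ := connectedComponentIn_subset _ _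
  have hZα : Z ⊆ αᶜ := connectedComponentIn_subset _ _
  have hdisj : Disjoint Y Z := by
    by_contra hcon
    obtain ⟨w, hwY, hwZ⟩ := not_disjoint_iff.1 hcon
    exact hYZ ((connectedComponentIn_eq hwY).trans (connectedComponentIn_eq hwZ).symm)
  have hclosed : ∀ w, IsClosed (connectedComponentIn αᶜ w ∪ α) := fun w => by
    refine isClosed_of_closure_subset ?_
    rw [closure_union, hcl.closure_eq]
    rintro x (hx | hx)
    · by_cases hxα : x ∈ α
      · exact Or.inr hxα
      · exact Or.inl (closure_connectedComponentIn_inter _ _ ⟨hx, hxα⟩)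
    · exact Or.inr hx
  have hYo : IsOpen Y := by
    have : Y = (Z ∪ α)ᶜ := by
      ext x
      constructor
      · exact fun hx h' => h'.elim (disjoint_left.1 hdisj hx) (hYα hx)
      · exact fun hx => (hcov x fun h' => hx (Or.inr h')).resolve_right fun h' => hx (Or.inl h')
    rw [this]
    exact (hclosed z).isOpen_compl
  have hZo : IsOpen Z := by
    have : Z = (Y ∪ α)ᶜ := by
      ext x
      constructor
      · exact fun hx h' => h'.elim (fun h' => disjoint_left.1 hdisj h' hx) (hZα hx)
      · exact fun hx => (hcov x fun h' => hx (Or.inr h')).resolve_left fun h' => hx (Or.inl h')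
    rw [this]
    exact (hclosed y).isOpen_compl
  have hYs : IsSide Y α := ⟨hYo, disjoint_left.2 hYα, hclosed y⟩
  have hZs : IsSide Z α := ⟨hZo, disjoint_left.2 hZα, hclosed z⟩
  have hαY : α ⊆ closure Y := hγ.subset_closure_side hB hYs ⟨y, mem_connectedComponentIn hy⟩
  have hαZ : α ⊆ closure Z := hγ.subset_closure_side hB hZs ⟨z, mem_connectedComponentIn hz⟩
  have hU : closure Z = Z ∪ α :=
    (closure_minimal subset_union_left (hclosed z)).antisymm (union_subset subset_closure hαZ)
  have hfr : frontier (closure Z) ∪ closure Z ∩ Bd S = α := by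
    have h1 : closure Z ∩ Bd S = ∅ := by
      rw [hU, union_inter_distrib_right, hZ, hαB, union_empty]
    rw [h1, union_empty, frontier, closure_closure]
    ext x
    constructor
    · rintro ⟨hx, hxi⟩
      rw [hU] at hx
      exact hx.resolve_left fun h' => hxi (interior_mono subset_closure (hZo.interior_eq.symm ▸ h'))
    · refine fun hx => ⟨hαZ hx, fun hxi => ?_⟩
      obtain ⟨w, hw, hwY⟩ := mem_closure_iff.1 (hαY hx) _ isOpen_interior hxi
      have := interior_subset hw
      rw [hU] at this
      exact this.elim (disjoint_left.1 hdisj hwY) (hYα hwY)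
  refine ⟨hY.mono inter_subset_right, α, hγ.edge.isCompact_image, z, hz, _, _, rfl, rfl, ?_, ?_, ?_⟩
  · rwa [hU]
  · rw [hfr]
    exact ⟨⟨γ 0, 0, by simp, rfl⟩, isPreconnected_Icc.image _ hγ.edge.1⟩
  · rw [hfr]
    exact hγ.edge.isCompact_image

end Loops

/-! ### Subdivision of the parameter interval -/

section Intervals

/-- A finite set of intervals in `[0, 1]` with disjoint interiors. -/
structure IsCutting (P : Finset (ℝ × ℝ)) : Prop where
  nonneg : ∀ p ∈ P, 0 ≤ p.1
  lt : ∀ p ∈ P, p.1 < p.2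
  le_one : ∀ p ∈ P, p.2 ≤ 1
  disj : ∀ p ∈ P, ∀ q ∈ P, p ≠ q → p.2 ≤ q.1 ∨ q.2 ≤ p.1

namespace IsCutting

variable {P : Finset (ℝ × ℝ)} {p q : ℝ × ℝ}

theorem eq_of_fst_eq (h : IsCutting P) (hp : p ∈ P) (hq : q ∈ P) (e : p.1 = q.1) : p = q := by
  by_contra hne
  have := h.lt p hp
  have := h.lt q hq
  rcases h.disj p hp q hq hne with h' | h' <;> linarith

theorem eq_of_snd_eq (h : IsCutting P) (hp : p ∈ P) (hq : q ∈ P) (e : p.2 = q.2) : p = q := by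
  by_contra hne
  have := h.lt p hp
  have := h.lt q hq
  rcases h.disj p hp q hq hne with h' | h' <;> linarith

theorem mem_Icc (h : IsCutting P) (hp : p ∈ P) {x : ℝ} (hx : x ∈ Icc p.1 p.2) : x ∈ Icc (0 : ℝ) 1 :=
  ⟨(h.nonneg p hp).trans hx.1, hx.2.trans (h.le_one p hp)⟩

end IsCutting

/-- Cutting `[0, 1]` at finitely many points. -/
theorem exists_cutting (A : Finset ℝ) : ∃ P, IsCutting P ∧
    (∀ x ∈ Icc (0 : ℝ) 1, ∃ p ∈ P, x ∈ Icc p.1 p.2) ∧ ∀ x ∈ A, ∀ p ∈ P, x ∉ Ioo p.1 p.2 := by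
  classical
  induction A using Finset.induction_on with
  | empty =>
    refine ⟨{(0, 1)}, ⟨?_, ?_, ?_, ?_⟩, fun x hx => ⟨(0, 1), by simp, hx⟩, by simp⟩
    all_goals simp
  | insert a A ha ih =>
    obtain ⟨P, hP, hcov, hA⟩ := ih
    by_cases hex : ∃ p ∈ P, a ∈ Ioo p.1 p.2
    · obtain ⟨p, hp, hap⟩ := hex
      have hmem : ∀ q, q ∈ insert (p.1, a) (insert (a, p.2) (P.erase p)) ↔
          q = (p.1, a) ∨ q = (a, p.2) ∨ (q ≠ p ∧ q ∈ P) := fun q => by simp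
      have h0 := hP.nonneg p hp
      have h1 := hP.le_one p hp
      refine ⟨insert (p.1, a) (insert (a, p.2) (P.erase p)), ⟨fun q hq => ?_, fun q hq => ?_,
        fun q hq => ?_, fun q hq q' hq' hne => ?_⟩, fun x hx => ?_, fun x hx q hq => ?_⟩
      · rcases (hmem q).1 hq with rfl | rfl | hq
        exacts [h0, h0.trans hap.1.le, hP.nonneg q hq.2]
      · rcases (hmem q).1 hq with rfl | rfl | hq
        exacts [hap.1, hap.2, hP.lt q hq.2]
      · rcases (hmem q).1 hq with rfl | rfl | hq
        exacts [hap.2.le.trans h1, h1, hP.le_one q hq.2]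
      · rcases (hmem q).1 hq with rfl | rfl | hq <;> rcases (hmem q').1 hq' with rfl | rfl | hq'
        · exact absurd rfl hne
        · exact Or.inl le_rfl
        · exact (hP.disj p hp q' hq'.2 hq'.1.symm).imp (fun h => hap.2.le.trans h) id
        · exact Or.inr le_rfl
        · exact absurd rfl hne
        · exact (hP.disj p hp q' hq'.2 hq'.1.symm).imp id fun h => h.trans hap.1.le
        · exact (hP.disj q hq.2 p hp hq.1).imp id fun h => hap.2.le.trans h
        · exact (hP.disj q hq.2 p hp hq.1).imp (fun h => h.trans hap.1.le) id
        · exact hP.disj q hq.2 q' hq'.2 hne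
      · obtain ⟨q, hq, hxq⟩ := hcov x hx
        by_cases hqp : q = p
        · subst hqp
          rcases le_total x a with hxa | hxa
          · exact ⟨_, (hmem _).2 (Or.inl rfl), hxq.1, hxa⟩
          · exact ⟨_, (hmem _).2 (Or.inr (Or.inl rfl)), hxa, hxq.2⟩
        · exact ⟨q, (hmem q).2 (Or.inr (Or.inr ⟨hqp, hq⟩)), hxq⟩
      · rcases Finset.mem_insert.1 hx with rfl | hx
        · rcases (hmem q).1 hq with rfl | rfl | hq
          · exact fun h => lt_irrefl _ h.2
          · exact fun h => lt_irrefl _ h.1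
          · rcases hP.disj p hp q hq.2 hq.1.symm with h | h
            · exact fun h' => (hap.2.trans_le h).not_gt h'.1
            · exact fun h' => (h'.2.trans_le h).not_gt hap.1
        · rcases (hmem q).1 hq with rfl | rfl | hq
          · exact fun h => hA x hx p hp ⟨h.1, h.2.trans hap.2⟩
          · exact fun h => hA x hx p hp ⟨hap.1.trans h.1, h.2⟩
          · exact hA x hx q hq.2
    · push Not at hex
      refine ⟨P, hP, hcov, fun x hx p hp => ?_⟩
      rcases Finset.mem_insert.1 hx with rfl | hx
      exacts [hex p hp, hA x hx p hp]

theorem exists_last_le {f : ℝ → ℝ} (hf : ContinuousOn f (Icc 0 1)) {a b : ℝ} (hab : a < b)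
    (h0 : f 0 < a ∨ b < f 0) {x : ℝ} (hx : x ∈ Icc (0 : ℝ) 1) (hxb : b ≤ f x) :
    ∃ s ∈ Icc 0 x, (∀ u ∈ Ioc s x, a < f u) ∧ ((s = 0 ∧ b < f s) ∨ (0 < s ∧ s < x ∧ f s = a)) := by
  have hI : Icc 0 x ⊆ Icc (0 : ℝ) 1 := Icc_subset_Icc le_rfl hx.2
  set A := {y ∈ Icc 0 x | f y ≤ a}
  have hA : IsCompact A := isCompact_Icc.of_isClosed_subset
    ((hf.mono hI).preimage_isClosed_of_isClosed isClosed_Icc isClosed_Iic) fun y hy => hy.1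
  rcases A.eq_empty_or_nonempty with he | hne
  · have hgt : ∀ u ∈ Icc 0 x, a < f u := fun u hu => not_le.1 fun h =>
      (he ▸ ⟨hu, h⟩ : u ∈ (∅ : Set ℝ))
    refine ⟨0, ⟨le_rfl, hx.1⟩, fun u hu => hgt u ⟨hu.1.le, hu.2⟩, Or.inl ⟨rfl, ?_⟩⟩
    exact h0.resolve_left (hgt 0 ⟨le_rfl, hx.1⟩).not_gt
  · obtain ⟨hs, hsa⟩ := hA.sSup_mem hne
    set s := sSup A
    have hgt : ∀ u ∈ Ioc s x, a < f u := fun u hu => not_le.1 fun h =>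
      hu.1.not_ge (le_csSup hA.bddAbove ⟨⟨hs.1.trans hu.1.le, hu.2⟩, h⟩)
    have hsx : s < x := lt_of_le_of_ne hs.2 fun e => by rw [e] at hsa; linarith
    have hfs : a ≤ f s := by
      have : s ∈ closure (Ioc s x) := by
        rw [closure_Ioc hsx.ne]
        exact ⟨le_rfl, hsx.le⟩
      have hm := ContinuousWithinAt.mem_closure_image
        ((hf s (hI hs)).mono fun u hu => hI ⟨hs.1.trans hu.1.le, hu.2⟩) this
      refine (closure_minimal (t := Ici a) ?_ isClosed_Ici hm)
      rintro _ ⟨u, hu, rfl⟩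
      exact (hgt u hu).le
    refine ⟨s, hs, hgt, Or.inr ⟨lt_of_le_of_ne hs.1 fun e => ?_, hsx, hsa.antisymm hfs⟩⟩
    rw [← e] at hsa hfs
    rcases h0 with h0 | h0 <;> linarith

/-- The maximal intervals on which a function is larger than `a` and which reach `b`. -/
theorem exists_pieces {f : ℝ → ℝ} (hf : ContinuousOn f (Icc 0 1)) {a b : ℝ} (hab : a < b)
    (h0 : f 0 < a ∨ b < f 0) (h1 : f 1 < a ∨ b < f 1) :
    ∃ P, IsCutting P ∧ (∀ p ∈ P, ∀ u ∈ Ioo p.1 p.2, a < f u) ∧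
      (∀ p ∈ P, (p.1 = 0 ∧ b < f p.1) ∨ (0 < p.1 ∧ f p.1 = a)) ∧
      (∀ p ∈ P, (p.2 = 1 ∧ b < f p.2) ∨ (p.2 < 1 ∧ f p.2 = a)) ∧
      ∀ x ∈ Icc (0 : ℝ) 1, b ≤ f x → ∃ p ∈ P, x ∈ Icc p.1 p.2 := by
  classical
  let good : ℝ × ℝ → Prop := fun p => 0 ≤ p.1 ∧ p.1 < p.2 ∧ p.2 ≤ 1 ∧
    (∀ u ∈ Ioo p.1 p.2, a < f u) ∧ ((p.1 = 0 ∧ b < f p.1) ∨ (0 < p.1 ∧ f p.1 = a)) ∧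
    ((p.2 = 1 ∧ b < f p.2) ∨ (p.2 < 1 ∧ f p.2 = a))
  have hex : ∀ x ∈ Icc (0 : ℝ) 1, b ≤ f x → ∃ p, good p ∧ x ∈ Icc p.1 p.2 := fun x hx hxb => by
    obtain ⟨s, hs, hsu, hs'⟩ := exists_last_le hf hab h0 hx hxb
    have hr : ∀ u ∈ Icc (0 : ℝ) 1, 1 - u ∈ Icc (0 : ℝ) 1 := fun u hu =>
      ⟨by linarith [hu.2], by linarith [hu.1]⟩
    obtain ⟨t, ht, htu, ht'⟩ := exists_last_le (f := fun u => f (1 - u))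
      (hf.comp (by fun_prop) hr) hab (by simpa using h1) (hr x hx) (by simpa using hxb)
    have htu' : ∀ u ∈ Ico x (1 - t), a < f u := fun u hu => by
      simpa using htu (1 - u) ⟨by linarith [hu.2], by linarith [hu.1]⟩
    refine ⟨(s, 1 - t), ⟨hs.1, ?_, by linarith [ht.1], fun u hu => ?_, hs'.imp id fun h =>
      ⟨h.1, h.2.2⟩, ht'.imp (fun h => ⟨by simp [h.1], h.2⟩) fun h => ⟨by linarith [h.1], h.2.2⟩⟩,
      hs.2, by linarith [ht.2]⟩
    · rcases hs' with ⟨hs0, -⟩ | ⟨-, hsx, -⟩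
      · rcases ht' with ⟨ht0, -⟩ | ⟨-, htx, -⟩
        · simp [hs0, ht0]
        · simp only
          linarith [hs.2]
      · simp only
        linarith [ht.2]
    · rcases le_or_gt u x with h | h
      · exact hsu u ⟨hu.1, h⟩
      · exact htu' u ⟨h.le, hu.2⟩
  have hmax : ∀ p, good p → ∀ x ∈ Icc p.1 p.2, ∀ y ∈ Icc (0 : ℝ) 1, (∀ u ∈ uIcc x y, a < f u) →
      y ∈ Icc p.1 p.2 := fun p hp x hx y hy hxy => by
    obtain ⟨hp0, hpp, hp1, -, hpl, hpr⟩ := hp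
    constructor
    · by_contra! hlt
      have := hxy p.1 (by rw [uIcc_of_ge (hlt.le.trans hx.1)]; exact ⟨hlt.le, hx.1⟩)
      rcases hpl with h | h
      · linarith [hy.1, h.1]
      · linarith [h.2]
    · by_contra! hlt
      have := hxy p.2 (by rw [uIcc_of_le (hx.2.trans hlt.le)]; exact ⟨hx.2, hlt.le⟩)
      rcases hpr with h | h
      · linarith [hy.2, h.1]
      · linarith [h.2]
  have hleft : ∀ p q, good p → good q → p.1 < q.1 → q.1 < p.2 → False := fun p q hp hq h h' => by
    have := hp.2.2.2.1 q.1 ⟨h, h'⟩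
    rcases hq.2.2.2.2.1 with e | e
    · linarith [hp.1, e.1]
    · linarith [e.2]
  have hright : ∀ p q, good p → good q → p.1 < q.2 → q.2 < p.2 → False := fun p q hp hq h h' => by
    have := hp.2.2.2.1 q.2 ⟨h, h'⟩
    rcases hq.2.2.2.2.2 with e | e
    · linarith [hp.2.2.1, e.1]
    · linarith [e.2]
  have hdisj : ∀ p q, good p → good q → p ≠ q → p.2 ≤ q.1 ∨ q.2 ≤ p.1 := fun p q hp hq hne => by
    by_contra! hcon
    apply hne
    refine Prod.ext ?_ ?_
    · rcases lt_trichotomy p.1 q.1 with h | h | h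
      exacts [(hleft p q hp hq h hcon.1).elim, h, (hleft q p hq hp h hcon.2).elim]
    · rcases lt_trichotomy p.2 q.2 with h | h | h
      exacts [(hright q p hq hp hcon.1 h).elim, h, (hright p q hp hq hcon.2 h).elim]
  have hK : IsCompact {x ∈ Icc (0 : ℝ) 1 | b ≤ f x} := isCompact_Icc.of_isClosed_subset
    (hf.preimage_isClosed_of_isClosed isClosed_Icc isClosed_Ici) fun y hy => hy.1
  choose! g hg hgx using hex
  have hnhds : ∀ x ∈ {x ∈ Icc (0 : ℝ) 1 | b ≤ f x}, ∃ ε > 0, ∀ y ∈ Icc (0 : ℝ) 1,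
      dist y x < ε → a < f y := fun x hx => by
    have := (hf x hx.1).eventually_mem (isOpen_Ioi.mem_nhds (hab.trans_le hx.2 : f x ∈ Ioi a))
    obtain ⟨ε, hε, h⟩ := Metric.mem_nhdsWithin_iff.1 this
    exact ⟨ε, hε, fun y hy hd => h ⟨Metric.mem_ball.2 hd, hy⟩⟩
  choose! ε hε hεf using hnhds
  obtain ⟨T, hTK, hT⟩ := hK.elim_nhds_subcover (fun x => Metric.ball x (ε x))
    fun x hx => Metric.ball_mem_nhds x (hε x hx)
  have hgood : ∀ p ∈ T.image g, good p := fun p hp => by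
    obtain ⟨x, hx, rfl⟩ := Finset.mem_image.1 hp
    exact hg x (hTK x hx).1 (hTK x hx).2
  refine ⟨T.image g, ⟨fun p hp => (hgood p hp).1, fun p hp => (hgood p hp).2.1,
    fun p hp => (hgood p hp).2.2.1, fun p hp q hq => hdisj p q (hgood p hp) (hgood q hq)⟩,
    fun p hp => (hgood p hp).2.2.2.1, fun p hp => (hgood p hp).2.2.2.2.1,
    fun p hp => (hgood p hp).2.2.2.2.2, fun y hy hyb => ?_⟩
  obtain ⟨x, hx, hyx⟩ := mem_iUnion₂.1 (hT ⟨hy, hyb⟩)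
  have hxK := hTK x hx
  refine ⟨g x, Finset.mem_image_of_mem g hx, hmax _ (hg x hxK.1 hxK.2) x (hgx x hxK.1 hxK.2) y hy
    fun u hu => hεf x hxK u (uIcc_subset_Icc hxK.1 hy hu) ?_⟩
  rw [Metric.mem_ball, Real.dist_eq] at hyx
  rw [Real.dist_eq]
  rw [mem_uIcc] at hu
  rw [abs_lt] at hyx ⊢
  rcases hu with hu | hu <;> constructor <;> linarith [hu.1, hu.2]

/-- Most values are not attained at a local minimum. -/
theorem exists_generic_value {ι : Type*} [Countable ι] {f : ι → ℝ → ℝ} {r b : ℝ} (hrb : r < b) :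
    ∃ a ∈ Ioo r b, ∀ i, ∀ s x t, s < x → x < t → (∀ u ∈ Ioo s t, a ≤ f i u) → f i x ≠ a := by
  have hc : (range fun k : ι × ℚ × ℚ => sInf (f k.1 '' Icc (k.2.1 : ℝ) k.2.2)).Countable :=
    countable_range _
  obtain ⟨a, ha, har⟩ : (Ioo r b ∩
      (range fun k : ι × ℚ × ℚ => sInf (f k.1 '' Icc (k.2.1 : ℝ) k.2.2))ᶜ).Nonempty :=
    (hc.dense_compl ℝ).inter_open_nonempty _ isOpen_Ioo (nonempty_Ioo.2 hrb)
  refine ⟨a, ha, fun i s x t hs ht hu e => har ?_⟩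
  obtain ⟨p, hp, hpx⟩ := exists_rat_btwn hs
  obtain ⟨q, hq, hqt⟩ := exists_rat_btwn ht
  have hxm : f i x ∈ f i '' Icc (p : ℝ) q := ⟨x, ⟨hpx.le, hq.le⟩, rfl⟩
  have hlb : ∀ y ∈ f i '' Icc (p : ℝ) q, a ≤ y := by
    rintro _ ⟨u, h, rfl⟩
    exact hu u ⟨hp.trans_le h.1, h.2.trans_lt hqt⟩
  exact ⟨(i, p, q), (csInf_le ⟨a, hlb⟩ hxm |>.trans_eq e).antisymm (le_csInf ⟨_, hxm⟩ hlb)⟩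

end Intervals

section Subdivision

theorem eq_or_eq_of_affine {a b t : ℝ} (hab : a < b) :
    (a + (b - a) * t = a → t = 0) ∧ (a + (b - a) * t = b → t = 1) := by
  constructor <;> intro h
  · have : (b - a) * t = 0 := by linarith
    exact (mul_eq_zero.1 this).resolve_left (sub_ne_zero.2 hab.ne')
  · have : (b - a) * (t - 1) = 0 := by linarith
    linarith [(mul_eq_zero.1 this).resolve_left (sub_ne_zero.2 hab.ne')]

variable {S : Type*} {ι : Type*}

/-- The pieces of a family of edges and a loop. -/
noncomputable def pieces (γ : ι → ℝ → S) (τ : ℝ → S) (P : Option ι → Finset (ℝ × ℝ))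
    (k : Σ j, {p // p ∈ P j}) : ℝ → S :=
  reparam (k.1.elim τ γ) k.2.1.1 k.2.1.2

theorem endp_pieces (γ : ι → ℝ → S) (τ : ℝ → S) (P : Option ι → Finset (ℝ × ℝ))
    (e : (Σ j, {p // p ∈ P j}) × Bool) : endp (pieces γ τ P) e =
      (e.1.1.elim τ γ) (if e.2 then e.1.2.1.2 else e.1.2.1.1) := by
  rcases e with ⟨k, b⟩
  cases b <;> simp [endp, pieces]

variable [TopologicalSpace S]

theorem IsSystem.subdivide {V : Set S} {γ : ι → ℝ → S} [Finite ι] (h : IsSystem V γ) {τ : ℝ → S}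
    (hτ : IsLoop τ) (hτV : τ '' Icc 0 1 ⊆ V) {ρ : S → ℝ} {a : ℝ}
    (hτa : ∀ t ∈ Icc (0 : ℝ) 1, ρ (τ t) = a) (hγa : ∀ i, ρ (γ i 0) ≠ a ∧ ρ (γ i 1) ≠ a)
    {P : Option ι → Finset (ℝ × ℝ)} (hP : ∀ j, IsCutting (P j))
    (hout : ∀ i, ∀ p ∈ P (some i), ∀ u ∈ Ioo p.1 p.2, ρ (γ i u) ≠ a)
    (hsep : ∀ i, ∀ p ∈ P (some i), ∀ q ∈ P (some i), p.2 ≠ q.1)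
    (hl : ∀ i, ∀ p ∈ P (some i), p.1 = 0 ∨ ρ (γ i p.1) = a)
    (hr : ∀ i, ∀ p ∈ P (some i), p.2 = 1 ∨ ρ (γ i p.2) = a)
    (hcut : ∀ i, ∀ p ∈ P (some i), ∀ q ∈ P none, ∀ u ∈ Ioo q.1 q.2,
      τ u ≠ γ i p.1 ∧ τ u ≠ γ i p.2) :
    IsSystem V (pieces γ τ P) := by
  have hedge : ∀ j : Option ι, IsEdge (j.elim τ γ) := by
    rintro (_ | i)
    exacts [hτ.edge, h.edge i]
  have hsub : ∀ j : Option ι, (j.elim τ γ) '' Icc 0 1 ⊆ V := by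
    rintro (_ | i)
    exacts [hτV, h.subset i]
  have hIcc : ∀ j, ∀ p ∈ P j, Icc p.1 p.2 ⊆ Icc (0 : ℝ) 1 := fun j p hp x hx => (hP j).mem_Icc hp hx
  have hev : ∀ i, ∀ u : ℝ, u = 0 ∨ u = 1 → ρ (γ i u) ≠ a := by
    rintro i _ (rfl | rfl)
    exacts [(hγa i).1, (hγa i).2]
  -- interior points of pieces
  have hint : ∀ j k : Σ j, {p // p ∈ P j}, j ≠ k → ∀ x ∈ Icc j.2.1.1 j.2.1.2,
      ∀ y ∈ Icc k.2.1.1 k.2.1.2, (j.1.elim τ γ) x = (k.1.elim τ γ) y → x ∉ Ioo j.2.1.1 j.2.1.2 := by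
    rintro ⟨j, p, hp⟩ ⟨k, q, hq⟩ hne x hx y hy e hxo
    have hxI := hIcc j p hp hx
    have hyI := hIcc k q hq hy
    have hxI' : x ∈ Ioo (0 : ℝ) 1 :=
      ⟨((hP j).nonneg p hp).trans_lt hxo.1, hxo.2.trans_le ((hP j).le_one p hp)⟩
    by_cases hjk : j = k
    · subst hjk
      have hpq : p ≠ q := fun e => by subst e; exact hne rfl
      have hxy := (hedge j).eq_of_mem_Ioo hxI' hyI e
      simp only at hxo hx hy
      rcases (hP j).disj p hp q hq hpq with h' | h' <;> linarith [hxo.1, hxo.2, hy.1, hy.2]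
    rcases j with _ | i <;> rcases k with _ | i'
    · exact hjk rfl
    · have hρ : ρ (γ i' y) = a := by
        have := hτa x hxI
        rwa [show τ x = γ i' y from e] at this
      have hyo : y ∉ Ioo q.1 q.2 := fun hyo => hout i' q hq y hyo hρ
      rcases hy.1.eq_or_lt with h1 | h1
      · exact (hcut i' q hq p hp x hxo).1 (by rw [h1]; exact e)
      rcases hy.2.eq_or_lt with h2 | h2
      · exact (hcut i' q hq p hp x hxo).2 (by rw [← h2]; exact e)
      · exact hyo ⟨h1, h2⟩
    · exact hout i p hp x hxo (by rw [show γ i x = τ y from e]; exact hτa y hyI)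
    · rcases h.disj i i' (fun e => hjk (congrArg some e)) x hxI y hyI e with h' | h'
      exacts [hxI'.1.ne' h', hxI'.2.ne h']
  have hpar : ∀ (k : Σ j, {p // p ∈ P j}) {t : ℝ}, t ∈ Icc (0 : ℝ) 1 →
      k.2.1.1 + (k.2.1.2 - k.2.1.1) * t ∈ Icc k.2.1.1 k.2.1.2 := fun k t ht =>
    affine_mem_Icc ((hP k.1).lt _ k.2.2).le ht
  refine ⟨fun k => (hedge k.1).reparam ((hP k.1).nonneg _ k.2.2) ((hP k.1).lt _ k.2.2)
    ((hP k.1).le_one _ k.2.2), fun k => ?_, fun j k hjk s hs t ht e => ?_, fun v => ?_⟩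
  · rw [pieces, reparam_image_of_le _ ((hP k.1).lt _ k.2.2).le]
    exact (image_mono (hIcc _ _ k.2.2)).trans (hsub _)
  · have hx := hpar j hs
    have := hint j k hjk _ hx _ (hpar k ht) e
    have hlt := (hP j.1).lt _ j.2.2
    rcases hx.1.eq_or_lt with h1 | h1
    · exact Or.inl ((eq_or_eq_of_affine hlt).1 h1.symm)
    rcases hx.2.eq_or_lt with h2 | h2
    · exact Or.inr ((eq_or_eq_of_affine hlt).2 h2)
    · exact absurd ⟨h1, h2⟩ this
  · have hends : ∀ e : (Σ j, {p // p ∈ P j}) × Bool,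
        (if e.2 then e.1.2.1.2 else e.1.2.1.1) ∈ Icc (0 : ℝ) 1 := by
      rintro ⟨⟨j, p, hp⟩, b⟩
      have := (hP j).lt p hp
      cases b
      · exact hIcc j p hp (left_mem_Icc.2 this.le)
      · exact hIcc j p hp (right_mem_Icc.2 this.le)
    by_cases hv : ρ v = a
    · let g : (Σ j, {p // p ∈ P j}) × Bool → Option Bool := fun e =>
        e.1.1.elim (some e.2) fun _ => none
      have hg : InjOn g {e | endp (pieces γ τ P) e = v} := by
        rintro ⟨⟨j, p, hp⟩, b⟩ h1 ⟨⟨k, q, hq⟩, b'⟩ h2 e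
        have e1 := hends ⟨⟨j, p, hp⟩, b⟩
        have e2 := hends ⟨⟨k, q, hq⟩, b'⟩
        rw [mem_ofPred_eq, endp_pieces] at h1 h2
        have hpl := (hP j).lt p hp
        have hql := (hP k).lt q hq
        have hp0 := (hP j).nonneg p hp
        have hq0 := (hP k).nonneg q hq
        have hp1 := (hP j).le_one p hp
        have hq1 := (hP k).le_one q hq
        rcases j with _ | i <;> rcases k with _ | i'
        · have hb : b = b' := by simpa [g] using e
          subst hb
          have h12 := h1.trans h2.symm
          cases b
          · have : p.1 = q.1 := by
              by_contra hne
              rcases lt_or_gt_of_ne hne with hlt | hlt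
              · have := (hτ.edge.2 _ e1 _ e2 hlt h12).2
                simp only [Bool.false_eq_true, if_false] at this
                linarith
              · have := (hτ.edge.2 _ e2 _ e1 hlt h12.symm).2
                simp only [Bool.false_eq_true, if_false] at this
                linarith
            obtain rfl := (hP none).eq_of_fst_eq hp hq this
            rfl
          · have : p.2 = q.2 := by
              by_contra hne
              rcases lt_or_gt_of_ne hne with hlt | hlt
              · have := (hτ.edge.2 _ e1 _ e2 hlt h12).1
                simp only [if_true] at this
                linarith
              · have := (hτ.edge.2 _ e2 _ e1 hlt h12.symm).1
                simp only [if_true] at this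
                linarith
            obtain rfl := (hP none).eq_of_snd_eq hp hq this
            rfl
        · simp [g] at e
        · simp [g] at e
        · simp only [Option.elim_some] at h1 h2
          have h12 := h1.trans h2.symm
          have hi : i = i' := by
            by_contra hi
            exact hev i _ (h.disj i i' hi _ e1 _ e2 h12) (by rw [h1]; exact hv)
          subst hi
          have hio : (if b then p.2 else p.1) ∈ Ioo (0 : ℝ) 1 := by
            refine ⟨lt_of_le_of_ne e1.1 fun h0 => ?_, lt_of_le_of_ne e1.2 fun h0 => ?_⟩
            · exact hev i _ (Or.inl h0.symm) (by rw [h1]; exact hv)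
            · exact hev i _ (Or.inr h0) (by rw [h1]; exact hv)
          have hxy := (h.edge i).eq_of_mem_Ioo hio e2 h12
          cases b <;> cases b' <;> simp only [Bool.false_eq_true, if_false, if_true] at hxy
          · obtain rfl := (hP _).eq_of_fst_eq hp hq hxy
            rfl
          · exact absurd hxy.symm (hsep i q hq p hp)
          · exact absurd hxy (hsep i p hp q hq)
          · obtain rfl := (hP _).eq_of_snd_eq hp hq hxy
            rfl
      calc _ ≤ (univ : Set (Option Bool)).ncard :=
            ncard_le_ncard_of_injOn g (fun _ _ => mem_univ _) hg (toFinite _)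
        _ = 3 := by simp
    · rcases isEmpty_or_nonempty ι with hι | hι
      · have : {e | endp (pieces γ τ P) e = v} = ∅ := by
          refine eq_empty_of_forall_notMem ?_
          rintro ⟨⟨_ | i, p, hp⟩, b⟩ h1
          · have e1 := hends ⟨⟨none, p, hp⟩, b⟩
            rw [mem_ofPred_eq, endp_pieces] at h1
            exact hv (h1 ▸ hτa _ e1)
          · exact hι.elim i
        simp [this]
      let g : (Σ j, {p // p ∈ P j}) × Bool → ι × Bool := fun e =>
        (e.1.1.elim hι.some id, e.2)
      have hsome : ∀ e ∈ {e | endp (pieces γ τ P) e = v}, ∃ i p, ∃ hp : p ∈ P (some i), ∃ b,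
          e = ⟨⟨some i, p, hp⟩, b⟩ ∧ (if b then p.2 else p.1) = (if b then 1 else 0) ∧
            γ i (if b then p.2 else p.1) = v := by
        rintro ⟨⟨_ | i, p, hp⟩, b⟩ h1
        · have e1 := hends ⟨⟨none, p, hp⟩, b⟩
          rw [mem_ofPred_eq, endp_pieces] at h1
          exact absurd (h1 ▸ hτa _ e1) hv
        · rw [mem_ofPred_eq, endp_pieces] at h1
          refine ⟨i, p, hp, b, rfl, ?_, h1⟩
          simp only [Option.elim_some] at h1
          cases b <;> simp only [Bool.false_eq_true, if_false, if_true] at h1 ⊢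
          · exact (hl i p hp).resolve_right fun h' => hv (h1 ▸ h')
          · exact (hr i p hp).resolve_right fun h' => hv (h1 ▸ h')
      refine (ncard_le_ncard_of_injOn g (t := {e | endp γ e = v}) ?_ ?_ (toFinite _)).trans
        (h.degree v)
      · intro e he
        obtain ⟨i, p, hp, b, rfl, hb, hv⟩ := hsome e he
        rw [hb] at hv
        exact hv
      · intro e he e' he' hg
        obtain ⟨i, p, hp, b, rfl, hb, -⟩ := hsome e he
        obtain ⟨i', q, hq, b', rfl, hb', -⟩ := hsome e' he'
        have hi : i = i' := congrArg Prod.fst hg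
        have hbb : b = b' := congrArg Prod.snd hg
        subst hi hbb
        have := hb.trans hb'.symm
        cases b <;> simp only [Bool.false_eq_true, if_false, if_true] at this
        · obtain rfl := (hP _).eq_of_fst_eq hp hq this
          rfl
        · obtain rfl := (hP _).eq_of_snd_eq hp hq this
          rfl

end Subdivision

section Swallow

theorem exists_mem_Ioo_forall_notMem {F : Set ℝ} (hF : F.Finite) {r B : ℝ} (hr : r < B) :
    ∃ b ∈ Ioo r B, ∀ x ∈ F, x ≤ r ∨ b < x := by
  have : (𝓝[>] r).Eventually fun b => b ∈ Ioo r B ∧ ∀ x ∈ F, x ≤ r ∨ b < x := by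
    refine Filter.Eventually.and (Ioo_mem_nhdsGT hr) ((Filter.eventually_all_finite hF).2 fun x _ => ?_)
    rcases le_or_gt x r with h | h
    · exact Filter.Eventually.of_forall fun _ => Or.inl h
    · filter_upwards [Ioo_mem_nhdsGT h] with b hb using Or.inr hb.2
  exact this.exists

variable {S : Type*} [TopologicalSpace S]

/-- A system can be cut along a level of a function, keeping the parts where the function
is large. -/
theorem IsSystem.exists_cut [T2Space S] {ι : Type} [Finite ι] {V : Set S} {γ : ι → ℝ → S} (h : IsSystem V γ)
    {ρ : S → ℝ} (hρ : Continuous ρ) {r B : ℝ} (hr : r < B) {τ : ℝ → ℝ → S}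
    (hτ : ∀ a ∈ Ioo r B, IsLoop (τ a) ∧ τ a '' Icc 0 1 ⊆ V ∧ ∀ t ∈ Icc (0 : ℝ) 1, ρ (τ a t) = a) :
    ∃ a b, r < a ∧ a < b ∧ b < B ∧ ∃ (κ : Type) (_ : Finite κ) (δ : κ → ℝ → S) (R : Set S),
      IsSystem V δ ∧ support δ = R ∪ τ a '' Icc 0 1 ∧ IsClosed R ∧ R ⊆ support γ ∧
      closure (support γ \ R) ⊆ {x | ρ x ≤ b} ∧ R ∩ closure (support γ \ R) ⊆ {x | ρ x = a} := by
  obtain ⟨b, hb, hbF⟩ := exists_mem_Ioo_forall_notMem (F := range fun e : ι × Bool => ρ (endp γ e))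
    (finite_range _) hr
  obtain ⟨a, ha, hgen⟩ := exists_generic_value (f := fun i t => ρ (γ i t)) hb.1
  have hend : ∀ i, (ρ (γ i 0) < a ∨ b < ρ (γ i 0)) ∧ (ρ (γ i 1) < a ∨ b < ρ (γ i 1)) := fun i =>
    ⟨(hbF _ ⟨(i, false), rfl⟩).imp (fun h => h.trans_lt ha.1) id,
      (hbF _ ⟨(i, true), rfl⟩).imp (fun h => h.trans_lt ha.1) id⟩
  choose P hP hP1 hP2 hP3 hP4 using fun i =>
    exists_pieces (hρ.comp_continuousOn (h.edge i).1) ha.2 (hend i).1 (hend i).2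
  simp only [Function.comp_apply] at hP1 hP2 hP3 hP4
  obtain ⟨hτ1, hτV, hτa⟩ := hτ a ⟨ha.1, ha.2.trans hb.2⟩
  have : ∀ v, ∃ u, (∃ t ∈ Icc (0 : ℝ) 1, τ a t = v) → u ∈ Icc (0 : ℝ) 1 ∧ τ a u = v := fun v => by
    by_cases hv : ∃ t ∈ Icc (0 : ℝ) 1, τ a t = v
    · obtain ⟨t, ht⟩ := hv
      exact ⟨t, fun _ => ht⟩
    · exact ⟨0, fun h => absurd h hv⟩
  choose g hg using this
  have hA : (⋃ i, ⋃ p ∈ P i, {g (γ i p.1), g (γ i p.2)}).Finite :=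
    finite_iUnion fun i => (P i).finite_toSet.biUnion fun p _ => by simp
  obtain ⟨P0, hP0, hcov, hA0⟩ := exists_cutting hA.toFinset
  let P' : Option ι → Finset (ℝ × ℝ) := fun j => j.elim P0 P
  have hP' : ∀ j, IsCutting (P' j) := by
    rintro (_ | i)
    exacts [hP0, hP i]
  have hgu : ∀ v, ∀ q ∈ P0, ∀ u ∈ Ioo q.1 q.2, τ a u = v → g v = u := fun v q hq u hu e => by
    have huI : u ∈ Ioo (0 : ℝ) 1 :=
      ⟨(hP0.nonneg q hq).trans_lt hu.1, hu.2.trans_le (hP0.le_one q hq)⟩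
    obtain ⟨h1, h2⟩ := hg v ⟨u, Ioo_subset_Icc_self huI, e⟩
    exact (hτ1.edge.eq_of_mem_Ioo huI h1 (e.trans h2.symm)).symm
  have hsys : IsSystem V (pieces γ (τ a) P') := by
    refine h.subdivide hτ1 hτV hτa (fun i => ⟨?_, ?_⟩) hP' (fun i p hp u hu => (hP1 i p hp u hu).ne')
      (fun i p hp q hq e => ?_) (fun i p hp => (hP2 i p hp).imp (·.1) (·.2))
      (fun i p hp => (hP3 i p hp).imp (·.1) (·.2)) fun i p hp q hq u hu => ⟨fun e => ?_, fun e => ?_⟩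
    · rcases (hend i).1 with h' | h'
      exacts [h'.ne, (ha.2.trans h').ne']
    · rcases (hend i).2 with h' | h'
      exacts [h'.ne, (ha.2.trans h').ne']
    · have hpl := (hP i).lt p hp
      have hql := (hP i).lt q hq
      have hq1 := (hP i).le_one q hq
      have hx : ρ (γ i p.2) = a := by
        rcases hP3 i p hp with h' | h'
        · linarith [h'.1]
        · exact h'.2
      refine hgen i p.1 p.2 q.2 hpl (e ▸ hql) (fun u hu => ?_) hx
      rcases lt_trichotomy u p.2 with h' | h' | h'
      · exact (hP1 i p hp u ⟨hu.1, h'⟩).le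
      · rw [h', hx]
      · exact (hP1 i q hq u ⟨e ▸ h', hu.2⟩).le
    · refine hA0 _ ?_ q hq hu
      rw [Finite.mem_toFinset, ← hgu _ q hq u hu e]
      exact mem_iUnion.2 ⟨i, mem_iUnion₂.2 ⟨p, hp, Or.inl rfl⟩⟩
    · refine hA0 _ ?_ q hq hu
      rw [Finite.mem_toFinset, ← hgu _ q hq u hu e]
      exact mem_iUnion.2 ⟨i, mem_iUnion₂.2 ⟨p, hp, Or.inr rfl⟩⟩
  have hIcc : ∀ i, ∀ p ∈ P i, Icc p.1 p.2 ⊆ Icc (0 : ℝ) 1 := fun i p hp x hx =>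
    (hP i).mem_Icc hp hx
  have hcl : ∀ i, ∀ p ∈ P i, IsClosed (γ i '' Icc p.1 p.2) := fun i p hp =>
    (h.edge i).isClosed_image_Icc ((hP i).nonneg p hp) ((hP i).le_one p hp)
  set R : Set S := ⋃ i, ⋃ p ∈ P i, γ i '' Icc p.1 p.2 with hR
  have hRcl : IsClosed R :=
    isClosed_iUnion_of_finite fun i => (P i).finite_toSet.isClosed_biUnion fun p hp => hcl i p hp
  have hRγ : R ⊆ support γ := iUnion_mono fun i => iUnion₂_subset fun p hp => image_mono (hIcc i p hp)
  have hclb : closure (support γ \ R) ⊆ {x | ρ x ≤ b} := by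
    refine closure_minimal ?_ (isClosed_le hρ continuous_const)
    rintro _ ⟨hx, hxR⟩
    obtain ⟨i, t, ht, rfl⟩ := mem_iUnion.1 hx
    by_contra hlt
    obtain ⟨p, hp, htp⟩ := hP4 i t ht (not_le.1 hlt).le
    exact hxR (mem_iUnion.2 ⟨i, mem_iUnion₂.2 ⟨p, hp, t, htp, rfl⟩⟩)
  refine ⟨a, b, ha.1, ha.2, hb.2, _, inferInstance, pieces γ (τ a) P', R, hsys, ?_, hRcl, hRγ, hclb,
    ?_⟩
  · ext x
    simp only [support, mem_iUnion, mem_union, hR]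
    constructor
    · rintro ⟨⟨_ | i, p, hp⟩, hx⟩
      · rw [pieces, reparam_image_of_le _ (hP0.lt p hp).le] at hx
        obtain ⟨t, ht, rfl⟩ := hx
        exact Or.inr ⟨t, hP0.mem_Icc hp ht, rfl⟩
      · rw [pieces, reparam_image_of_le _ ((hP i).lt p hp).le] at hx
        exact Or.inl ⟨i, p, hp, hx⟩
    · rintro (⟨i, p, hp, hx⟩ | ⟨t, ht, rfl⟩)
      · refine ⟨⟨some i, p, hp⟩, ?_⟩
        rwa [pieces, reparam_image_of_le _ ((hP i).lt p hp).le]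
      · obtain ⟨p, hp, htp⟩ := hcov t ht
        refine ⟨⟨none, p, hp⟩, ?_⟩
        rw [pieces, reparam_image_of_le _ (hP0.lt p hp).le]
        exact ⟨t, htp, rfl⟩
  · rintro x ⟨hxR, hxc⟩
    obtain ⟨i, hx⟩ := mem_iUnion.1 hxR
    obtain ⟨p, hp, t, ht, rfl⟩ := mem_iUnion₂.1 hx
    have hle : ρ (γ i t) ≤ b := hclb hxc
    rcases ht.1.eq_or_lt with h1 | h1
    · rw [← h1] at hle ⊢
      exact ((hP2 i p hp).resolve_left fun h' => h'.2.not_ge hle).2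
    rcases ht.2.eq_or_lt with h2 | h2
    · rw [h2] at hle ⊢
      exact ((hP3 i p hp).resolve_left fun h' => h'.2.not_ge hle).2
    exfalso
    have htI : t ∈ Ioo (0 : ℝ) 1 :=
      ⟨((hP i).nonneg p hp).trans_lt h1, h2.trans_le ((hP i).le_one p hp)⟩
    have hF : IsClosed ((⋃ j : {j // j ≠ i}, γ j '' Icc 0 1) ∪
        (γ i '' Icc 0 p.1 ∪ γ i '' Icc p.2 1)) := by
      refine (isClosed_iUnion_of_finite fun j : {j // j ≠ i} => (h.edge j).isClosed_image).union
        (IsClosed.union ?_ ?_)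
      · exact (h.edge i).isClosed_image_Icc le_rfl (((hP i).lt p hp).le.trans ((hP i).le_one p hp))
      · exact (h.edge i).isClosed_image_Icc
          (((hP i).nonneg p hp).trans ((hP i).lt p hp).le) le_rfl
    have hsub : support γ \ R ⊆ (⋃ j : {j // j ≠ i}, γ j '' Icc 0 1) ∪
        (γ i '' Icc 0 p.1 ∪ γ i '' Icc p.2 1) := by
      rintro y ⟨hy, hyR⟩
      obtain ⟨j, s, hs, rfl⟩ := mem_iUnion.1 hy
      by_cases hj : j = i
      · subst hj
        refine Or.inr ?_
        by_contra hcon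
        refine hyR (mem_iUnion.2 ⟨j, mem_iUnion₂.2 ⟨p, hp, s, ⟨?_, ?_⟩, rfl⟩⟩)
        · by_contra h'
          exact hcon (Or.inl ⟨s, ⟨hs.1, (not_le.1 h').le⟩, rfl⟩)
        · by_contra h'
          exact hcon (Or.inr ⟨s, ⟨(not_le.1 h').le, hs.2⟩, rfl⟩)
      · exact Or.inl (mem_iUnion.2 ⟨⟨j, hj⟩, s, hs, rfl⟩)
    rcases closure_minimal hsub hF hxc with hx | ⟨s, hs, e⟩ | ⟨s, hs, e⟩
    · obtain ⟨⟨j, hj⟩, s, hs, e⟩ := mem_iUnion.1 hx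
      rcases h.disj i j (Ne.symm hj) t (Ioo_subset_Icc_self htI) s hs e.symm with h' | h'
      exacts [htI.1.ne' h', htI.2.ne h']
    · have := (h.edge i).eq_of_mem_Ioo htI
        ⟨hs.1, hs.2.trans (((hP i).lt p hp).le.trans ((hP i).le_one p hp))⟩ e.symm
      linarith [hs.2]
    · have := (h.edge i).eq_of_mem_Ioo htI
        ⟨((hP i).nonneg p hp).trans (((hP i).lt p hp).le.trans hs.1), hs.2⟩ e.symm
      linarith [hs.1]

/-- A truncated radius function of a chart. -/
theorem exists_radius [T2Space S] {φ : ℂ → S} (hφ : IsOpenEmbedding φ) (M : ℝ) :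
    ∃ ρ : S → ℝ, Continuous ρ ∧ (∀ z, ρ (φ z) = min ‖z‖ M) ∧ ∀ x ∉ range φ, ρ x = M := by
  classical
  let ρ : S → ℝ := fun x => if x ∈ range φ then min ‖Function.invFun φ x‖ M else M
  have h1 : ∀ z, ρ (φ z) = min ‖z‖ M := fun z => by
    simp [ρ, Function.leftInverse_invFun hφ.injective z]
  have h2 : ∀ x ∉ range φ, ρ x = M := fun x hx => if_neg hx
  refine ⟨ρ, continuous_iff_continuousAt.2 fun x => ?_, h1, h2⟩
  by_cases hx : x ∈ range φ
  · obtain ⟨z, rfl⟩ := hx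
    rw [ContinuousAt, ← hφ.map_nhds_eq, Filter.tendsto_map'_iff]
    have : ρ ∘ φ = fun z => min ‖z‖ M := funext h1
    rw [this, h1]
    exact (continuous_norm.min continuous_const).continuousAt
  · have hcl : IsClosed (φ '' Metric.closedBall 0 M) :=
      ((isCompact_closedBall 0 M).image hφ.continuous).isClosed
    have hev : ρ =ᶠ[𝓝 x] fun _ => M := by
      filter_upwards [hcl.isOpen_compl.mem_nhds fun h => hx (image_subset_range _ _ h)] with y hy
      by_cases hyr : y ∈ range φ
      · obtain ⟨z, rfl⟩ := hyr
        rw [h1, min_eq_right]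
        by_contra hlt
        exact hy ⟨z, by simpa using (not_le.1 hlt).le, rfl⟩
      · exact h2 y hyr
    exact continuousAt_const.congr hev.symm

theorem isLoop_circle {φ : ℂ → S} (hφ : IsOpenEmbedding φ) {a : ℝ} (ha : 0 < a) :
    ∃ τ : ℝ → S, IsLoop τ ∧ τ '' Icc 0 1 = φ '' Metric.sphere 0 a := by
  let c : ℝ → ℂ := fun t => (a : ℂ) * ⟨(circPoint t : ℝ × ℝ).1, (circPoint t : ℝ × ℝ).2⟩
  have hc : Continuous c := by
    refine continuous_const.mul ?_
    have h : Continuous fun p : ℝ × ℝ => Complex.equivRealProdCLM.symm p :=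
      Complex.equivRealProdCLM.symm.continuous
    exact h.comp (continuous_subtype_val.comp continuous_circPoint)
  have ha' : (a : ℂ) ≠ 0 := Complex.ofReal_ne_zero.2 ha.ne'
  refine ⟨fun t => φ (c t), ⟨⟨(hφ.continuous.comp hc).continuousOn, fun s hs t ht hst e => ?_⟩, ?_⟩,
    ?_⟩
  · have h1 := mul_left_cancel₀ ha' (hφ.injective e)
    refine circPoint_eq hs ht hst (Subtype.ext (Prod.ext ?_ ?_))
    · simpa using congrArg Complex.re h1
    · simpa using congrArg Complex.im h1
  · simp only [c, circPoint_zero_eq_one]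
  · have : c '' Icc 0 1 = Metric.sphere 0 a := by
      ext z
      constructor
      · rintro ⟨t, -, rfl⟩
        have h1 : (circPoint t : ℝ × ℝ).1 ^ 2 + (circPoint t : ℝ × ℝ).2 ^ 2 = 1 := (circPoint t).2
        have h2 : ‖(⟨(circPoint t : ℝ × ℝ).1, (circPoint t : ℝ × ℝ).2⟩ : ℂ)‖ = 1 := by
          rw [Complex.norm_def, Complex.normSq_mk, ← sq, ← sq, h1, Real.sqrt_one]
        simp [c, h2, abs_of_pos ha]
      · intro hz
        have hz' : ‖z / a‖ = 1 := by
          rw [norm_div, mem_sphere_zero_iff_norm.1 hz, Complex.norm_real, Real.norm_of_nonneg ha.le,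
            div_self ha.ne']
        have hz2 : (z / a).re ^ 2 + (z / a).im ^ 2 = 1 := by
          rw [← one_pow 2, ← hz', ← Complex.normSq_eq_norm_sq, Complex.normSq_apply, sq, sq]
        obtain ⟨t, ht, e⟩ := exists_circPoint ⟨((z / a).re, (z / a).im), hz2⟩
        refine ⟨t, ht, ?_⟩
        simp only [c, e, Complex.eta]
        field_simp
    rw [← this, image_image]

theorem IsSep.enlarge {V E X X' C : Set S} {c : S} (h : IsSep V c E X) (hX' : IsClosed X')
    (hXX' : X ⊆ X') (hC : IsCompact C) (hX'C : X' ⊆ X ∪ C) : IsSep V c (E \ X') X' := by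
  obtain ⟨K, hK, hVK⟩ := h.exhaust
  refine ⟨⟨h.side.1.sdiff hX', disjoint_sdiff_left, ?_⟩, fun h' => h.notMem h'.1, K ∪ C,
    hK.union hC, fun x hx => ?_⟩
  · have : E \ X' ∪ X' = (E ∪ X) ∪ X' := by
      rw [sdiff_union_self, union_assoc, union_eq_self_of_subset_left hXX']
    rw [this]
    exact h.side.2.2.union hX'
  · have hxE := hVK ⟨hx.1, fun h' => hx.2 (Or.inl h')⟩
    exact ⟨hxE, fun h' => (hX'C h').elim (disjoint_left.1 h.side.2.1 hxE) fun h' => hx.2 (Or.inr h')⟩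

end Swallow

section Existence

variable {S : Type*} [TopologicalSpace S]

/-- The interior of a closed disc can be dropped from the boundary of a side. -/
theorem IsSide.of_isOpen_sdiff {E X X' : Set S} (h : IsSide E X) (hX : X' ⊆ X) {O : Set S}
    (hO : IsOpen (O \ X')) (hOX : O ⊆ X) (hsub : X \ X' ⊆ O) : IsSide E X' := by
  refine ⟨h.1, h.2.1.mono_right hX, ?_⟩
  have : E ∪ X' = (E ∪ X) ∩ (O \ X')ᶜ := by
    ext x
    constructor
    · rintro (hx | hx)
      · exact ⟨Or.inl hx, fun h' => disjoint_left.1 h.2.1 hx (hOX h'.1)⟩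
      · exact ⟨Or.inr (hX hx), fun h' => h'.2 hx⟩
    · rintro ⟨hx | hx, hx'⟩
      · exact Or.inl hx
      · by_contra hcon
        have hxX' : x ∉ X' := fun h' => hcon (Or.inr h')
        exact hx' ⟨hsub ⟨hx, hxX'⟩, hxX'⟩
  rw [this]
  exact h.2.2.inter hO.isClosed_compl

/-- A disc in the separating set can be replaced by edges, at the cost of slightly enlarging
the rest of the separating set. -/
theorem IsSystem.swallow [T2Space S] {ι : Type} [Finite ι] {V : Set S} {γ : ι → ℝ → S}
    (h : IsSystem V γ) {c : S} (hc : c ∉ V) {φ : ℂ → S} (hφ : IsOpenEmbedding φ)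
    (hφV : range φ ⊆ V) {r : ℝ} (hr : 0 < r) {Q Q' E : Set S} (hQ : IsCompact Q)
    (hQ' : IsCompact Q') (hQ'V : Q' ⊆ V) (hQQ' : Q ⊆ interior Q')
    (hE : IsSep V c E (support γ ∪ φ '' Metric.closedBall 0 r ∪ Q)) :
    ∃ (κ : Type) (_ : Finite κ) (δ : κ → ℝ → S) (E' : Set S),
      IsSystem V δ ∧ IsSep V c E' (support δ ∪ Q') := by
  obtain ⟨ρ, hρ, hρφ, hρo⟩ := exists_radius hφ (r + 1)
  have hle : ∀ a < r + 1, ∀ x, ρ x ≤ a → x ∈ φ '' Metric.closedBall 0 a := fun a ha x hx => by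
    by_cases hxr : x ∈ range φ
    · obtain ⟨z, rfl⟩ := hxr
      rw [hρφ] at hx
      refine ⟨z, ?_, rfl⟩
      rcases min_le_iff.1 hx with h' | h'
      · simpa using h'
      · linarith
    · rw [hρo x hxr] at hx
      linarith
  have hcomp : ∀ a, IsCompact (φ '' Metric.closedBall 0 a) := fun a =>
    (isCompact_closedBall 0 a).image hφ.continuous
  -- a uniform thickness of `Q` inside `Q'`
  have hK : IsCompact (φ ⁻¹' Q ∩ Metric.closedBall 0 (r + 1)) :=
    (isCompact_closedBall 0 (r + 1)).inter_left (hQ.isClosed.preimage hφ.continuous)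
  obtain ⟨η, hη, hηQ⟩ := hK.exists_thickening_subset_open
    (isOpen_interior.preimage hφ.continuous) fun z hz => hQQ' hz.1
  have hcirc : ∀ a : ℝ, ∃ τ : ℝ → S, 0 < a → IsLoop τ ∧ τ '' Icc 0 1 = φ '' Metric.sphere 0 a :=
    fun a => by
      by_cases ha : 0 < a
      · obtain ⟨τ, h⟩ := isLoop_circle hφ ha
        exact ⟨τ, fun _ => h⟩
      · exact ⟨fun _ => φ 0, fun h => absurd h ha⟩
  choose τ hτ using hcirc
  obtain ⟨a, b, ha, hab, hbB, κ, hκ, δ, R, hδ, hsupp, hRcl, hRγ, hclb, hRa⟩ := h.exists_cut hρ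
    (r := r) (B := min (r + 1) (r + η)) (by simp [hη]) (τ := τ) fun a ha => by
      have ha0 := hr.trans ha.1
      refine ⟨(hτ a ha0).1, ?_, fun t ht => ?_⟩
      · rw [(hτ a ha0).2]
        exact (image_subset_range _ _).trans hφV
      · obtain ⟨z, hz, e⟩ : τ a t ∈ φ '' Metric.sphere 0 a := (hτ a ha0).2 ▸ mem_image_of_mem _ ht
        rw [← e, hρφ, mem_sphere_zero_iff_norm.1 hz]
        exact min_eq_left (ha.2.trans_le (min_le_left _ _)).le
  have hb1 := hbB.trans_le (min_le_left _ _)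
  have hb2 := hbB.trans_le (min_le_right _ _)
  rw [(hτ a (hr.trans ha)).2] at hsupp
  have hγcl := h.isClosed_support
  -- enlarge the disc
  have hE1 := hE.enlarge (X' := support γ ∪ φ '' Metric.closedBall 0 a ∪ Q)
    (C := φ '' Metric.closedBall 0 a) ((hγcl.union (hcomp a).isClosed).union hQ.isClosed)
    (union_subset_union_left _ (union_subset_union_right _
      (image_mono (Metric.closedBall_subset_closedBall ha.le)))) (hcomp a) (by
      rintro x ((hx | hx) | hx)
      exacts [Or.inl (Or.inl (Or.inl hx)), Or.inr hx, Or.inl (Or.inr hx)])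
  set E1 := E \ (support γ ∪ φ '' Metric.closedBall 0 a ∪ Q)
  set X2 := closure (support γ \ R)
  have hX2 : X2 ⊆ support γ := closure_minimal sdiff_subset hγcl
  set X1 := R ∪ φ '' Metric.closedBall 0 a ∪ Q
  have hX12 : support γ ∪ φ '' Metric.closedBall 0 a ∪ Q = X1 ∪ X2 := by
    ext x
    constructor
    · rintro ((hx | hx) | hx)
      · by_cases hxR : x ∈ R
        · exact Or.inl (Or.inl (Or.inl hxR))
        · exact Or.inr (subset_closure ⟨hx, hxR⟩)
      · exact Or.inl (Or.inl (Or.inr hx))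
      · exact Or.inl (Or.inr hx)
    · rintro (((hx | hx) | hx) | hx)
      exacts [Or.inl (Or.inl (hRγ hx)), Or.inl (Or.inr hx), Or.inr hx, Or.inl (Or.inl (hX2 hx))]
  set X' := R ∪ φ '' Metric.closedBall 0 a ∪ Q'
  have hX1' : X1 ⊆ X' := union_subset_union_right _ (hQQ'.trans interior_subset)
  set T0 : Set ℂ := {z | ‖z‖ ≤ b ∧ ∀ l ∈ Icc (0 : ℝ) 1, φ ((l : ℂ) * z) ∈ X'}
  have hT0 : IsPreconnected T0 := by
    have h0 : (0 : ℂ) ∈ T0 := ⟨by simpa using (hr.trans (ha.trans hab)).le, fun l _ =>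
      Or.inl (Or.inr ⟨0, by simpa using (hr.trans ha).le, by simp⟩)⟩
    have hst : StarConvex ℝ 0 T0 := by
      refine starConvex_zero_iff.2 fun z hz m hm0 hm1 => ⟨?_, fun l hl => ?_⟩
      · rw [norm_smul, Real.norm_of_nonneg hm0]
        exact (mul_le_of_le_one_left (norm_nonneg _) hm1).trans hz.1
      · have := hz.2 (l * m) ⟨mul_nonneg hl.1 hm0, mul_le_one₀ hl.2 hm0 hm1⟩
        rwa [Complex.real_smul, ← mul_assoc, ← Complex.ofReal_mul]
    exact (hst.isPathConnected h0).isConnected.isPreconnected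
  have hcB : ∀ z : ℂ, ‖z‖ ≤ a → φ z ∈ X' := fun z hz => Or.inl (Or.inr ⟨z, by simpa using hz, rfl⟩)
  obtain ⟨E2, hE2, hs⟩ := IsSide.surgery_sameOff (N := V) (X1 := X1) (X2 := X2) (X' := X')
    (T := φ '' T0) (C := Q') (r := b) hφ
    ((hRcl.union (hcomp a).isClosed).union hQ.isClosed) isClosed_closure
    ((hRcl.union (hcomp a).isClosed).union hQ'.isClosed) (fun x hx => hle b hb1 x (hclb hx)) hX1'
    (hT0.image _ hφ.continuous.continuousOn) (by
      rintro x ⟨hx1, hx2⟩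
      obtain ⟨z, hz, rfl⟩ := hle b hb1 x (hclb hx2)
      have hzb : ‖z‖ ≤ b := by simpa using hz
      have hl : ∀ l ∈ Icc (0 : ℝ) 1, ‖(l : ℂ) * z‖ = l * ‖z‖ := fun l hl => by
        rw [norm_mul, Complex.norm_real, Real.norm_of_nonneg hl.1]
      refine ⟨z, ⟨hzb, fun l hl' => ?_⟩, rfl⟩
      by_cases hza : ‖z‖ ≤ a
      · refine hcB _ ?_
        rw [hl l hl']
        exact (mul_le_of_le_one_left (norm_nonneg _) hl'.2).trans hza
      · rcases hx1 with (hx | ⟨w, hw, e⟩) | hx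
        · have : ρ (φ z) = a := hRa ⟨hx, hx2⟩
          rw [hρφ, min_eq_left (hzb.trans hb1.le)] at this
          exact absurd this.le hza
        · rw [hφ.injective e] at hw
          exact absurd (by simpa using hw) hza
        · by_cases hlz : ‖(l : ℂ) * z‖ ≤ a
          · exact hcB _ hlz
          · refine Or.inr (interior_subset (hηQ ?_))
            refine Metric.mem_thickening_iff.2 ⟨z, ⟨hx, by simpa using hzb.trans hb1.le⟩, ?_⟩
            rw [dist_eq_norm, show (l : ℂ) * z - z = -(((1 - l : ℝ) : ℂ) * z) by push_cast; ring,
              norm_neg, hl _ ⟨by linarith [hl'.2], by linarith [hl'.1]⟩]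
            rw [hl l hl'] at hlz
            nlinarith) (by
      rintro _ ⟨z, hz, rfl⟩
      refine ⟨by simpa using hz.2 1 ⟨zero_le_one, le_rfl⟩, z, by simpa using hz.1, rfl⟩)
    (hX12 ▸ hE1.side) hφV hQ' hQ'V (by
      rintro x ((hx | hx) | hx)
      exacts [Or.inl (Or.inl (Or.inl (Or.inl hx))), Or.inl (Or.inl (Or.inl (Or.inr hx))),
        Or.inr hx])
  have hsep := hE1.of_sameOff hc hE2 hs
  refine ⟨κ, hκ, δ, E2, hδ, ⟨hE2.of_isOpen_sdiff (O := φ '' Metric.ball 0 a) ?_ ?_ ?_ ?_,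
    hsep.notMem, hsep.exhaust⟩⟩
  · rw [hsupp]
    exact union_subset_union_left _ (union_subset_union_right _
      (image_mono Metric.sphere_subset_closedBall))
  · exact (hφ.isOpenMap _ Metric.isOpen_ball).sdiff (hδ.isClosed_support.union hQ'.isClosed)
  · exact fun x hx => Or.inl (Or.inr (image_mono Metric.ball_subset_closedBall hx))
  · rw [hsupp]
    rintro x ⟨(hx | ⟨z, hz, rfl⟩) | hx, hx'⟩
    · exact absurd (Or.inl (Or.inl hx)) hx'
    · refine ⟨z, ?_, rfl⟩
      refine lt_of_le_of_ne hz fun e => hx' (Or.inl (Or.inr ⟨z, e, rfl⟩))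
    · exact absurd (Or.inr hx) hx'

/-- A separating union of discs can be replaced by edges. -/
theorem exists_hasSep_of_discs [T2Space S] {V : Set S} {c : S} (hc : c ∉ V) :
    ∀ (L : List (ℂ → S)), (∀ φ ∈ L, IsOpenEmbedding φ ∧ range φ ⊆ V) → ∀ (r : ℝ), 0 < r →
      ∀ (ι : Type) [Finite ι] (γ : ι → ℝ → S) (E : Set S), IsSystem V γ →
        IsSep V c E (support γ ∪ ⋃ φ ∈ L, φ '' Metric.closedBall 0 r) → ∃ n, HasSep V c n := by
  intro L
  induction L with
  | nil =>
    intro _ r _ ι _ γ E h hE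
    exact ⟨_, HasSep.of_system h (by simpa using hE)⟩
  | cons φ L ih =>
    intro hL r hr ι _ γ E h hE
    have hcomp : ∀ r, IsCompact (⋃ ψ ∈ L, ψ '' Metric.closedBall 0 r) := fun r =>
      L.finite_toSet.isCompact_biUnion fun ψ hψ =>
        (isCompact_closedBall 0 r).image (hL ψ (List.mem_cons_of_mem _ hψ)).1.continuous
    obtain ⟨κ, hκ, δ, E', hδ, hE'⟩ := h.swallow hc (hL φ List.mem_cons_self).1
      (hL φ List.mem_cons_self).2 hr (hcomp r) (hcomp (r + 1))
      (iUnion₂_subset fun ψ hψ => (image_subset_range _ _).trans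
        (hL ψ (List.mem_cons_of_mem _ hψ)).2)
      (iUnion₂_subset fun ψ hψ => by
        refine interior_maximal ?_ ((hL ψ (List.mem_cons_of_mem _ hψ)).1.isOpenMap _
          (Metric.isOpen_ball (x := 0) (ε := r + 1))) |>.trans' (image_mono
            (Metric.closedBall_subset_ball (by linarith)))
        exact (image_mono Metric.ball_subset_closedBall).trans
          (subset_iUnion₂ (s := fun ψ _ => ψ '' Metric.closedBall 0 (r + 1)) ψ hψ))
      (E := E) (by
        convert hE using 1
        rw [union_assoc]
        congr 1
        ext x
        simp)
    exact ih (fun ψ hψ => hL ψ (List.mem_cons_of_mem _ hψ)) (r + 1) (by linarith) κ δ E' hδ hE'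

/-- A compact separating set disjoint from the boundary can be replaced by edges. -/
theorem exists_hasSep_of_isCompact [T2Space S] {V : Set S} (hV : IsOpen V) (hVB : Disjoint V (Bd S))
    {c : S} (hc : c ∉ V) {E X : Set S} (hE : IsSep V c E X) (hX : IsCompact X) (hXV : X ⊆ V) :
    ∃ n, HasSep V c n := by
  have hch : ∀ x ∈ V, ∃ φ : ℂ → S, IsOpenEmbedding φ ∧ φ 0 = x ∧ range φ ⊆ V := fun x hx =>
    exists_chart (disjoint_left.1 hVB hx) (hV.mem_nhds hx)
  choose! φ hφ hφ0 hφV using hch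
  obtain ⟨t, ht, htX⟩ := hX.elim_nhds_subcover (fun x => φ x '' Metric.ball 0 1) fun x hx =>
    ((hφ x (hXV hx)).isOpenMap _ Metric.isOpen_ball).mem_nhds ⟨0, by simp, hφ0 x (hXV hx)⟩
  have hL : ∀ ψ ∈ t.toList.map φ, IsOpenEmbedding ψ ∧ range ψ ⊆ V := fun ψ hψ => by
    obtain ⟨x, hx, rfl⟩ := List.mem_map.1 hψ
    have hxV := hXV (ht x (Finset.mem_toList.1 hx))
    exact ⟨hφ x hxV, hφV x hxV⟩
  have hcomp : IsCompact (⋃ ψ ∈ t.toList.map φ, ψ '' Metric.closedBall 0 1) :=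
    (t.toList.map φ).finite_toSet.isCompact_biUnion fun ψ hψ =>
      (isCompact_closedBall 0 1).image (hL ψ hψ).1.continuous
  have hX' : X ⊆ ⋃ ψ ∈ t.toList.map φ, ψ '' Metric.closedBall 0 1 := fun x hx => by
    obtain ⟨y, hy, hxy⟩ := mem_iUnion₂.1 (htX hx)
    exact mem_iUnion₂.2 ⟨φ y, List.mem_map_of_mem (Finset.mem_toList.2 hy),
      image_mono Metric.ball_subset_closedBall hxy⟩
  have hE' := hE.enlarge hcomp.isClosed hX' hcomp subset_union_right
  refine exists_hasSep_of_discs hc _ hL 1 one_pos Empty (fun i => i.elim) _ ⟨fun i => i.elim,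
    fun i => i.elim, fun i => i.elim, fun v => ?_⟩ (by simpa [support] using hE')
  rw [Set.eq_empty_of_isEmpty {e | endp _ e = v}]
  simp

end Existence

section IsolatedEnd

variable {S : Type*} [TopologicalSpace S]

theorem IsSurface.weaklyLocallyCompactSpace (hS : IsSurface S) : WeaklyLocallyCompactSpace S := by
  refine ⟨fun x => ?_⟩
  obtain ⟨U, V, hU, hx, hV, ⟨e⟩⟩ := hS.locallyHalfPlane x
  have h1 : LocallyCompactSpace {p : ℝ × ℝ // 0 ≤ p.2} :=
    (isClosed_le continuous_const continuous_snd).isClosedEmbedding_subtypeVal.locallyCompactSpace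
  have h2 : LocallyCompactSpace V := hV.isOpenEmbedding_subtypeVal.locallyCompactSpace
  have h3 : LocallyCompactSpace U := e.isOpenEmbedding.locallyCompactSpace
  obtain ⟨K, hK, hxK⟩ := exists_compact_mem_nhds (⟨x, hx⟩ : U)
  exact ⟨Subtype.val '' K, hK.image continuous_subtype_val,
    hU.isOpenEmbedding_subtypeVal.isOpenMap.image_mem_nhds hxK⟩

theorem isOpen_connectedComponentIn_of_disjoint_Bd {V : Set S} (hV : IsOpen V)
    (hVB : Disjoint V (Bd S)) (x : S) : IsOpen (connectedComponentIn V x) := by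
  refine isOpen_iff_mem_nhds.2 fun y hy => ?_
  have hyV := connectedComponentIn_subset _ _ hy
  obtain ⟨φ, hφ, hφy, hφV⟩ := exists_chart (disjoint_left.1 hVB hyV) (hV.mem_nhds hyV)
  rw [connectedComponentIn_eq hy]
  refine Filter.mem_of_superset (hφ.isOpen_range.mem_nhds ⟨0, hφy⟩) ?_
  exact (isPreconnected_range hφ.continuous).subset_connectedComponentIn ⟨0, hφy⟩ hφV

/-- A noncompact closed set with compact connected boundary contains a noncompact region off the
boundary which can be separated from it by edges. -/
theorem exists_region [T2Space S] [PreconnectedSpace S] [WeaklyLocallyCompactSpace S]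
    {U B : Set S} (hU : IsClosed U) (hUB : B = frontier U ∪ (U ∩ Bd S)) (hUc : ¬ IsCompact U)
    (hB : IsCompact B) {c : S} (hc : c ∈ B) :
    ∃ V : Set S, IsOpen V ∧ IsPreconnected V ∧ Disjoint V (Bd S) ∧ Disjoint B V ∧
      frontier V ⊆ B ∧ ¬ IsCompact (closure V) ∧ ∃ n, HasSep V c n := by
  have hBU : B ⊆ U := hUB ▸ union_subset hU.frontier_subset inter_subset_left
  have hV0 : IsOpen (U \ B) := by
    have : U \ B = interior U \ Bd S := by
      rw [← self_sdiff_frontier, hUB]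
      ext x
      simp only [mem_sdiff, mem_union, mem_inter_iff]
      tauto
    rw [this]
    exact isOpen_interior.sdiff isClosed_Bd
  have hV0B : Disjoint (U \ B) (Bd S) := by
    rw [hUB]
    exact disjoint_left.2 fun x hx hxB => hx.2 (Or.inr ⟨hx.1, hxB⟩)
  set V : S → Set S := connectedComponentIn (U \ B) with hVdef
  have hVo : ∀ y, IsOpen (V y) := isOpen_connectedComponentIn_of_disjoint_Bd hV0 hV0B
  have hVsub : ∀ y, V y ⊆ U \ B := connectedComponentIn_subset _
  have hVfr : ∀ y, frontier (V y) ⊆ B := fun y x hx => by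
    by_contra hxB
    have hxU : x ∈ U := closure_minimal ((hVsub y).trans sdiff_subset) hU hx.1
    have := closure_connectedComponentIn_inter _ _ ⟨hx.1, ⟨hxU, hxB⟩⟩
    exact hx.2 ((hVo y).interior_eq.symm ▸ this)
  obtain ⟨K, hK, hBK⟩ := exists_compact_superset hB
  have hWK : closure (interior K) ⊆ K := closure_minimal interior_subset hK.isClosed
  have hfrK : frontier (interior K) ⊆ K := frontier_subset_closure.trans hWK
  have hfrB : Disjoint (frontier (interior K)) B := by
    rw [isOpen_interior.frontier_eq]
    exact disjoint_left.2 fun x hx hxB => hx.2 (hBK hxB)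
  have hCc : IsCompact (frontier (interior K) ∩ U) :=
    (hK.of_isClosed_subset isClosed_frontier hfrK).inter_right hU
  obtain ⟨t, -, htC⟩ := hCc.elim_nhds_subcover V fun x hx => (hVo x).mem_nhds
    (mem_connectedComponentIn ⟨hx.2, disjoint_left.1 hfrB hx.1⟩)
  have hsmall : ∀ y ∈ U \ B, Disjoint (V y) (frontier (interior K)) → V y ⊆ K := fun y hy hd => by
    have hyV : y ∈ V y := mem_connectedComponentIn hy
    have hne : (frontier (V y)).Nonempty := by
      rw [nonempty_iff_ne_empty, Ne, ← isClopen_iff_frontier_eq_empty]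
      intro h
      rcases isClopen_iff.1 h with h | h
      · exact (h ▸ hyV : y ∈ (∅ : Set S))
      · exact (hVsub y (h ▸ mem_univ c)).2 hc
    obtain ⟨w, hw⟩ := hne
    obtain ⟨z, hzK, hzV⟩ := mem_closure_iff.1 hw.1 _ isOpen_interior (hBK (hVfr y hw))
    have hside : IsSide (interior K) (frontier (interior K)) := ⟨isOpen_interior,
      (disjoint_frontier_iff_isOpen.2 isOpen_interior).symm, by
        rw [← closure_eq_self_union_frontier]; exact isClosed_closure⟩
    exact (hside.subset_of_isPreconnected isPreconnected_connectedComponentIn hd hzV hzK).trans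
      interior_subset
  have hex : ∃ y, ¬ IsCompact (closure (V y)) := by
    by_contra! hcon
    refine hUc ((hK.union (t.finite_toSet.isCompact_biUnion fun y _ => hcon y)).of_isClosed_subset hU
      fun x hx => ?_)
    by_cases hxB : x ∈ B
    · exact Or.inl (interior_subset (hBK hxB))
    have hxV : x ∈ V x := mem_connectedComponentIn ⟨hx, hxB⟩
    by_cases hd : Disjoint (V x) (frontier (interior K))
    · exact Or.inl (hsmall x ⟨hx, hxB⟩ hd hxV)
    · obtain ⟨z, hzV, hzf⟩ := not_disjoint_iff.1 hd
      obtain ⟨y, hy, hzy⟩ := mem_iUnion₂.1 (htC ⟨hzf, (hVsub x hzV).1⟩)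
      refine Or.inr (mem_iUnion₂.2 ⟨y, hy, subset_closure ?_⟩)
      have : V x = V y := (connectedComponentIn_eq hzV).trans (connectedComponentIn_eq hzy).symm
      exact this ▸ hxV
  obtain ⟨y, hy⟩ := hex
  have hcV : c ∉ V y := fun h => (hVsub y h).2 hc
  refine ⟨V y, hVo y, isPreconnected_connectedComponentIn, hV0B.mono_left (hVsub y),
    disjoint_left.2 fun x hx hxV => (hVsub y hxV).2 hx, hVfr y, hy, ?_⟩
  have hXeq : frontier (interior K) ∩ V y = frontier (interior K) ∩ closure (V y) := by
    refine Subset.antisymm (inter_subset_inter_right _ subset_closure) fun x hx => ⟨hx.1, ?_⟩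
    by_contra hxV
    exact disjoint_left.1 hfrB hx.1 (hVfr y ⟨hx.2, fun h => hxV (interior_subset h)⟩)
  refine exists_hasSep_of_isCompact (hVo y) (hV0B.mono_left (hVsub y)) hcV
    (E := V y \ closure (interior K)) (X := frontier (interior K) ∩ V y) ⟨⟨(hVo y).sdiff
      isClosed_closure, ?_, ?_⟩, fun h => hcV h.1, K, hK, fun x hx => ⟨hx.1, fun h => hx.2 (hWK h)⟩⟩
    ?_ inter_subset_right
  · exact disjoint_left.2 fun x hx hx' => hx.2 (frontier_subset_closure hx'.1)
  · have : V y \ closure (interior K) ∪ frontier (interior K) ∩ V y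
        = closure (V y) ∩ (interior K)ᶜ := by
      ext x
      constructor
      · rintro (hx | hx)
        · exact ⟨subset_closure hx.1, fun h => hx.2 (subset_closure h)⟩
        · rw [isOpen_interior.frontier_eq] at hx
          exact ⟨subset_closure hx.2, hx.1.2⟩
      · rintro ⟨hx, hxK⟩
        have hxV : x ∈ V y := by
          by_contra hxV
          exact hxK (hBK (hVfr y ⟨hx, fun h => hxV (interior_subset h)⟩))
        by_cases hxc : x ∈ closure (interior K)
        · exact Or.inr ⟨by rw [isOpen_interior.frontier_eq]; exact ⟨hxc, hxK⟩, hxV⟩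
        · exact Or.inl ⟨hxV, hxc⟩
    rw [this]
    exact isClosed_closure.inter isOpen_interior.isClosed_compl
  · rw [hXeq]
    exact (hK.of_isClosed_subset isClosed_frontier hfrK).inter_right isClosed_closure

/-- A single separating loop is boundary isolating. -/
theorem IsLoop.isBoundaryIsolating [T2Space S] [PreconnectedSpace S] {γ : ℝ → S} (h : IsLoop γ)
    {V B E : Set S} {c : S} (hγV : γ '' Icc 0 1 ⊆ V) (hVB : Disjoint V (Bd S))
    (hE : IsSep V c E (γ '' Icc 0 1)) (hV : IsOpen V) (hB : IsPreconnected B) (hcB : c ∈ B)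
    (hVfr : frontier V ⊆ B) (hBV : Disjoint B V) (hVc : ¬ IsCompact (closure V))
    (hBd : (Bd S).Nonempty) : IsBoundaryIsolating (γ '' Icc 0 1) := by
  have hγB : Disjoint (γ '' Icc 0 1) (Bd S) := hVB.mono_left hγV
  have hcγ : c ∉ γ '' Icc 0 1 := fun h' => disjoint_left.1 hBV hcB (hγV h')
  have hcompl : c ∈ (E ∪ γ '' Icc 0 1)ᶜ := fun h' => h'.elim hE.notMem hcγ
  have hEpre : IsPreconnected E := h.isPreconnected_side hγB hE.side ⟨c, hcompl⟩
  have hBE : Disjoint B E := disjoint_left.2 fun x hxB hxE =>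
    hE.notMem (hE.side.subset_of_isPreconnected hB (hBV.mono_right hγV) hxB hxE hcB)
  obtain ⟨K, hK, hVK⟩ := hE.exhaust
  have hne : (E ∩ V).Nonempty := by
    by_contra hcon
    refine hVc ((hK.of_isClosed_subset isClosed_closure) (closure_minimal (fun x hx => ?_)
      hK.isClosed))
    by_contra hxK
    exact hcon ⟨x, hVK ⟨hx, hxK⟩, hx⟩
  have hEV : E ⊆ V := by
    have hside : IsSide V (frontier V) := ⟨hV, (disjoint_frontier_iff_isOpen.2 hV).symm, by
      rw [← closure_eq_self_union_frontier]; exact isClosed_closure⟩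
    obtain ⟨x, hxE, hxV⟩ := hne
    exact hside.subset_of_isPreconnected hEpre (hBE.symm.mono_right hVfr) hxE hxV
  have hYpre : IsPreconnected (E ∪ γ '' Icc 0 1)ᶜ := by
    refine h.isPreconnected_side hγB hE.side.compl ?_
    obtain ⟨x, hxE, -⟩ := hne
    refine ⟨x, fun h' => h'.elim (fun h' => h' (Or.inl hxE)) fun h' => ?_⟩
    exact disjoint_left.1 hE.side.2.1 hxE h'
  have hcomp : ∀ {A : Set S}, IsSide A (γ '' Icc 0 1) → IsPreconnected A → ∀ x ∈ A,
      connectedComponentIn (γ '' Icc 0 1)ᶜ x = A := fun {A} hA hApre x hx => by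
    have hAγ : A ⊆ (γ '' Icc 0 1)ᶜ := fun y hy hyγ => disjoint_left.1 hA.2.1 hy hyγ
    refine Subset.antisymm (hA.subset_of_isPreconnected isPreconnected_connectedComponentIn
      (disjoint_left.2 fun y hy hyγ => connectedComponentIn_subset _ _ hy hyγ)
      (mem_connectedComponentIn (hAγ hx)) hx) (hApre.subset_connectedComponentIn hx hAγ)
  have hYγ : (E ∪ γ '' Icc 0 1)ᶜ ⊆ (γ '' Icc 0 1)ᶜ := compl_subset_compl.2 subset_union_right
  refine ⟨h.isSimpleClosedCurve, hγB.inter_eq, (E ∪ γ '' Icc 0 1)ᶜ, E, ?_, fun C => ⟨?_, ?_⟩, ?_, ?_,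
    fun hcpt => ?_⟩
  · exact fun e => hE.notMem (e ▸ hcompl)
  · rintro ⟨x, hx, rfl⟩
    by_cases hxE : x ∈ E
    · exact Or.inr (hcomp hE.side hEpre x hxE)
    · exact Or.inl (hcomp hE.side.compl hYpre x fun h' => h'.elim hxE hx)
  · rintro (rfl | rfl)
    · exact ⟨c, hYγ hcompl, (hcomp hE.side.compl hYpre c hcompl).symm⟩
    · obtain ⟨x, hxE, -⟩ := hne
      exact ⟨x, fun hx => disjoint_left.1 hE.side.2.1 hxE hx, (hcomp hE.side hEpre x hxE).symm⟩
  · obtain ⟨x, hx⟩ := hBd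
    exact ⟨x, fun h' => disjoint_left.1 hVB (h'.elim (fun h' => hEV h') fun h' => hγV h') hx, hx⟩
  · exact (hVB.mono_left hEV).inter_eq
  · refine hVc ((hK.union hcpt).of_isClosed_subset isClosed_closure (closure_minimal (fun x hx => ?_)
      (hK.union hcpt).isClosed))
    by_cases hxK : x ∈ K
    · exact Or.inl hxK
    · exact Or.inr (Or.inl (hVK ⟨hx, hxK⟩))

end IsolatedEnd

/-! ### Merging two loops -/

section Merge

variable {S : Type*} [TopologicalSpace S]

theorem exists_outer_nhds {ψ : ℂ → S} (hψ : IsOpenEmbedding ψ) {p : S}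
    (hp : p ∈ ψ '' Metric.sphere 0 1) {P : Set S} (hP : IsClosed P) (hpP : p ∉ P) :
    ∃ U ∈ 𝓝 p, ∃ W, IsPreconnected W ∧ U \ ψ '' Metric.closedBall 0 1 ⊆ W ∧
      Disjoint W (P ∪ ψ '' Metric.sphere 0 1) := by
  obtain ⟨z, hz, rfl⟩ := hp
  have hz1 : ‖z‖ = 1 := by simpa using hz
  have hz0 : z ≠ 0 := fun h => by simp [h] at hz1
  have hO : IsOpen ((fun w => ψ (Complex.exp w)) ⁻¹' Pᶜ) :=
    hP.isOpen_compl.preimage (hψ.continuous.comp Complex.continuous_exp)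
  obtain ⟨r, hr, hb⟩ := Metric.isOpen_iff.1 hO (Complex.log z) (by simpa [Complex.exp_log hz0])
  have hopen : IsOpenMap fun w => ψ (Complex.exp w) := hψ.isOpenMap.comp Complex.isOpenMap_exp
  refine ⟨_, (hopen _ Metric.isOpen_ball).mem_nhds ⟨Complex.log z, Metric.mem_ball_self hr, by
      simp [Complex.exp_log hz0]⟩, (fun w => ψ (Complex.exp w)) ''
      (Metric.ball (Complex.log z) r ∩ {w | 0 < w.re}), ?_, ?_, ?_⟩
  · exact ((convex_ball _ _).inter (convex_halfSpace_re_gt 0)).isPreconnected.image _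
      (hψ.continuous.comp Complex.continuous_exp).continuousOn
  · rintro _ ⟨⟨w, hw, rfl⟩, hwD⟩
    refine ⟨w, ⟨hw, show 0 < w.re from not_le.1 fun h => hwD ⟨_, ?_, rfl⟩⟩, rfl⟩
    simpa [Complex.norm_exp] using h
  · rw [disjoint_left]
    rintro _ ⟨w, ⟨hw, hw0 : 0 < w.re⟩, rfl⟩ (h | h)
    · exact hb hw h
    · rw [hψ.injective.mem_set_image, mem_sphere_zero_iff_norm, Complex.norm_exp] at h
      linarith [Real.exp_eq_one_iff _ |>.1 h]

/-- After possibly switching a disc from one side to the other, an arc of its boundary has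
different sides locally. -/
theorem IsSide.exists_essential {ψ : ℂ → S} (hψ : IsOpenEmbedding ψ) [T2Space S] {E P J : Set S}
    (hP : IsClosed P) (hPψ : Disjoint P (ψ '' Metric.ball 0 1))
    (hE : IsSide E (P ∪ ψ '' Metric.sphere 0 1)) (hJ : IsPreconnected J)
    (hJψ : J ⊆ ψ '' Metric.sphere 0 1) (hJP : Disjoint J P) :
    ∃ E', IsSide E' (P ∪ ψ '' Metric.sphere 0 1) ∧
      (∀ p ∈ J, p ∈ closure E' ∧ p ∈ closure (E' ∪ (P ∪ ψ '' Metric.sphere 0 1))ᶜ) ∧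
      ∀ x ∉ ψ '' Metric.closedBall 0 1, x ∈ E' ↔ x ∈ E := by
  set D := ψ '' Metric.closedBall 0 1 with hD
  set X := P ∪ ψ '' Metric.sphere 0 1 with hX
  have hDc : IsClosed D := ((isCompact_closedBall 0 1).image hψ.continuous).isClosed
  have hO : IsOpen (ψ '' Metric.ball 0 1) := hψ.isOpenMap _ Metric.isOpen_ball
  have hDO : D = ψ '' Metric.ball 0 1 ∪ ψ '' Metric.sphere 0 1 := by
    rw [← image_union, Metric.ball_union_sphere]
  have hOX : Disjoint (ψ '' Metric.ball 0 1) X := by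
    refine disjoint_union_right.2 ⟨hPψ.symm, ?_⟩
    rw [disjoint_image_iff hψ.injective]
    exact Metric.sphere_disjoint_ball.symm
  have hJO : J ⊆ closure (ψ '' Metric.ball 0 1) := hJψ.trans (by
    rintro _ ⟨z, hz, rfl⟩
    refine image_closure_subset_closure_image hψ.continuous ⟨z, ?_, rfl⟩
    rw [closure_ball _ one_ne_zero]
    exact Metric.sphere_subset_closedBall hz)
  have hcov : J ⊆ closure (E \ D) ∪ closure ((E ∪ X)ᶜ \ D) := fun p hp => by
    rw [← closure_union, mem_closure_iff_nhds]
    intro N hN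
    have hPN := Filter.inter_mem hN (hP.isOpen_compl.mem_nhds (disjoint_left.1 hJP hp))
    obtain ⟨y, hy, hyD⟩ : ((N ∩ Pᶜ) \ D).Nonempty := by
      rw [nonempty_iff_ne_empty, Ne, sdiff_eq_empty]
      intro hsub
      obtain ⟨z, hz, rfl⟩ := hJψ hp
      have h1 : Metric.closedBall (0 : ℂ) 1 ∈ 𝓝 z := by
        refine Filter.mem_of_superset (hψ.continuous.continuousAt hPN) fun w hw => ?_
        exact (hψ.injective.mem_set_image).1 (hsub hw)
      have h2 := mem_interior_iff_mem_nhds.2 h1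
      rw [interior_closedBall _ one_ne_zero] at h2
      exact disjoint_left.1 Metric.sphere_disjoint_ball hz h2
    have hyX : y ∉ X := fun h => h.elim hy.2 fun h => hyD (hDO ▸ Or.inr h)
    by_cases hyE : y ∈ E
    · exact ⟨y, hy.1, Or.inl ⟨hyE, hyD⟩⟩
    · exact ⟨y, hy.1, Or.inr ⟨fun h => h.elim hyE hyX, hyD⟩⟩
  have hone : J ⊆ closure (E \ D) ∨ J ⊆ closure ((E ∪ X)ᶜ \ D) := by
    by_contra! h
    obtain ⟨⟨p, hpJ, hp⟩, q, hqJ, hq⟩ := And.intro (not_subset.1 h.1) (not_subset.1 h.2)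
    obtain ⟨x, hx, hx1, hx2⟩ := isPreconnected_closed_iff.1 hJ _ _ isClosed_closure isClosed_closure
      hcov ⟨q, hqJ, (hcov hqJ).resolve_right hq⟩ ⟨p, hpJ, (hcov hpJ).resolve_left hp⟩
    obtain ⟨U, hU, W, hW, hUW, hWX⟩ :=
      exists_outer_nhds hψ (hJψ hx) hP (disjoint_left.1 hJP hx)
    obtain ⟨y, hyU, hy⟩ := mem_closure_iff_nhds.1 hx1 U hU
    obtain ⟨y', hyU', hy'⟩ := mem_closure_iff_nhds.1 hx2 U hU
    exact hy'.1 (Or.inl (hE.subset_of_isPreconnected hW hWX (hUW ⟨hyU, hy.2⟩) hy.1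
      (hUW ⟨hyU', hy'.2⟩)))
  rcases hone with h | h
  · refine ⟨E \ D, ⟨hE.1.sdiff hDc, hE.2.1.mono_left sdiff_subset, ?_⟩, fun p hp => ⟨h hp, ?_⟩,
      fun x hx => ⟨fun h => h.1, fun h => ⟨h, hx⟩⟩⟩
    · have : E \ D ∪ X = (E ∪ X) \ ψ '' Metric.ball 0 1 := by
        ext x
        have h1 : x ∈ ψ '' Metric.ball 0 1 → x ∉ X := fun h => disjoint_left.1 hOX h
        have h2 : x ∈ ψ '' Metric.sphere 0 1 → x ∈ X := Or.inr
        simp only [hDO, mem_union, mem_sdiff]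
        tauto
      rw [this]
      exact hE.2.2.sdiff hO
    · refine closure_mono ?_ (hJO hp)
      rintro x hx (hx' | hx')
      · exact hx'.2 (hDO ▸ Or.inl hx)
      · exact disjoint_left.1 hOX hx hx'
  · refine ⟨E ∪ ψ '' Metric.ball 0 1, ⟨hE.1.union hO, disjoint_union_left.2 ⟨hE.2.1, hOX⟩, ?_⟩,
      fun p hp => ⟨closure_mono subset_union_right (hJO hp), closure_mono ?_ (h hp)⟩, ?_⟩
    · have : E ∪ ψ '' Metric.ball 0 1 ∪ X = E ∪ X ∪ D := by
        ext x
        have h2 : x ∈ ψ '' Metric.sphere 0 1 → x ∈ X := Or.inr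
        simp only [hDO, mem_union]
        tauto
      rw [this]
      exact hE.2.2.union hDc
    · rintro x ⟨hx, hxD⟩ ((hx' | hx') | hx')
      exacts [hx (Or.inl hx'), hxD (hDO ▸ Or.inl hx'), hx (Or.inr hx')]
    · intro x hx
      refine ⟨fun h => h.resolve_right fun h' => hx (hDO ▸ Or.inl h'), Or.inl⟩

/-- One of the three arms of a theta curve can be removed. -/
theorem exists_loop_of_theta [T2Space S] {V Y E : Set S} (hV : IsOpen V)
    (hVB : Disjoint V (Bd S)) (hY : IsClosed Y) {γ : Fin 3 → ℝ → S} {a b : S} (hab : a ≠ b)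
    (hγ : ∀ k, IsEdge (γ k)) (h0 : ∀ k, γ k 0 = a) (h1 : ∀ k, γ k 1 = b)
    (hd : ∀ k l, k < l → γ k '' Icc 0 1 ∩ γ l '' Icc 0 1 ⊆ {a, b}) (hγV : ∀ k, γ k '' Icc 0 1 ⊆ V)
    (hγY : ∀ k, Disjoint (γ k '' Icc 0 1) Y) (hE : IsSide E (Y ∪ ⋃ k, γ k '' Icc 0 1)) :
    ∃ δ E', IsLoop δ ∧ δ '' Icc 0 1 ⊆ V ∧ Disjoint (δ '' Icc 0 1) Y ∧
      IsSide E' (Y ∪ δ '' Icc 0 1) ∧ SameOff V E E' := by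
  have hne : ∀ k, γ k 0 ≠ γ k 1 := fun k => by rwa [h0, h1]
  have hm0 : (0 : ℝ) ∈ Icc (0 : ℝ) 1 := by simp
  have hm1 : (1 : ℝ) ∈ Icc (0 : ℝ) 1 := by simp
  have hd' : ∀ k l, k ≠ l → ∀ s ∈ Icc (0 : ℝ) 1, ∀ t ∈ Icc (0 : ℝ) 1, γ k s = γ l t →
      (s = 0 ∧ t = 0) ∨ (s = 1 ∧ t = 1) := fun k l hkl s hs t ht e => by
    have hab : γ k s = a ∨ γ k s = b := by
      rcases hkl.lt_or_gt with h | h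
      · exact hd k l h ⟨⟨s, hs, rfl⟩, t, ht, e.symm⟩
      · exact hd l k h ⟨⟨t, ht, e.symm⟩, s, hs, rfl⟩
    rcases hab with h | h
    · exact Or.inl ⟨(hγ k).injOn (hne k) hs hm0 (h.trans (h0 k).symm),
        (hγ l).injOn (hne l) ht hm0 (e.symm.trans (h.trans (h0 l).symm))⟩
    · exact Or.inr ⟨(hγ k).injOn (hne k) hs hm1 (h.trans (h1 k).symm),
        (hγ l).injOn (hne l) ht hm1 (e.symm.trans (h.trans (h1 l).symm))⟩
  have hsp : IsSpider a γ Y := ⟨hY, fun h => disjoint_left.1 hVB (hγV 0 ⟨0, hm0, h0 0⟩) h,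
    fun h => disjoint_left.1 (hγY 0) ⟨0, hm0, h0 0⟩ h, fun k => (hγ k).1,
    fun k => (hγ k).injOn (hne k), h0, fun k l hkl s hs t ht e =>
      (hd' k l hkl s hs t ht e).imp And.left And.left⟩
  obtain ⟨k, u, hu, hess⟩ : ∃ k, ∃ u ∈ Ioo (0 : ℝ) 1, ¬ (γ k u ∈ closure E ∧
      γ k u ∈ closure (E ∪ (Y ∪ ⋃ k, γ k '' Icc 0 1))ᶜ) := by
    by_contra! h
    exact hsp.not_three hE h
  obtain ⟨i, j, hik, hjk, hij, hall⟩ := (by decide : ∀ k : Fin 3, ∃ i j : Fin 3,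
    i ≠ k ∧ j ≠ k ∧ i ≠ j ∧ ∀ l, l = i ∨ l = j ∨ l = k) k
  have hδe : IsEdge (concat (γ i) (reparam (γ j) 1 0)) := by
    refine IsEdge.concat (hγ i) (hγ j).reverse (hne i) (by simpa using (hne j).symm)
      (by simp [h1]) fun s hs t ht e => ?_
    rcases hd' i j hij s hs (1 + (0 - 1) * t) ⟨by linarith [ht.2], by linarith [ht.1]⟩ e with h | h
    · exact Or.inr ⟨h.1, by linarith [h.2]⟩
    · exact Or.inl ⟨h.1, by linarith [h.2]⟩
  have hδi : concat (γ i) (reparam (γ j) 1 0) '' Icc 0 1 = γ i '' Icc 0 1 ∪ γ j '' Icc 0 1 := by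
    rw [concat_image (by simp [h1]), reverse_image]
  have hU : Y ∪ ⋃ k, γ k '' Icc 0 1 = Y ∪ (γ i '' Icc 0 1 ∪ γ j '' Icc 0 1) ∪ γ k '' Icc 0 1 := by
    rw [union_assoc]
    congr 1
    refine Subset.antisymm (iUnion_subset fun l => ?_) (union_subset (union_subset
      (subset_iUnion_of_subset i subset_rfl) (subset_iUnion_of_subset j subset_rfl))
      (subset_iUnion_of_subset k subset_rfl))
    rcases hall l with rfl | rfl | rfl
    exacts [fun x hx => Or.inl (Or.inl hx), fun x hx => Or.inl (Or.inr hx), fun x hx => Or.inr hx]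
  rw [hU] at hE hess
  have ⟨E', hE', hs⟩ := IsSide.remove_edge hV hVB
    (hY.union ((hγ i).isClosed_image.union (hγ j).isClosed_image)) (hγ k) (hγV k) (by
      rintro t ht (h | ⟨s, hs, e⟩ | ⟨s, hs, e⟩)
      · exact disjoint_left.1 (hγY k) ⟨t, Ioo_subset_Icc_self ht, rfl⟩ h
      · rcases hd' i k hik s hs t (Ioo_subset_Icc_self ht) e with h | h
        exacts [ht.1.ne' h.2, ht.2.ne h.2]
      · rcases hd' j k hjk s hs t (Ioo_subset_Icc_self ht) e with h | h
        exacts [ht.1.ne' h.2, ht.2.ne h.2]) hE hu hess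
  exact ⟨_, E', ⟨hδe, by simp [h0]⟩, by rw [hδi]; exact union_subset (hγV i) (hγV j),
    by rw [hδi]; exact disjoint_union_left.2 ⟨hγY i, hγY j⟩, by rwa [hδi], hs⟩

/-- Two edges which meet only where one ends and the other one starts form an edge. -/
theorem IsEdge.concat_of_inter {α β : ℝ → S} (hα : IsEdge α) (hβ : IsEdge β) (hα' : α 0 ≠ α 1)
    (hβ' : β 0 ≠ β 1) (h : α 1 = β 0) (hd : α '' Icc 0 1 ∩ β '' Icc 0 1 ⊆ {α 1}) :
    IsEdge (_root_.concat α β) :=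
  hα.concat hβ hα' hβ' h fun s hs t ht e =>
    have hs1 : α s = α 1 := hd ⟨⟨s, hs, rfl⟩, t, ht, e.symm⟩
    Or.inl ⟨hα.injOn hα' hs (by simp) hs1, hβ.injOn hβ' ht (by simp) (e.symm.trans (hs1.trans h))⟩

theorem IsLoop.eq_or {τ : ℝ → S} (h : IsLoop τ) {s t : ℝ} (hs : s ∈ Icc (0 : ℝ) 1)
    (ht : t ∈ Icc (0 : ℝ) 1) (e : τ s = τ t) : s = t ∨ (s = 0 ∧ t = 1) ∨ (s = 1 ∧ t = 0) := by
  rcases lt_trichotomy s t with h' | h' | h'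
  · exact Or.inr (Or.inl (h.edge.2 s hs t ht h' e))
  · exact Or.inl h'
  · exact Or.inr (Or.inr (h.edge.2 t ht s hs h' e.symm).symm)

set_option maxHeartbeats 800000 in
/-- Two disjoint chords outside a disc can be replaced by one loop. -/
theorem exists_loop_of_chords [T2Space S] {V Y E : Set S} (hV : IsOpen V)
    (hVB : Disjoint V (Bd S)) (hY : IsClosed Y) {τ R₁ R₂ : ℝ → S} (hτ : IsLoop τ) {t₁ t₂ t₃ : ℝ}
    (h01 : 0 < t₁) (h12 : t₁ < t₂) (h23 : t₂ < t₃) (h31 : t₃ < 1) (hR₁ : IsEdge R₁)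
    (hR₂ : IsEdge R₂) (hR₁0 : R₁ 0 = τ t₂) (hR₁1 : R₁ 1 = τ t₃) (hR₂0 : R₂ 0 = τ 0)
    (hR₂1 : R₂ 1 = τ t₁) (hR₁τ : ∀ s ∈ Ioo (0 : ℝ) 1, R₁ s ∉ τ '' Icc 0 1)
    (hR₂τ : ∀ s ∈ Ioo (0 : ℝ) 1, R₂ s ∉ τ '' Icc 0 1)
    (hRR : Disjoint (R₁ '' Icc 0 1) (R₂ '' Icc 0 1)) (hτV : τ '' Icc 0 1 ⊆ V)
    (hR₁V : R₁ '' Icc 0 1 ⊆ V) (hR₂V : R₂ '' Icc 0 1 ⊆ V) (hτY : Disjoint (τ '' Icc 0 1) Y)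
    (hR₁Y : Disjoint (R₁ '' Icc 0 1) Y) (hR₂Y : Disjoint (R₂ '' Icc 0 1) Y)
    (hE : IsSide E (Y ∪ R₁ '' Icc 0 1 ∪ R₂ '' Icc 0 1 ∪ τ '' Icc 0 1))
    (hess : ∀ p ∈ τ '' Ioo t₁ t₂, p ∈ closure E ∧
      p ∈ closure (E ∪ (Y ∪ R₁ '' Icc 0 1 ∪ R₂ '' Icc 0 1 ∪ τ '' Icc 0 1))ᶜ) :
    ∃ δ E', IsLoop δ ∧ δ '' Icc 0 1 ⊆ V ∧ Disjoint (δ '' Icc 0 1) Y ∧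
      IsSide E' (Y ∪ δ '' Icc 0 1) ∧ SameOff V E E' := by
  have hR₁e : ∀ s ∈ Icc (0 : ℝ) 1, R₁ s ∈ τ '' Icc 0 1 → R₁ s = τ t₂ ∨ R₁ s = τ t₃ := by
    intro s hs h
    rcases eq_endpoints_or_mem_Ioo_of_mem_Icc hs with rfl | rfl | h'
    exacts [Or.inl hR₁0, Or.inr hR₁1, absurd h (hR₁τ s h')]
  have hR₂e : ∀ s ∈ Icc (0 : ℝ) 1, R₂ s ∈ τ '' Icc 0 1 → R₂ s = τ t₁ ∨ R₂ s = τ 0 := by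
    intro s hs h
    rcases eq_endpoints_or_mem_Ioo_of_mem_Icc hs with rfl | rfl | h'
    exacts [Or.inr hR₂0, Or.inl hR₂1, absurd h (hR₂τ s h')]
  have hsub : ∀ {a b : ℝ}, 0 ≤ a → b ≤ 1 → τ '' Icc a b ⊆ τ '' Icc 0 1 := fun ha hb =>
    image_mono (Icc_subset_Icc ha hb)
  have hτ01 : τ t₁ ≠ τ 0 := fun e => by
    rcases hτ.eq_or ⟨by linarith, by linarith⟩ ⟨le_rfl, zero_le_one⟩ e with h | ⟨h, -⟩ | ⟨h, -⟩ <;>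
      linarith
  have hεi : reparam τ t₁ 0 '' Icc 0 1 = τ '' Icc 0 t₁ := by
    rw [reparam_image, uIcc_comm, uIcc_of_le h01.le]
  have hτinj : ∀ {a b : ℝ}, 0 ≤ a → b ≤ 1 → (0 < a ∨ b < 1) → InjOn τ (Icc a b) := fun ha hb h =>
    hτ.edge.injOn_Icc ha hb h
  have hεe : IsEdge (reparam τ t₁ 0) := by
    refine isEdge_of_injOn (ContinuousOn.reparam ?_) (InjOn.reparam h01.ne' ?_) <;>
      rw [uIcc_comm, uIcc_of_le h01.le]
    exacts [hτ.edge.1.mono (Icc_subset_Icc le_rfl (by linarith)),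
      hτinj le_rfl (by linarith) (Or.inr (by linarith))]
  have key : ∀ f E₁, IsEdge f → f 0 = τ t₁ → f 1 = τ 0 →
      f '' Icc 0 1 ⊆ τ '' Icc t₁ 1 ∪ R₁ '' Icc 0 1 →
      IsSide E₁ (Y ∪ (R₂ '' Icc 0 1 ∪ τ '' Icc 0 t₁ ∪ f '' Icc 0 1)) → SameOff V E E₁ →
      ∃ δ E', IsLoop δ ∧ δ '' Icc 0 1 ⊆ V ∧ Disjoint (δ '' Icc 0 1) Y ∧
        IsSide E' (Y ∪ δ '' Icc 0 1) ∧ SameOff V E E' := by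
    intro f E₁ hf hf0 hf1 hfi hE₁ hs
    have hfV : f '' Icc 0 1 ⊆ V :=
      hfi.trans (union_subset ((hsub h01.le le_rfl).trans hτV) hR₁V)
    have hfY : Disjoint (f '' Icc 0 1) Y := Disjoint.mono_left hfi
      (disjoint_union_left.2 ⟨hτY.mono_left (hsub h01.le le_rfl), hR₁Y⟩)
    have hi2 := reverse_image R₂
    have := exists_loop_of_theta (γ := ![reparam R₂ 1 0, reparam τ t₁ 0, f]) (E := E₁) hV hVB hY
      hτ01 (by simp [Fin.forall_fin_succ, hR₂.reverse, hεe, hf])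
      (by simp [Fin.forall_fin_succ, hR₂1, hf0]) (by simp [Fin.forall_fin_succ, hR₂0, hf1])
      ?_ ?_ ?_ ?_
    · obtain ⟨δ, E', h1, h2, h3, h4, h5⟩ := this
      exact ⟨δ, E', h1, h2, h3, h4, hs.trans h5⟩
    · have d1 : R₂ '' Icc 0 1 ∩ τ '' Icc 0 t₁ ⊆ {τ t₁, τ 0} := by
        rintro _ ⟨⟨s, hs, rfl⟩, h⟩
        exact hR₂e s hs (hsub le_rfl (by linarith) h)
      have d2 : R₂ '' Icc 0 1 ∩ f '' Icc 0 1 ⊆ {τ t₁, τ 0} := by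
        rintro _ ⟨⟨s, hs, rfl⟩, h⟩
        rcases hfi h with h | h
        · exact hR₂e s hs (hsub h01.le le_rfl h)
        · exact absurd ⟨s, hs, rfl⟩ (disjoint_left.1 hRR h)
      have d3 : τ '' Icc 0 t₁ ∩ f '' Icc 0 1 ⊆ {τ t₁, τ 0} := by
        rintro _ ⟨⟨s, hs, rfl⟩, h⟩
        have hs1 : s ∈ Icc (0 : ℝ) 1 := ⟨hs.1, by linarith [hs.2]⟩
        rcases hfi h with ⟨t, ht, e⟩ | ⟨t, ht, e⟩
        · rcases hτ.eq_or ⟨by linarith [ht.1], ht.2⟩ hs1 e with h | h | h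
          · have : s = t₁ := le_antisymm hs.2 (h ▸ ht.1)
            exact Or.inl (by rw [this])
          · linarith [ht.1, h.1]
          · exact Or.inr (by rw [h.2]; rfl)
        · rcases hR₁e t ht (e ▸ ⟨s, hs1, rfl⟩) with h | h <;> rw [e] at h <;>
            rcases hτ.eq_or hs1 ⟨by linarith, by linarith⟩ h with h | ⟨h, h'⟩ | ⟨h, h'⟩ <;>
            linarith [hs.2]
      intro k l hkl
      fin_cases k <;> fin_cases l <;> simp [hi2, hεi] at hkl ⊢
      exacts [d1, d2, d3]
    · simp only [Fin.forall_fin_succ, Matrix.cons_val_zero, Matrix.cons_val_succ]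
      exact ⟨hi2 ▸ hR₂V, by rw [hεi]; exact (hsub le_rfl (by linarith)).trans hτV, hfV, by simp⟩
    · simp only [Fin.forall_fin_succ, Matrix.cons_val_zero, Matrix.cons_val_succ]
      exact ⟨hi2 ▸ hR₂Y, by rw [hεi]; exact hτY.mono_left (hsub le_rfl (by linarith)), hfY,
        by simp⟩
    · convert hE₁ using 2
      rw [← hi2, ← hεi]
      ext x
      simp [Fin.exists_fin_succ, or_assoc]
  have hm0 : (0 : ℝ) ∈ Icc (0 : ℝ) 1 := by simp
  have hm1 : (1 : ℝ) ∈ Icc (0 : ℝ) 1 := by simp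
  have hd₁i : reparam τ t₂ t₁ '' Icc 0 1 = τ '' Icc t₁ t₂ := by
    rw [reparam_image, uIcc_comm, uIcc_of_le h12.le]
  have hd₁e : IsEdge (reparam τ t₂ t₁) := by
    refine isEdge_of_injOn (ContinuousOn.reparam ?_) (InjOn.reparam h12.ne' ?_) <;>
      rw [uIcc_comm, uIcc_of_le h12.le]
    exacts [hτ.edge.1.mono (Icc_subset_Icc h01.le (by linarith)),
      hτinj h01.le (by linarith) (Or.inl h01)]
  have he₁e : IsEdge (reparam τ t₂ t₃) :=
    hτ.edge.reparam (by linarith) h23 (by linarith)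
  have he₁i := reparam_image_of_le τ h23.le
  have hne : ∀ {a b : ℝ}, 0 < a → a < b → b < 1 → τ a ≠ τ b := fun h0 h h1 e => by
    rcases hτ.eq_or ⟨h0.le, by linarith⟩ ⟨by linarith, h1.le⟩ e with h | ⟨h, -⟩ | ⟨h, -⟩ <;>
      linarith
  have hcut : τ '' Icc 0 1 = τ '' Icc 0 t₁ ∪ τ '' Icc t₁ 1 := by
    rw [← image_union, Icc_union_Icc_eq_Icc h01.le (by linarith)]
  have hcut' : τ '' Icc t₁ 1 = τ '' Icc t₁ t₂ ∪ (τ '' Icc t₂ t₃ ∪ τ '' Icc t₃ 1) := by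
    rw [← image_union, ← image_union, Icc_union_Icc_eq_Icc h23.le h31.le,
      Icc_union_Icc_eq_Icc h12.le (by linarith)]
  have hcl : ∀ {a b : ℝ}, 0 ≤ a → b ≤ 1 → IsClosed (τ '' Icc a b) := fun ha hb =>
    hτ.edge.isClosed_image_Icc ha hb
  have hR₁d : R₁ '' Icc 0 1 ∩ τ '' Icc 0 1 ⊆ {τ t₂, τ t₃} := by
    rintro _ ⟨⟨s, hs, rfl⟩, h⟩
    exact hR₁e s hs h
  have hττ : ∀ {a b s : ℝ}, 0 ≤ a → b ≤ 1 → 0 < s → s < 1 → τ s ∈ τ '' Icc a b → s ∈ Icc a b := by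
    rintro a b s ha hb h0 h1 ⟨t, ht, e⟩
    rcases hτ.eq_or ⟨ha.trans ht.1, ht.2.trans hb⟩ ⟨h0.le, h1.le⟩ e with h | ⟨-, h⟩ | ⟨-, h⟩
    · exact h ▸ ht
    all_goals linarith
  have hess' : (∃ u ∈ Ioo (0 : ℝ) 1, ¬ (reparam τ t₂ t₃ u ∈ closure E ∧ reparam τ t₂ t₃ u ∈
      closure (E ∪ (Y ∪ R₁ '' Icc 0 1 ∪ R₂ '' Icc 0 1 ∪ τ '' Icc 0 1))ᶜ)) ∨
      ∃ u ∈ Ioo (0 : ℝ) 1, ¬ (R₁ u ∈ closure E ∧ R₁ u ∈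
      closure (E ∪ (Y ∪ R₁ '' Icc 0 1 ∪ R₂ '' Icc 0 1 ∪ τ '' Icc 0 1))ᶜ) := by
    by_contra! hcon
    set γ : Fin 3 → ℝ → S := ![reparam τ t₂ t₁, reparam τ t₂ t₃, R₁]
    have hγe : ∀ k, IsEdge (γ k) := by simp [γ, Fin.forall_fin_succ, hd₁e, he₁e, hR₁]
    have hγ0 : ∀ k, γ k 0 = τ t₂ := by simp [γ, Fin.forall_fin_succ, hR₁0]
    have hγn : ∀ k, γ k 0 ≠ γ k 1 := by
      simp [γ, Fin.forall_fin_succ, hR₁0, hR₁1,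
        (hne h01 h12 (by linarith)).symm, hne (by linarith) h23 h31]
    have hd : ∀ k l, k ≠ l → γ k '' Icc 0 1 ∩ γ l '' Icc 0 1 ⊆ {γ k 0, γ k 1} := by
      have d1 : τ '' Icc t₁ t₂ ∩ τ '' Icc t₂ t₃ ⊆ {τ t₂} := by
        rintro _ ⟨⟨s, hs, rfl⟩, h⟩
        have := hττ (by linarith) (by linarith) (by linarith [hs.1]) (by linarith [hs.2]) h
        rw [le_antisymm hs.2 this.1]
        rfl
      have d2 : τ '' Icc t₁ t₂ ∩ R₁ '' Icc 0 1 ⊆ {τ t₂} := by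
        rintro x ⟨h, h'⟩
        rcases hR₁d ⟨h', hsub h01.le (by linarith) h⟩ with h' | h'
        · exact h'
        · rw [h'] at h
          linarith [(hττ h01.le (by linarith) (by linarith) h31 h).2]
      have d3 : τ '' Icc t₂ t₃ ∩ R₁ '' Icc 0 1 ⊆ {τ t₂, τ t₃} := fun x h =>
        hR₁d ⟨h.2, hsub (by linarith) (by linarith) h.1⟩
      intro k l hkl
      fin_cases k <;> fin_cases l <;> simp [γ, hd₁i, he₁i, hR₁0, hR₁1] at hkl ⊢
      exacts [d1.trans (by simp), d2.trans (by simp), (inter_comm _ _ ▸ d1).trans (by simp),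
        d3, (inter_comm _ _ ▸ d2).trans (by simp), inter_comm _ _ ▸ d3]
    have hU : Y ∪ R₂ '' Icc 0 1 ∪ (τ '' Icc 0 t₁ ∪ τ '' Icc t₃ 1) ∪ ⋃ k, γ k '' Icc 0 1 =
        Y ∪ R₁ '' Icc 0 1 ∪ R₂ '' Icc 0 1 ∪ τ '' Icc 0 1 := by
      have : ⋃ k, γ k '' Icc 0 1 = τ '' Icc t₁ t₂ ∪ (τ '' Icc t₂ t₃ ∪ R₁ '' Icc 0 1) := by
        rw [← hd₁i, ← he₁i]
        ext x
        simp [γ, Fin.exists_fin_succ]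
      rw [hcut, hcut', this]
      ac_rfl
    have hsp : IsSpider (τ t₂) γ (Y ∪ R₂ '' Icc 0 1 ∪ (τ '' Icc 0 t₁ ∪ τ '' Icc t₃ 1)) := by
      have hmem : τ t₂ ∈ τ '' Icc 0 1 := ⟨t₂, ⟨by linarith, by linarith⟩, rfl⟩
      refine ⟨(hY.union hR₂.isClosed_image).union ((hcl le_rfl (by linarith)).union
        (hcl (by linarith) le_rfl)), fun h => disjoint_left.1 hVB (hτV hmem) h, ?_,
        fun k => (hγe k).1, fun k => (hγe k).injOn (hγn k), hγ0, fun k l hkl s hs u hu e => ?_⟩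
      · rintro ((h | h) | h | h)
        · exact disjoint_left.1 hτY hmem h
        · exact disjoint_left.1 hRR ⟨0, hm0, hR₁0⟩ h
        · linarith [(hττ le_rfl (by linarith) (by linarith) (by linarith) h).2]
        · linarith [(hττ (by linarith) le_rfl (by linarith) (by linarith) h).1]
      · rcases hd k l hkl ⟨⟨s, hs, rfl⟩, u, hu, e.symm⟩ with h | h
        exacts [Or.inl ((hγe k).injOn (hγn k) hs hm0 h), Or.inr ((hγe k).injOn (hγn k) hs hm1 h)]
    refine hsp.not_three (hU ▸ hE) fun k u hu => ?_
    rw [hU]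
    fin_cases k
    · refine hess _ ⟨t₂ + (t₁ - t₂) * u, ⟨?_, ?_⟩, rfl⟩ <;> nlinarith [hu.1, hu.2]
    · exact hcon.1 u hu
    · exact hcon.2 u hu
  rcases hess' with ⟨u, hu, h⟩ | ⟨u, hu, h⟩
  · have hg : IsEdge (concat R₁ (reparam τ t₃ 1)) := by
      refine hR₁.concat_of_inter (hτ.edge.reparam (by linarith) h31 le_rfl)
        (by rw [hR₁0, hR₁1]; exact hne (by linarith) h23 h31) ?_ (by simp [hR₁1]) ?_
      · rw [reparam_zero, reparam_one]
        intro e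
        rcases hτ.eq_or ⟨by linarith, by linarith⟩ hm1 e with h | ⟨h, -⟩ | ⟨h, -⟩ <;> linarith
      · rw [reparam_image_of_le τ h31.le, hR₁1]
        rintro x ⟨h, h'⟩
        rcases hR₁d ⟨h, hsub (by linarith) le_rfl h'⟩ with h | h
        · rw [h] at h'
          linarith [(hττ (by linarith) le_rfl (by linarith) (by linarith) h').1]
        · exact h
    have hgi : concat R₁ (reparam τ t₃ 1) '' Icc 0 1 = R₁ '' Icc 0 1 ∪ τ '' Icc t₃ 1 := by
      rw [concat_image (by simp [hR₁1]), reparam_image_of_le τ h31.le]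
    have hf : IsEdge (concat (reparam τ t₁ t₂) (concat R₁ (reparam τ t₃ 1))) := by
      refine (hτ.edge.reparam h01.le h12 (by linarith)).concat_of_inter hg
        (by simpa using hne h01 h12 (by linarith)) ?_ (by simp [hR₁0]) ?_
      · simp only [concat_zero, concat_one, reparam_one, hR₁0]
        intro e
        rcases hτ.eq_or ⟨by linarith, by linarith⟩ hm1 e with h | ⟨h, -⟩ | ⟨h, -⟩ <;> linarith
      · rw [reparam_image_of_le τ h12.le, hgi, reparam_one]
        rintro _ ⟨⟨s, hs, rfl⟩, h | h⟩
        · rcases hR₁d ⟨h, s, ⟨by linarith [hs.1], by linarith [hs.2]⟩, rfl⟩ with h | h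
          · exact h
          · exact absurd h (hne (by linarith [hs.1]) (by linarith [hs.2]) h31)
        · linarith [hs.2, (hττ (by linarith) le_rfl (by linarith [hs.1]) (by linarith [hs.2]) h).1]
    have hfi : concat (reparam τ t₁ t₂) (concat R₁ (reparam τ t₃ 1)) '' Icc 0 1 =
        τ '' Icc t₁ t₂ ∪ (R₁ '' Icc 0 1 ∪ τ '' Icc t₃ 1) := by
      rw [concat_image (by simp [hR₁0]), reparam_image_of_le τ h12.le, hgi]
    have hX : Y ∪ R₁ '' Icc 0 1 ∪ R₂ '' Icc 0 1 ∪ τ '' Icc 0 1 =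
        Y ∪ (R₂ '' Icc 0 1 ∪ τ '' Icc 0 t₁ ∪ (τ '' Icc t₁ t₂ ∪ (R₁ '' Icc 0 1 ∪ τ '' Icc t₃ 1))) ∪
          reparam τ t₂ t₃ '' Icc 0 1 := by
      rw [hcut, hcut', he₁i]
      ac_rfl
    rw [hX] at hE h
    have ⟨E₁, hE₁, hs⟩ := IsSide.remove_edge hV hVB (hY.union ((hR₂.isClosed_image.union
      (hcl le_rfl (by linarith))).union ((hcl h01.le (by linarith)).union
      (hR₁.isClosed_image.union (hcl (by linarith) le_rfl))))) he₁e
      (he₁i ▸ (hsub (by linarith) (by linarith)).trans hτV) (by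
        intro t ht
        obtain ⟨s, hs, hst⟩ : ∃ s ∈ Ioo t₂ t₃, reparam τ t₂ t₃ t = τ s :=
          ⟨_, affine_mem_Ioo h23 ht, rfl⟩
        have hs0 : 0 < s := by linarith [hs.1]
        have hs1 : s < 1 := by linarith [hs.2]
        have hsτ : τ s ∈ τ '' Icc 0 1 := ⟨s, ⟨hs0.le, hs1.le⟩, rfl⟩
        rw [hst]
        rintro (h | (⟨w, hw, e⟩ | h) | h | h | h)
        · exact disjoint_left.1 hτY hsτ h
        · rcases hR₂e w hw (e ▸ hsτ) with h | h <;> rw [e] at h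
          · exact hne h01 (by linarith [hs.1]) hs1 h.symm
          · rcases hτ.eq_or ⟨hs0.le, hs1.le⟩ hm0 h with h | ⟨h, -⟩ | ⟨h, -⟩ <;> linarith
        · linarith [(hττ le_rfl (by linarith) hs0 hs1 h).2, hs.1]
        · linarith [(hττ h01.le (by linarith) hs0 hs1 h).2, hs.1]
        · rcases hR₁d ⟨h, hsτ⟩ with h | h
          · exact hne (by linarith) hs.1 hs1 h.symm
          · exact hne hs0 hs.2 h31 h
        · linarith [(hττ (by linarith) le_rfl hs0 hs1 h).1, hs.2]) hE hu h
    refine key _ E₁ hf (by simp) (by simp [hτ.closed]) ?_ (by rw [hfi]; exact hE₁) hs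
    rw [hfi, hcut']
    rintro x (h | h | h)
    exacts [Or.inl (Or.inl h), Or.inr h, Or.inl (Or.inr (Or.inr h))]
  · have hX : Y ∪ R₁ '' Icc 0 1 ∪ R₂ '' Icc 0 1 ∪ τ '' Icc 0 1 =
        Y ∪ (R₂ '' Icc 0 1 ∪ τ '' Icc 0 t₁ ∪ τ '' Icc t₁ 1) ∪ R₁ '' Icc 0 1 := by
      rw [hcut]
      ac_rfl
    rw [hX] at hE h
    have ⟨E₁, hE₁, hs⟩ := IsSide.remove_edge hV hVB (hY.union ((hR₂.isClosed_image.union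
      (hcl le_rfl (by linarith))).union (hcl h01.le le_rfl))) hR₁ hR₁V (by
        rintro t ht (h | (h | h) | h)
        · exact disjoint_left.1 hR₁Y ⟨t, Ioo_subset_Icc_self ht, rfl⟩ h
        · exact disjoint_left.1 hRR ⟨t, Ioo_subset_Icc_self ht, rfl⟩ h
        · exact hR₁τ t ht (hsub le_rfl (by linarith) h)
        · exact hR₁τ t ht (hsub h01.le le_rfl h)) hE hu h
    have hi := reparam_image_of_le τ (show t₁ ≤ 1 by linarith)
    exact key (reparam τ t₁ 1) E₁ (hτ.edge.reparam h01.le (by linarith) le_rfl) (by simp)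
      (by simp [hτ.closed]) (by rw [hi]; exact subset_union_left) (by rwa [hi]) hs

end Merge

/-! ### Merging loops across a disc -/

section Angles

theorem exists_angles {z w : ℂ} (hz : ‖z‖ = 1) (hw : ‖w‖ = 1) (hzw : z ≠ w) (hz' : 0 < z.re)
    (hw' : 0 < w.re) : ∃ a b : ℝ, -(Real.pi / 2) < a ∧ a < b ∧ b < Real.pi / 2 ∧
      ((z = Complex.exp (a * Complex.I) ∧ w = Complex.exp (b * Complex.I)) ∨
        (w = Complex.exp (a * Complex.I) ∧ z = Complex.exp (b * Complex.I))) := by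
  have key : ∀ u : ℂ, ‖u‖ = 1 → u = Complex.exp (u.arg * Complex.I) := fun u hu => by
    have := Complex.norm_mul_exp_arg_mul_I u
    rw [hu, Complex.ofReal_one, one_mul] at this
    exact this.symm
  have hza := abs_lt.1 (Complex.abs_arg_lt_pi_div_two_iff.2 (Or.inl hz'))
  have hwa := abs_lt.1 (Complex.abs_arg_lt_pi_div_two_iff.2 (Or.inl hw'))
  rcases lt_trichotomy z.arg w.arg with h | h | h
  · exact ⟨_, _, hza.1, h, hwa.2, Or.inl ⟨key z hz, key w hw⟩⟩
  · exact absurd ((key z hz).trans (h ▸ (key w hw).symm)) hzw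
  · exact ⟨_, _, hwa.1, h, hza.2, Or.inr ⟨key w hw, key z hz⟩⟩

end Angles

section Discs

variable {S : Type*} [TopologicalSpace S]

/-- The unit circle of a chart, parametrized so that it starts at a prescribed angle. -/
theorem isLoop_circle_angle {ψ : ℂ → S} (hψ : IsOpenEmbedding ψ) (θ : ℝ) :
    ∃ τ : ℝ → S, IsLoop τ ∧ τ '' Icc 0 1 = ψ '' Metric.sphere 0 1 ∧
      ∀ t : ℝ, τ t = ψ (Complex.exp ((θ + 2 * Real.pi * t : ℝ) * Complex.I)) := by
  have hπ := Real.pi_pos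
  have hper : ∀ (t : ℝ) (n : ℤ), Complex.exp ((θ + 2 * Real.pi * (t + n) : ℝ) * Complex.I) =
      Complex.exp ((θ + 2 * Real.pi * t : ℝ) * Complex.I) := fun t n =>
    Complex.exp_eq_exp_iff_exists_int.2 ⟨n, by push_cast; ring⟩
  refine ⟨fun t => ψ (Complex.exp ((θ + 2 * Real.pi * t : ℝ) * Complex.I)),
    ⟨⟨Continuous.continuousOn (hψ.continuous.comp (by fun_prop)), fun s hs t ht hst e => ?_⟩, ?_⟩,
    ?_, fun t => rfl⟩
  · obtain ⟨n, hn⟩ := Complex.exp_eq_exp_iff_exists_int.1 (hψ.injective e)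
    have h1 := congrArg Complex.im hn
    simp at h1
    have h2 : s = t + n := by
      have : 2 * Real.pi * (s - (t + n)) = 0 := by linarith
      have := (mul_eq_zero.1 this).resolve_left (by positivity)
      linarith
    have hn1 : (n : ℝ) < 0 := by linarith
    have hn2 : (n : ℝ) ≤ -1 := by
      have : n < 0 := by exact_mod_cast hn1
      exact_mod_cast (by omega : n ≤ -1)
    constructor <;> linarith [hs.1, ht.2]
  · have := hper 0 1
    simp only [Int.cast_one, zero_add] at this
    exact congrArg ψ this.symm
  · rw [← image_image ψ (fun t : ℝ => Complex.exp ((θ + 2 * Real.pi * t : ℝ) * Complex.I))]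
    congr 1
    ext z
    rw [mem_sphere_zero_iff_norm]
    constructor
    · rintro ⟨t, -, rfl⟩
      exact Complex.norm_exp_ofReal_mul_I _
    · intro hz
      have hz' := Complex.norm_mul_exp_arg_mul_I z
      rw [hz, Complex.ofReal_one, one_mul] at hz'
      let s : ℝ := (z.arg - θ) / (2 * Real.pi)
      refine ⟨Int.fract s, ⟨Int.fract_nonneg _, (Int.fract_lt_one _).le⟩, ?_⟩
      beta_reduce
      rw [← hper _ ⌊s⌋, Int.fract_add_floor]
      have : θ + 2 * Real.pi * s = z.arg := by simp only [s]; field_simp; ring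
      rw [this, hz']

/-- Two points in the right half and two in the left half of the unit circle of a chart. -/
theorem exists_circle_of_points {ψ : ℂ → S} (hψ : IsOpenEmbedding ψ) {p p' q q' : S} (hpp : p ≠ p')
    (hqq : q ≠ q') (hp : p ∈ ψ '' (Metric.sphere 0 1 ∩ {z | z.re < 0}))
    (hp' : p' ∈ ψ '' (Metric.sphere 0 1 ∩ {z | z.re < 0}))
    (hq : q ∈ ψ '' (Metric.sphere 0 1 ∩ {z | 0 < z.re}))
    (hq' : q' ∈ ψ '' (Metric.sphere 0 1 ∩ {z | 0 < z.re})) :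
    ∃ τ t₁ t₂ t₃, IsLoop τ ∧ τ '' Icc 0 1 = ψ '' Metric.sphere 0 1 ∧ (0 : ℝ) < t₁ ∧ t₁ < t₂ ∧
      t₂ < t₃ ∧ t₃ < 1 ∧ ((τ t₂ = p ∧ τ t₃ = p') ∨ (τ t₂ = p' ∧ τ t₃ = p)) ∧
      ((τ 0 = q ∧ τ t₁ = q') ∨ (τ 0 = q' ∧ τ t₁ = q)) := by
  obtain ⟨z, ⟨hz, hz'⟩, rfl⟩ := hp
  obtain ⟨w, ⟨hw, hw'⟩, rfl⟩ := hp'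
  obtain ⟨x, ⟨hx, hx'⟩, rfl⟩ := hq
  obtain ⟨y, ⟨hy, hy'⟩, rfl⟩ := hq'
  rw [mem_sphere_zero_iff_norm] at hz hw hx hy
  have hz'' : z.re < 0 := hz'
  have hw'' : w.re < 0 := hw'
  obtain ⟨a, b, ha, hab, hb, h1⟩ := exists_angles hx hy (fun e => hqq (congrArg ψ e)) hx' hy'
  obtain ⟨c, d, hc, hcd, hd, h2⟩ := exists_angles (z := -z) (w := -w) (by simpa) (by simpa)
    (fun e => hpp (congrArg ψ (neg_injective e))) (by simpa) (by simpa)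
  obtain ⟨τ, hτ, hτi, hτe⟩ := isLoop_circle_angle hψ a
  have hπ := Real.pi_pos
  have hneg : ∀ (u : ℂ) (e : ℝ), -u = Complex.exp (e * Complex.I) →
      u = Complex.exp ((e + Real.pi : ℝ) * Complex.I) := fun u e h => by
    rw [Complex.ofReal_add, add_mul, Complex.exp_add, Complex.exp_pi_mul_I, ← h]
    ring
  have hval : ∀ e : ℝ, τ ((e - a) / (2 * Real.pi)) = ψ (Complex.exp (e * Complex.I)) := fun e => by
    rw [hτe]
    congr 4
    field_simp
    ring
  refine ⟨τ, (b - a) / (2 * Real.pi), (c + Real.pi - a) / (2 * Real.pi),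
    (d + Real.pi - a) / (2 * Real.pi), hτ, hτi, div_pos (by linarith) (by positivity),
    div_lt_div_of_pos_right (by linarith) (by positivity),
    div_lt_div_of_pos_right (by linarith) (by positivity),
    (div_lt_one (by positivity)).2 (by linarith), ?_, ?_⟩
  · rw [hval, hval]
    rcases h2 with ⟨e, e'⟩ | ⟨e, e'⟩
    · exact Or.inl ⟨congrArg ψ (hneg _ _ e).symm, congrArg ψ (hneg _ _ e').symm⟩
    · exact Or.inr ⟨congrArg ψ (hneg _ _ e).symm, congrArg ψ (hneg _ _ e').symm⟩
  · rw [hval, show τ 0 = ψ (Complex.exp (a * Complex.I)) by simpa using hτe 0]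
    rcases h1 with ⟨e, e'⟩ | ⟨e, e'⟩
    · exact Or.inl ⟨congrArg ψ e.symm, congrArg ψ e'.symm⟩
    · exact Or.inr ⟨congrArg ψ e.symm, congrArg ψ e'.symm⟩

/-- The last exit of a path from a closed set. -/
theorem exists_last_exit {f : ℝ → S} {O D : Set S} (hf : ContinuousOn f (Icc 0 1)) (hD : IsClosed D)
    (hO : IsOpen O) {η : ℝ} (hη0 : 0 < η) (hη : η ≤ 1) (h0 : f 0 ∈ O) (hOD : O ⊆ D)
    (hηD : f η ∉ D) : ∃ α ∈ Ioo 0 η, f α ∈ D \ O ∧ ∀ t ∈ Ioc α η, f t ∉ D := by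
  have hf' : ContinuousOn f (Icc 0 η) := hf.mono (Icc_subset_Icc_right hη)
  have hK : IsCompact (Icc 0 η ∩ f ⁻¹' D) :=
    isCompact_Icc.of_isClosed_subset (hf'.preimage_isClosed_of_isClosed isClosed_Icc hD)
      inter_subset_left
  obtain ⟨α, ⟨hα, hαD⟩, hmax⟩ := hK.exists_isGreatest ⟨0, ⟨le_rfl, hη0.le⟩, hOD h0⟩
  have hαη : α < η := lt_of_le_of_ne hα.2 fun e => hηD (e ▸ hαD)
  have hout : ∀ t ∈ Ioc α η, f t ∉ D := fun t ht h =>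
    absurd (hmax ⟨⟨hα.1.trans ht.1.le, ht.2⟩, h⟩) (not_le.2 ht.1)
  have hαO : f α ∉ O := fun h => by
    have hcont : Filter.Tendsto f (𝓝[>] α) (𝓝 (f α)) :=
      ((hf' α hα).mono_left (nhdsWithin_le_of_mem (Filter.mem_of_superset (Ioc_mem_nhdsGT hαη)
        fun t ht => ⟨hα.1.trans ht.1.le, ht.2⟩)))
    have := (hcont.eventually (hO.mem_nhds h)).and (Ioc_mem_nhdsGT hαη)
    obtain ⟨t, htO, ht⟩ := this.exists
    exact hout t ht (hOD htO)
  refine ⟨α, ⟨lt_of_le_of_ne hα.1 fun e => hαO (e ▸ h0), hαη⟩, ⟨hαD, hαO⟩, hout⟩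

/-- The part of a loop outside a disc, when the loop enters the disc only near its base point. -/
theorem IsLoop.exists_excursion {c : ℝ → S} (h : IsLoop c) {O D : Set S} (hD : IsClosed D)
    (hO : IsOpen O) (hOD : O ⊆ D) {η : ℝ} (hη0 : 0 < η) (hη : η < 1 / 2) (h0 : c 0 ∈ O)
    (hηD : ∀ t ∈ Icc η (1 - η), c t ∉ D) :
    ∃ α β, 0 < α ∧ α < η ∧ 1 - η < β ∧ β < 1 ∧ c α ∈ D \ O ∧ c β ∈ D \ O ∧
      ∀ t ∈ Ioo α β, c t ∉ D := by
  obtain ⟨α, hα, hαD, hαo⟩ := exists_last_exit h.edge.1 hD hO hη0 (by linarith) h0 hOD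
    (hηD η ⟨le_rfl, by linarith⟩)
  obtain ⟨β, hβ, hβD, hβo⟩ := exists_last_exit h.edge.reverse.1 hD hO hη0 (by linarith)
    (by simpa using h.closed ▸ h0) hOD (by
      have := hηD (1 - η) ⟨by linarith, le_rfl⟩
      simpa [reparam, sub_eq_add_neg] using this)
  have hr : ∀ t, reparam c 1 0 t = c (1 - t) := fun t => by simp [reparam, sub_eq_add_neg]
  rw [hr] at hβD
  refine ⟨α, 1 - β, hα.1, hα.2, by linarith [hβ.2], by linarith [hβ.1], hαD, hβD, fun t ht => ?_⟩
  rcases le_total t η with h1 | h1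
  · exact hαo t ⟨ht.1, h1⟩
  rcases le_total t (1 - η) with h2 | h2
  · exact hηD t ⟨h1, h2⟩
  · have := hβo (1 - t) ⟨by linarith [ht.2], by linarith⟩
    rwa [hr, sub_sub_cancel] at this

/-- A piece of a loop, traversed in either direction. -/
theorem IsLoop.exists_arc {c : ℝ → S} (h : IsLoop c) {α β : ℝ} (hα : 0 < α) (hαβ : α < β)
    (hβ : β < 1) {u v : S} (huv : (u = c α ∧ v = c β) ∨ (u = c β ∧ v = c α)) :
    ∃ R : ℝ → S, IsEdge R ∧ R 0 = u ∧ R 1 = v ∧ R '' Icc 0 1 = c '' Icc α β ∧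
      ∀ s ∈ Ioo (0 : ℝ) 1, R s ∈ c '' Ioo α β := by
  have he := h.edge.reparam hα.le hαβ hβ.le
  rcases huv with ⟨rfl, rfl⟩ | ⟨rfl, rfl⟩
  · exact ⟨_, he, by simp, by simp, reparam_image_of_le _ hαβ.le,
      fun s hs => ⟨_, affine_mem_Ioo hαβ hs, rfl⟩⟩
  · refine ⟨_, he.reverse, by simp, by simp,
      (reverse_image _).trans (reparam_image_of_le _ hαβ.le), fun s hs => ?_⟩
    have hs' : (1 : ℝ) + (0 - 1) * s ∈ Ioo (0 : ℝ) 1 := ⟨by linarith [hs.2], by linarith [hs.1]⟩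
    exact ⟨_, affine_mem_Ioo hαβ hs', rfl⟩

end Discs

section DiscMerge

variable {S : Type*} [TopologicalSpace S]

/-- Two disjoint loops crossing a common disc, each in one half of it, can be replaced by one. -/
theorem exists_loop_of_disc [T2Space S] {V Y E : Set S} (hV : IsOpen V) (hVB : Disjoint V (Bd S))
    (hY : IsClosed Y) {ψ : ℂ → S} (hψ : IsOpenEmbedding ψ) (hψV : range ψ ⊆ V) {c₁ c₂ : ℝ → S}
    (h₁ : IsLoop c₁) (h₂ : IsLoop c₂) (hd : Disjoint (c₁ '' Icc 0 1) (c₂ '' Icc 0 1))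
    (h₁V : c₁ '' Icc 0 1 ⊆ V) (h₂V : c₂ '' Icc 0 1 ⊆ V) (h₁Y : Disjoint (c₁ '' Icc 0 1) Y)
    (h₂Y : Disjoint (c₂ '' Icc 0 1) Y) (hψY : Disjoint (ψ '' Metric.closedBall 0 1) Y) {η : ℝ}
    (hη0 : 0 < η) (hη : η < 1 / 2) (h₁0 : c₁ 0 ∈ ψ '' Metric.ball 0 1)
    (h₂0 : c₂ 0 ∈ ψ '' Metric.ball 0 1)
    (h₁o : ∀ t ∈ Icc η (1 - η), c₁ t ∉ ψ '' Metric.closedBall 0 1)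
    (h₂o : ∀ t ∈ Icc η (1 - η), c₂ t ∉ ψ '' Metric.closedBall 0 1)
    (h₁s : ∀ t ∈ Icc (0 : ℝ) 1, t ≤ η ∨ 1 - η ≤ t → c₁ t ∈ ψ '' {z | z.re < 0})
    (h₂s : ∀ t ∈ Icc (0 : ℝ) 1, t ≤ η ∨ 1 - η ≤ t → c₂ t ∈ ψ '' {z | 0 < z.re})
    (hE : IsSide E (Y ∪ c₁ '' Icc 0 1 ∪ c₂ '' Icc 0 1)) :
    ∃ δ E', IsLoop δ ∧ δ '' Icc 0 1 ⊆ V ∧ Disjoint (δ '' Icc 0 1) Y ∧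
      IsSide E' (Y ∪ δ '' Icc 0 1) ∧ SameOff V E E' := by
  set D : Set S := ψ '' Metric.closedBall 0 1 with hDdef
  set T : Set S := ψ '' Metric.sphere 0 1 with hTdef
  have hDc : IsCompact D := (isCompact_closedBall 0 1).image hψ.continuous
  have hTc : IsCompact T := (isCompact_sphere 0 1).image hψ.continuous
  have hO : IsOpen (ψ '' Metric.ball 0 1) := hψ.isOpenMap _ Metric.isOpen_ball
  have hOD : ψ '' Metric.ball 0 1 ⊆ D := image_mono Metric.ball_subset_closedBall
  have hTD : T ⊆ D := image_mono Metric.sphere_subset_closedBall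
  have hDO : D \ ψ '' Metric.ball 0 1 = T := by
    rw [hDdef, hTdef, ← image_sdiff hψ.injective, Metric.closedBall_sdiff_ball]
  obtain ⟨α₁, β₁, hα₁, hα₁η, hβ₁η, hβ₁, hα₁T, hβ₁T, ho₁⟩ :=
    h₁.exists_excursion hDc.isClosed hO hOD hη0 hη h₁0 h₁o
  obtain ⟨α₂, β₂, hα₂, hα₂η, hβ₂η, hβ₂, hα₂T, hβ₂T, ho₂⟩ :=
    h₂.exists_excursion hDc.isClosed hO hOD hη0 hη h₂0 h₂o
  rw [hDO] at hα₁T hβ₁T hα₂T hβ₂T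
  have hαβ₁ : α₁ < β₁ := by linarith
  have hαβ₂ : α₂ < β₂ := by linarith
  have hmem : ∀ {x : S} {Q : Set ℂ}, x ∈ T → x ∈ ψ '' Q → x ∈ ψ '' (Metric.sphere 0 1 ∩ Q) :=
    fun h h' => by rw [image_inter hψ.injective]; exact ⟨h, h'⟩
  have hne : ∀ {c : ℝ → S} {α β : ℝ}, IsLoop c → 0 < α → α < β → β < 1 → c α ≠ c β :=
    fun h hα hαβ hβ e => by
      have := h.edge.2 _ ⟨hα.le, (hαβ.trans hβ).le⟩ _ ⟨(hα.trans hαβ).le, hβ.le⟩ hαβ e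
      exact hα.ne' this.1
  obtain ⟨τ, t₁, t₂, t₃, hτ, hτi, h01, h12, h23, h31, hτ₁, hτ₂⟩ :=
    exists_circle_of_points hψ (hne h₁ hα₁ hαβ₁ hβ₁) (hne h₂ hα₂ hαβ₂ hβ₂)
      (hmem hα₁T (h₁s _ ⟨hα₁.le, by linarith⟩ (Or.inl hα₁η.le)))
      (hmem hβ₁T (h₁s _ ⟨by linarith, hβ₁.le⟩ (Or.inr hβ₁η.le)))
      (hmem hα₂T (h₂s _ ⟨hα₂.le, by linarith⟩ (Or.inl hα₂η.le)))
      (hmem hβ₂T (h₂s _ ⟨by linarith, hβ₂.le⟩ (Or.inr hβ₂η.le)))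
  replace hτi : τ '' Icc 0 1 = T := hτi
  obtain ⟨R₁, hR₁, hR₁0, hR₁1, hR₁i, hR₁o⟩ := h₁.exists_arc hα₁ hαβ₁ hβ₁ (u := τ t₂) (v := τ t₃)
    (hτ₁.imp id fun h => h)
  obtain ⟨R₂, hR₂, hR₂0, hR₂1, hR₂i, hR₂o⟩ := h₂.exists_arc hα₂ hαβ₂ hβ₂ (u := τ 0) (v := τ t₁)
    (hτ₂.imp id fun h => h)
  have hsub : ∀ {α β : ℝ}, 0 < α → β < 1 → Icc α β ⊆ Icc (0 : ℝ) 1 :=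
    fun hα hβ => Icc_subset_Icc hα.le hβ.le
  have hR₁c : R₁ '' Icc 0 1 ⊆ c₁ '' Icc 0 1 := hR₁i ▸ image_mono (hsub hα₁ hβ₁)
  have hR₂c : R₂ '' Icc 0 1 ⊆ c₂ '' Icc 0 1 := hR₂i ▸ image_mono (hsub hα₂ hβ₂)
  have hR₁D : ∀ s ∈ Ioo (0 : ℝ) 1, R₁ s ∉ D := fun s hs => by
    obtain ⟨t, ht, e⟩ := hR₁o s hs
    exact e ▸ ho₁ t ht
  have hR₂D : ∀ s ∈ Ioo (0 : ℝ) 1, R₂ s ∉ D := fun s hs => by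
    obtain ⟨t, ht, e⟩ := hR₂o s hs
    exact e ▸ ho₂ t ht
  have hR₁e : ∀ x ∈ R₁ '' Icc 0 1, x ∈ D → x = τ t₂ ∨ x = τ t₃ := by
    rintro _ ⟨s, hs, rfl⟩ h
    rcases eq_endpoints_or_mem_Ioo_of_mem_Icc hs with rfl | rfl | h'
    exacts [Or.inl hR₁0, Or.inr hR₁1, absurd h (hR₁D s h')]
  have hR₂e : ∀ x ∈ R₂ '' Icc 0 1, x ∈ D → x = τ 0 ∨ x = τ t₁ := by
    rintro _ ⟨s, hs, rfl⟩ h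
    rcases eq_endpoints_or_mem_Ioo_of_mem_Icc hs with rfl | rfl | h'
    exacts [Or.inl hR₂0, Or.inr hR₂1, absurd h (hR₂D s h')]
  have hτT : ∀ t ∈ Icc (0 : ℝ) 1, τ t ∈ T := fun t ht => hτi ▸ mem_image_of_mem _ ht
  have hYT : Disjoint T Y := hψY.mono_left hTD
  -- the two pieces of each loop
  let Q : (ℝ → S) → ℝ → ℝ → Set S := fun c α β => c '' Icc 0 α ∪ c '' Icc β 1
  have hsplit : ∀ {c R : ℝ → S} {α β : ℝ}, 0 < α → α < β → β < 1 → R '' Icc 0 1 = c '' Icc α β →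
      c '' Icc 0 1 = R '' Icc 0 1 ∪ Q c α β := fun {c R α β} hα hαβ hβ e => by
    rw [e, ← Icc_union_Icc_eq_Icc hα.le (hαβ.trans hβ).le,
      ← Icc_union_Icc_eq_Icc hαβ.le hβ.le, image_union, image_union]
    simp only [Q]
    ac_rfl
  have hQinter : ∀ {c R : ℝ → S} {α β : ℝ}, IsLoop c → 0 < α → α < β → β < 1 → c α ∈ T → c β ∈ T →
      R '' Icc 0 1 = c '' Icc α β → R '' Icc 0 1 ∩ Q c α β ⊆ T := by
    rintro c R α β hc hα hαβ hβ hαT hβT e x ⟨h, h'⟩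
    rw [e] at h
    obtain ⟨s, hs, rfl⟩ := h
    have hs1 : s ∈ Icc (0 : ℝ) 1 := hsub hα hβ hs
    rcases h' with ⟨t, ht, e'⟩ | ⟨t, ht, e'⟩
    · rcases hc.eq_or hs1 ⟨ht.1, by linarith [ht.2]⟩ e'.symm with h | h | h
      · rwa [show s = α by linarith [hs.1, ht.2]]
      · linarith [hs.1]
      · linarith [hs.2]
    · rcases hc.eq_or hs1 ⟨by linarith [ht.1], ht.2⟩ e'.symm with h | h | h
      · rwa [show s = β by linarith [hs.2, ht.1]]
      · linarith [hs.1]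
      · linarith [hs.2]
  have hQc : ∀ {c : ℝ → S} {α β : ℝ}, IsLoop c → 0 < α → α < β → β < 1 → IsCompact (Q c α β) :=
    fun hc hα hαβ hβ =>
      (isCompact_Icc.image_of_continuousOn
        (hc.edge.1.mono (Icc_subset_Icc_right (hαβ.trans hβ).le))).union
      (isCompact_Icc.image_of_continuousOn
        (hc.edge.1.mono (Icc_subset_Icc_left (hα.trans hαβ).le)))
  have hQr : ∀ {c : ℝ → S} {α β : ℝ} {H : Set ℂ}, α < η → 1 - η < β → 0 < α → β < 1 →
      (∀ t ∈ Icc (0 : ℝ) 1, t ≤ η ∨ 1 - η ≤ t → c t ∈ ψ '' H) → Q c α β ⊆ range ψ := by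
    rintro c α β H hα hβ hα0 hβ1 h _ (⟨t, ht, rfl⟩ | ⟨t, ht, rfl⟩)
    · exact image_subset_range _ _ (h t ⟨ht.1, by linarith [ht.2]⟩ (Or.inl (ht.2.trans hα.le)))
    · exact image_subset_range _ _ (h t ⟨by linarith [ht.1], ht.2⟩ (Or.inr (hβ.le.trans ht.1)))
  set X₁ : Set S := Y ∪ R₁ '' Icc 0 1 ∪ R₂ '' Icc 0 1 with hX₁
  set X₂ : Set S := Q c₁ α₁ β₁ ∪ Q c₂ α₂ β₂ with hX₂
  have hX₁c : IsClosed X₁ := (hY.union hR₁.isClosed_image).union hR₂.isClosed_image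
  have hX₂c : IsCompact X₂ := (hQc h₁ hα₁ hαβ₁ hβ₁).union (hQc h₂ hα₂ hαβ₂ hβ₂)
  have hX₂r : X₂ ⊆ range ψ :=
    union_subset (hQr hα₁η hβ₁η hα₁ hβ₁ h₁s) (hQr hα₂η hβ₂η hα₂ hβ₂ h₂s)
  obtain ⟨M, hM1, hM⟩ : ∃ M : ℝ, 1 ≤ M ∧ X₂ ⊆ ψ '' Metric.closedBall 0 M := by
    obtain ⟨M, hM⟩ :=
      ((hψ.isInducing.isCompact_preimage_iff hX₂r).2 hX₂c).isBounded.subset_closedBall 0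
    refine ⟨max M 1, le_max_right _ _, fun x hx => ?_⟩
    obtain ⟨z, rfl⟩ := hX₂r hx
    exact ⟨z, Metric.closedBall_subset_closedBall (le_max_left _ _) (hM hx), rfl⟩
  have hQ₁ : Q c₁ α₁ β₁ ⊆ c₁ '' Icc 0 1 := by
    rw [hsplit hα₁ hαβ₁ hβ₁ hR₁i]
    exact subset_union_right
  have hQ₂ : Q c₂ α₂ β₂ ⊆ c₂ '' Icc 0 1 := by
    rw [hsplit hα₂ hαβ₂ hβ₂ hR₂i]
    exact subset_union_right
  have hX₁₂ : X₁ ∩ X₂ ⊆ T := by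
    rintro x ⟨(h | h) | h, h' | h'⟩
    · exact absurd h (disjoint_left.1 h₁Y (hQ₁ h'))
    · exact absurd h (disjoint_left.1 h₂Y (hQ₂ h'))
    · exact hQinter h₁ hα₁ hαβ₁ hβ₁ hα₁T hβ₁T hR₁i ⟨h, h'⟩
    · exact absurd (hQ₂ h') (disjoint_left.1 hd (hR₁c h))
    · exact absurd (hR₂c h) (disjoint_left.1 hd (hQ₁ h'))
    · exact hQinter h₂ hα₂ hαβ₂ hβ₂ hα₂T hβ₂T hR₂i ⟨h, h'⟩
  have hEX : IsSide E (X₁ ∪ X₂) := by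
    convert hE using 1
    rw [hsplit hα₁ hαβ₁ hβ₁ hR₁i, hsplit hα₂ hαβ₂ hβ₂ hR₂i, hX₁, hX₂]
    ac_rfl
  have hTp : IsPreconnected T :=
    hτi ▸ isPreconnected_Icc.image _ hτ.edge.1
  have hTV : T ⊆ V := (image_subset_range _ _).trans hψV
  obtain ⟨E₁, hE₁, hs₁⟩ := IsSide.surgery_sameOff hψ hX₁c hX₂c.isClosed
    (hX₁c.union hTc.isClosed) hM subset_union_left hTp hX₁₂
    (subset_inter subset_union_right (hTD.trans (image_mono
      (Metric.closedBall_subset_closedBall hM1)))) hEX hψV hTc hTV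
    (union_subset (subset_union_left.trans subset_union_left) subset_union_right)
  have hX₁D : ∀ x ∈ X₁, x ∈ D → x = τ t₂ ∨ x = τ t₃ ∨ x = τ 0 ∨ x = τ t₁ := by
    rintro x ((h | h) | h) hxD
    · exact absurd h (disjoint_left.1 hψY hxD)
    · exact (hR₁e x h hxD).imp id Or.inl
    · exact Or.inr (Or.inr (hR₂e x h hxD))
  have hX₁O : Disjoint X₁ (ψ '' Metric.ball 0 1) := by
    refine disjoint_left.2 fun x hx hxO => ?_
    have hxT : x ∉ T := fun h => (hDO ▸ h : x ∈ D \ ψ '' Metric.ball 0 1).2 hxO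
    rcases hX₁D x hx (hOD hxO) with rfl | rfl | rfl | rfl
    · exact hxT (hτT _ ⟨by linarith, by linarith⟩)
    · exact hxT (hτT _ ⟨by linarith, by linarith⟩)
    · exact hxT (hτT _ ⟨by linarith, by linarith⟩)
    · exact hxT (hτT _ ⟨by linarith, by linarith⟩)
  have hIoo : Ioo t₁ t₂ ⊆ Icc (0 : ℝ) 1 := fun t ht => ⟨by linarith [ht.1], by linarith [ht.2]⟩
  have hJX₁ : Disjoint (τ '' Ioo t₁ t₂) X₁ := by
    refine disjoint_left.2 ?_
    rintro _ ⟨t, ht, rfl⟩ hx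
    have key : ∀ s ∈ Icc (0 : ℝ) 1, τ t = τ s → s = t := fun s hs e => by
      rcases hτ.eq_or (hIoo ht) hs e with h | h | h
      · exact h.symm
      · linarith [ht.1]
      · linarith [ht.2]
    rcases hX₁D _ hx (hTD (hτT t (hIoo ht))) with e | e | e | e
    · linarith [key t₂ ⟨by linarith, by linarith⟩ e, ht.2]
    · linarith [key t₃ ⟨by linarith, by linarith⟩ e, ht.2]
    · linarith [key 0 ⟨by linarith, by linarith⟩ e, ht.1]
    · linarith [key t₁ ⟨by linarith, by linarith⟩ e, ht.1]
  obtain ⟨E₂, hE₂, hess, hs₂⟩ := IsSide.exists_essential hψ hX₁c hX₁O hE₁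
    (isPreconnected_Ioo.image _ (hτ.edge.1.mono hIoo))
    (by rintro _ ⟨t, ht, rfl⟩; exact hτT t (hIoo ht)) hJX₁
  have hs₂' : SameOff V E₁ E₂ := ⟨D, hDc, (image_subset_range _ _).trans hψV, hs₂⟩
  obtain ⟨δ, E₃, hδ, hδV, hδY, hE₃, hs₃⟩ := exists_loop_of_chords hV hVB hY hτ h01 h12 h23 h31 hR₁ hR₂
    hR₁0 hR₁1 hR₂0 hR₂1 (fun s hs h => hR₁D s hs (hTD (hτi ▸ h)))
    (fun s hs h => hR₂D s hs (hTD (hτi ▸ h))) (hd.mono hR₁c hR₂c) (hτi ▸ hTV) (hR₁c.trans h₁V)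
    (hR₂c.trans h₂V) (hτi ▸ hYT) (h₁Y.mono_left hR₁c) (h₂Y.mono_left hR₂c) (by rw [hτi]; exact hE₂)
    (by rw [hτi]; exact hess)
  exact ⟨δ, E₃, hδ, hδV, hδY, hE₃, (hs₁.trans hs₂').trans hs₃⟩

end DiscMerge

section ThinDiscs

variable {S : Type*} [TopologicalSpace S]

/-- The affine map of the plane that carries the unit disc to a thin ellipse around the segment
from `m - h` to `m + h`. -/
noncomputable def ellipseHomeo (m h : ℂ) (hh : h ≠ 0) {r : ℝ} (hr : 0 < r) : ℂ ≃ₜ ℂ where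
  toFun w := m + h * (((1 + r) * w.re : ℝ) + ((r * w.im : ℝ) : ℂ) * Complex.I)
  invFun z := (((z - m) / h).re / (1 + r) : ℝ) + (((z - m) / h).im / r : ℝ) * Complex.I
  left_inv w := by
    have h1 : (1 + r) ≠ 0 := by positivity
    beta_reduce
    rw [add_sub_cancel_left, mul_div_cancel_left₀ _ hh]
    apply Complex.ext
    · simp only [Complex.add_re, Complex.mul_re, Complex.I_re, Complex.I_im, Complex.ofReal_re,
        Complex.ofReal_im]
      field_simp
      ring
    · simp only [Complex.add_im, Complex.mul_im, Complex.I_re, Complex.I_im, Complex.ofReal_re,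
        Complex.ofReal_im]
      field_simp
      ring
  right_inv z := by
    have h1 : (1 + r) ≠ 0 := by positivity
    have h2 : z = m + h * ((z - m) / h) := by field_simp; ring
    conv_rhs => rw [h2]
    beta_reduce
    congr 2
    apply Complex.ext
    · simp only [Complex.add_re, Complex.add_im, Complex.mul_re, Complex.mul_im, Complex.I_re,
        Complex.I_im, Complex.ofReal_re, Complex.ofReal_im]
      field_simp
      ring
    · simp only [Complex.add_re, Complex.add_im, Complex.mul_re, Complex.mul_im, Complex.I_re,
        Complex.I_im, Complex.ofReal_re, Complex.ofReal_im]
      field_simp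
      ring
  continuous_toFun := by fun_prop
  continuous_invFun := by fun_prop

theorem exists_disjoint_nearest {P Q : Set ℂ} (hP : IsClosed P) (hQ : IsClosed Q) (hPQ : Disjoint P Q)
    (hP' : P.Nonempty) (hQ' : Q.Nonempty) : ∃ z ∈ P, ∃ w ∈ Q, z ≠ w ∧
      ∀ x ∈ segment ℝ z w, (x ∈ P → x = z) ∧ (x ∈ Q → x = w) := by
  obtain ⟨a, ha⟩ := hP'
  obtain ⟨b, hb⟩ := hQ'
  have hseg : IsCompact (segment ℝ a b) := by
    rw [segment_eq_image_lineMap]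
    exact isCompact_Icc.image AffineMap.lineMap_continuous
  obtain ⟨⟨z, w⟩, ⟨⟨hz, hzP⟩, hw, hwQ⟩, hmin⟩ := ((hseg.inter_right hP).prod
    (hseg.inter_right hQ)).exists_isMinOn ⟨(a, b), ⟨left_mem_segment ℝ a b, ha⟩,
      right_mem_segment ℝ a b, hb⟩ (f := fun p : ℂ × ℂ => dist p.1 p.2) (by fun_prop)
  have hzw : z ≠ w := fun e => disjoint_left.1 hPQ hzP (e ▸ hwQ)
  have hd : 0 < dist z w := dist_pos.2 hzw
  refine ⟨z, hzP, w, hwQ, hzw, fun x hx => ?_⟩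
  have hx' : x ∈ segment ℝ a b := (convex_segment a b).segment_subset hz hw hx
  rw [segment_eq_image_lineMap] at hx
  obtain ⟨t, ht, rfl⟩ := hx
  constructor
  · intro h
    have h1 : dist z w ≤ dist (AffineMap.lineMap z w t) w := hmin (a := (_, w)) ⟨⟨hx', h⟩, hw, hwQ⟩
    rw [dist_lineMap_right, Real.norm_of_nonneg (by linarith [ht.2])] at h1
    have h2 : t = 0 := by nlinarith [ht.1]
    simp [h2]
  · intro h
    have h1 : dist z w ≤ dist z (AffineMap.lineMap z w t) := hmin (a := (z, _)) ⟨⟨hz, hzP⟩, hx', h⟩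
    rw [dist_left_lineMap, Real.norm_of_nonneg ht.1] at h1
    have h2 : t = 1 := by nlinarith [ht.2]
    simp [h2]

theorem IsLoop.exists_strands {c : ℝ → S} (h : IsLoop c) {O : Set S} (hO : IsOpen O) (h0 : c 0 ∈ O) :
    ∃ η, 0 < η ∧ η < 1 / 2 ∧ ∀ t ∈ Icc (0 : ℝ) 1, t ≤ η ∨ 1 - η ≤ t → c t ∈ O := by
  have hc0 := Metric.mem_nhdsWithin_iff.1 (h.edge.1 0 (by simp) (hO.mem_nhds h0))
  have hc1 := Metric.mem_nhdsWithin_iff.1 (h.edge.1 1 (by simp) (hO.mem_nhds (h.closed ▸ h0)))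
  obtain ⟨ε₀, hε₀, h₀⟩ := hc0
  obtain ⟨ε₁, hε₁, h₁⟩ := hc1
  have h2 : 0 < min (min ε₀ ε₁) (1 / 2) := by positivity
  have h3 : min (min ε₀ ε₁) (1 / 2) ≤ ε₀ := (min_le_left _ _).trans (min_le_left _ _)
  have h4 : min (min ε₀ ε₁) (1 / 2) ≤ ε₁ := (min_le_left _ _).trans (min_le_right _ _)
  have h5 : min (min ε₀ ε₁) (1 / 2) ≤ (1 : ℝ) / 2 := min_le_right _ _
  refine ⟨min (min ε₀ ε₁) (1 / 2) / 2, by linarith, by linarith, fun t ht h' => ?_⟩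
  rcases h' with h' | h'
  · refine h₀ ⟨?_, ht⟩
    rw [Metric.mem_ball, Real.dist_eq, sub_zero, abs_of_nonneg ht.1]
    linarith
  · refine h₁ ⟨?_, ht⟩
    rw [Metric.mem_ball, Real.dist_eq, abs_sub_comm, abs_of_nonneg (by linarith [ht.2])]
    linarith

/-- Two disjoint loops joined by an arc in a chart can be replaced by one. -/
theorem exists_loop_of_segment [T2Space S] {V Y E : Set S} (hV : IsOpen V) (hVB : Disjoint V (Bd S))
    (hY : IsClosed Y) {φ : ℂ → S} (hφ : IsOpenEmbedding φ) (hφV : range φ ⊆ V) {c₁ c₂ : ℝ → S}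
    (h₁ : IsLoop c₁) (h₂ : IsLoop c₂) (hd : Disjoint (c₁ '' Icc 0 1) (c₂ '' Icc 0 1))
    (h₁V : c₁ '' Icc 0 1 ⊆ V) (h₂V : c₂ '' Icc 0 1 ⊆ V) (h₁Y : Disjoint (c₁ '' Icc 0 1) Y)
    (h₂Y : Disjoint (c₂ '' Icc 0 1) Y) {z₁ z₂ : ℂ} (hz : z₁ ≠ z₂) (hz₁ : c₁ 0 = φ z₁)
    (hz₂ : c₂ 0 = φ z₂) (hs₁ : ∀ z ∈ segment ℝ z₁ z₂, φ z ∈ c₁ '' Icc 0 1 → z = z₁)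
    (hs₂ : ∀ z ∈ segment ℝ z₁ z₂, φ z ∈ c₂ '' Icc 0 1 → z = z₂)
    (hsY : ∀ z ∈ segment ℝ z₁ z₂, φ z ∉ Y) (hE : IsSide E (Y ∪ c₁ '' Icc 0 1 ∪ c₂ '' Icc 0 1)) :
    ∃ δ E', IsLoop δ ∧ δ '' Icc 0 1 ⊆ V ∧ Disjoint (δ '' Icc 0 1) Y ∧
      IsSide E' (Y ∪ δ '' Icc 0 1) ∧ SameOff V E E' := by
  set m : ℂ := (z₁ + z₂) / 2 with hm
  set h : ℂ := (z₂ - z₁) / 2 with hh'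
  have hh : h ≠ 0 := div_ne_zero (sub_ne_zero.2 hz.symm) two_ne_zero
  have hm₁ : (z₁ - m) / h = -1 := by
    rw [div_eq_iff hh, hm, hh']
    ring
  have hm₂ : (z₂ - m) / h = 1 := by
    rw [div_eq_iff hh, hm, hh']
    ring
  let f : ℂ → ℝ := fun z => ((z - m) / h).re
  have hf : Continuous f := by fun_prop
  obtain ⟨η₁, hη₁, hη₁', ho₁⟩ := h₁.exists_strands (O := φ '' {z | f z < 0})
    (hφ.isOpenMap _ (isOpen_lt hf continuous_const)) ⟨z₁, by simp [f, hm₁], hz₁.symm⟩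
  obtain ⟨η₂, hη₂, hη₂', ho₂⟩ := h₂.exists_strands (O := φ '' {z | 0 < f z})
    (hφ.isOpenMap _ (isOpen_lt continuous_const hf)) ⟨z₂, by simp [f, hm₂], hz₂.symm⟩
  set η := min η₁ η₂ with hη
  have hη0 : 0 < η := lt_min hη₁ hη₂
  have hηl : η ≤ η₁ := min_le_left _ _
  have hηr : η ≤ η₂ := min_le_right _ _
  have hηh : η < 1 / 2 := by linarith
  set F := Y ∪ c₁ '' Icc η (1 - η) ∪ c₂ '' Icc η (1 - η) with hF
  have hFc : IsClosed F := (hY.union (h₁.edge.isClosed_image_Icc hη0.le (by linarith))).union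
    (h₂.edge.isClosed_image_Icc hη0.le (by linarith))
  have hmid : ∀ {c : ℝ → S} {t : ℝ}, IsLoop c → t ∈ Icc η (1 - η) → c t ≠ c 0 := fun hc ht e => by
    rcases hc.eq_or ⟨by linarith [ht.1], by linarith [ht.2]⟩ (by simp) e with e | e | e
    · linarith [ht.1]
    · linarith [ht.1]
    · linarith [ht.2]
  have hFs : segment ℝ z₁ z₂ ⊆ (φ ⁻¹' F)ᶜ := by
    rintro z hzs ((h' | ⟨t, ht, e⟩) | ⟨t, ht, e⟩)
    · exact hsY z hzs h'
    · have := hs₁ z hzs (e ▸ mem_image_of_mem _ ⟨by linarith [ht.1], by linarith [ht.2]⟩)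
      exact hmid h₁ ht (by rw [e, this, hz₁])
    · have := hs₂ z hzs (e ▸ mem_image_of_mem _ ⟨by linarith [ht.1], by linarith [ht.2]⟩)
      exact hmid h₂ ht (by rw [e, this, hz₂])
  have hseg : IsCompact (segment ℝ z₁ z₂) := by
    rw [segment_eq_image_lineMap]
    exact isCompact_Icc.image AffineMap.lineMap_continuous
  obtain ⟨ε, hε, hεF⟩ := hseg.exists_cthickening_subset_open
    (hFc.preimage hφ.continuous).isOpen_compl hFs
  have hhn : 0 < ‖h‖ := norm_pos_iff.2 hh
  set r : ℝ := ε / (2 * ‖h‖) with hr'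
  have hr : 0 < r := by positivity
  have hrε : ‖h‖ * (r + r) = ε := by rw [hr']; field_simp; ring
  set ψ : ℂ → S := φ ∘ ellipseHomeo m h hh hr with hψdef
  have hψ : IsOpenEmbedding ψ := hφ.comp (ellipseHomeo m h hh hr).isOpenEmbedding
  have hψe : ∀ w, ψ w = φ (m + h * (((1 + r) * w.re : ℝ) + ((r * w.im : ℝ) : ℂ) * Complex.I)) :=
    fun w => rfl
  have hψf : ∀ z, ∃ w, φ z = ψ w ∧ f z = (1 + r) * w.re := fun z => by
    obtain ⟨w, rfl⟩ := (ellipseHomeo m h hh hr).surjective z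
    refine ⟨w, rfl, ?_⟩
    change ((m + h * (((1 + r) * w.re : ℝ) + ((r * w.im : ℝ) : ℂ) * Complex.I) - m) / h).re = _
    rw [add_sub_cancel_left, mul_div_cancel_left₀ _ hh]
    simp
  have hψF : Disjoint (ψ '' Metric.closedBall 0 1) F := by
    refine disjoint_left.2 ?_
    rintro _ ⟨w, hw, rfl⟩ hF'
    rw [mem_closedBall_zero_iff] at hw
    have hre := abs_le.1 ((Complex.abs_re_le_norm w).trans hw)
    refine hεF (a := m + h * (((1 + r) * w.re : ℝ) + ((r * w.im : ℝ) : ℂ) * Complex.I)) ?_ hF'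
    refine Metric.mem_cthickening_of_dist_le _ (m + h * (w.re : ℂ)) _ _ ?_ ?_
    · refine ⟨(1 - w.re) / 2, (1 + w.re) / 2, by linarith [hre.2], by linarith [hre.1], by ring, ?_⟩
      simp only [Complex.real_smul, hm, hh']
      push_cast
      ring
    · rw [dist_eq_norm]
      have : m + h * (((1 + r) * w.re : ℝ) + ((r * w.im : ℝ) : ℂ) * Complex.I) -
          (m + h * (w.re : ℂ)) = h * ((r * w.re : ℝ) + ((r * w.im : ℝ) : ℂ) * Complex.I) := by
        push_cast
        ring
      rw [this, norm_mul, ← hrε]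
      gcongr
      refine (norm_add_le _ _).trans (add_le_add ?_ ?_)
      · rw [Complex.norm_real, Real.norm_eq_abs, abs_mul, abs_of_pos hr]
        exact mul_le_of_le_one_right hr.le ((Complex.abs_re_le_norm w).trans hw)
      · rw [norm_mul, Complex.norm_I, mul_one, Complex.norm_real, Real.norm_eq_abs, abs_mul,
          abs_of_pos hr]
        exact mul_le_of_le_one_right hr.le ((Complex.abs_im_le_norm w).trans hw)
  have hψV : range ψ ⊆ V := (range_comp_subset_range _ _).trans hφV
  have hball : ∀ a : ℝ, |a| = 1 → φ (m + h * (a : ℂ)) ∈ ψ '' Metric.ball 0 1 := fun a ha => by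
    refine ⟨((a / (1 + r) : ℝ) : ℂ), ?_, ?_⟩
    · rw [mem_ball_zero_iff, Complex.norm_real, Real.norm_eq_abs, abs_div, ha,
        abs_of_pos (by positivity), div_lt_one (by positivity)]
      linarith
    · have h1 : (1 + r) ≠ 0 := by positivity
      rw [hψe, Complex.ofReal_re, Complex.ofReal_im, mul_zero, Complex.ofReal_zero, zero_mul,
        add_zero, mul_div_cancel₀ _ h1]
  refine exists_loop_of_disc hV hVB hY hψ hψV h₁ h₂ hd h₁V h₂V h₁Y h₂Y
    (hψF.mono_right (subset_union_left.trans subset_union_left)) hη0 hηh ?_ ?_ ?_ ?_ ?_ ?_ hE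
  · have := hball (-1) (by simp)
    rwa [show m + h * ((-1 : ℝ) : ℂ) = z₁ by rw [hm, hh']; push_cast; ring, ← hz₁] at this
  · have := hball 1 (by simp)
    rwa [show m + h * ((1 : ℝ) : ℂ) = z₂ by rw [hm, hh']; push_cast; ring, ← hz₂] at this
  · exact fun t ht h' => disjoint_left.1 hψF h' (Or.inl (Or.inr (mem_image_of_mem _ ht)))
  · exact fun t ht h' => disjoint_left.1 hψF h' (Or.inr (mem_image_of_mem _ ht))
  · intro t ht h'
    obtain ⟨z, hz', e⟩ := ho₁ t ht (h'.imp (fun h => h.trans hηl) fun h => by linarith)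
    obtain ⟨w, hw, hw'⟩ := hψf z
    refine ⟨w, ?_, by rw [← hw, e]⟩
    have h3 : (1 + r) * w.re < 0 := hw' ▸ hz'
    show w.re < 0
    by_contra h4
    exact absurd h3 (not_lt.2 (mul_nonneg (by positivity) (not_lt.1 h4)))
  · intro t ht h'
    obtain ⟨z, hz', e⟩ := ho₂ t ht (h'.imp (fun h => h.trans hηr) fun h => by linarith)
    obtain ⟨w, hw, hw'⟩ := hψf z
    refine ⟨w, ?_, by rw [← hw, e]⟩
    have h3 : 0 < (1 + r) * w.re := hw' ▸ hz'
    exact pos_of_mul_pos_right h3 (by positivity)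

end ThinDiscs

/-! ### Moving a loop into a chart -/

section Moving

/-- A homeomorphism of the plane moving one point to another, supported in a ball. -/
theorem exists_homeomorph_move (a b : ℂ) :
    ∃ (g : ℂ ≃ₜ ℂ) (R : ℝ), g a = b ∧ ∀ z ∉ Metric.closedBall a R, g z = z := by
  set R : ℝ := 2 * ‖b - a‖ + 1 with hR
  have hR0 : 0 < R := by positivity
  let u : ℂ → ℝ := fun z => max (1 - ‖z - a‖ / R) 0
  let f : ℂ → ℂ := fun z => z + (u z : ℂ) * (b - a)
  have hu : ∀ z w, |u z - u w| ≤ ‖z - w‖ / R := fun z w => by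
    refine (abs_max_sub_max_le_abs _ _ _).trans ?_
    rw [sub_sub_sub_cancel_left, ← sub_div, abs_div, abs_of_pos hR0]
    refine div_le_div_of_nonneg_right ?_ hR0.le
    have := abs_norm_sub_norm_le (w - a) (z - a)
    rwa [sub_sub_sub_cancel_right, norm_sub_rev w z] at this
  have hf : ApproximatesLinearOn f (ContinuousLinearEquiv.refl ℝ ℂ : ℂ →L[ℝ] ℂ) univ (1 / 2) := by
    intro z _ w _
    have h1 : f z - f w - (ContinuousLinearEquiv.refl ℝ ℂ : ℂ →L[ℝ] ℂ) (z - w) =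
        ((u z - u w : ℝ) : ℂ) * (b - a) := by
      simp only [f, ContinuousLinearEquiv.coe_refl, ContinuousLinearMap.coe_id', id_eq]
      push_cast
      ring
    rw [h1, norm_mul, Complex.norm_real, Real.norm_eq_abs]
    have h2 : ‖b - a‖ / R ≤ 1 / 2 := by
      rw [div_le_iff₀ hR0, hR]
      linarith
    calc |u z - u w| * ‖b - a‖ ≤ ‖z - w‖ / R * ‖b - a‖ := by gcongr; exact hu z w
      _ = ‖b - a‖ / R * ‖z - w‖ := by ring
      _ ≤ 1 / 2 * ‖z - w‖ := by gcongr
      _ = _ := by norm_num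
  have hc : Subsingleton ℂ ∨ (1 / 2 : NNReal) <
      ‖((ContinuousLinearEquiv.refl ℝ ℂ).symm : ℂ →L[ℝ] ℂ)‖₊⁻¹ := by
    right
    have : ‖((ContinuousLinearEquiv.refl ℝ ℂ).symm : ℂ →L[ℝ] ℂ)‖₊ = 1 :=
      NNReal.eq ContinuousLinearMap.norm_id
    rw [this, inv_one]
    exact NNReal.half_lt_self one_ne_zero
  refine ⟨hf.toHomeomorph f hc, R, ?_, fun z hz => ?_⟩
  · change f a = b
    simp [f, u]
  · change f z = z
    rw [mem_closedBall_iff_norm, not_le] at hz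
    have : u z = 0 := max_eq_right (by rw [sub_nonpos, one_le_div hR0]; exact hz.le)
    simp [f, this]

variable {S : Type*}

open Classical in
/-- The extension by the identity of a self-map of a chart. -/
noncomputable def extendChart (φ : ℂ → S) (g : ℂ → ℂ) (x : S) : S :=
  if x ∈ range φ then φ (g (Function.invFun φ x)) else x

theorem extendChart_apply {φ : ℂ → S} (hφ : Function.Injective φ) (g : ℂ → ℂ) (z : ℂ) :
    extendChart φ g (φ z) = φ (g z) := by
  rw [extendChart, if_pos (mem_range_self z), Function.leftInverse_invFun hφ z]

theorem extendChart_of_notMem {φ : ℂ → S} (g : ℂ → ℂ) {x : S} (hx : x ∉ range φ) :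
    extendChart φ g x = x := if_neg hx

variable [TopologicalSpace S]

theorem continuous_extendChart [T2Space S] {φ : ℂ → S} (hφ : IsOpenEmbedding φ) {g : ℂ → ℂ}
    (hg : Continuous g) {K : Set ℂ} (hK : IsCompact K) (hgK : ∀ z ∉ K, g z = z) :
    Continuous (extendChart φ g) := by
  refine continuous_iff_continuousAt.2 fun x => ?_
  by_cases hx : x ∈ range φ
  · obtain ⟨z, rfl⟩ := hx
    rw [← hφ.continuousAt_iff]
    have : extendChart φ g ∘ φ = φ ∘ g := funext fun z => extendChart_apply hφ.injective g z
    rw [this]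
    exact (hφ.continuous.comp hg).continuousAt
  · have hx' : x ∈ (φ '' K)ᶜ := fun h => hx (image_subset_range _ _ h)
    refine continuousAt_id.congr (Filter.eventuallyEq_of_mem
      ((hK.image hφ.continuous).isClosed.isOpen_compl.mem_nhds hx') fun y hy => ?_)
    by_cases hy' : y ∈ range φ
    · obtain ⟨z, rfl⟩ := hy'
      rw [extendChart_apply hφ.injective, hgK z fun h => hy (mem_image_of_mem _ h), id]
    · rw [extendChart_of_notMem g hy', id]

/-- A homeomorphism moving one point of a chart to another. -/
theorem exists_homeomorph_chart [T2Space S] {φ : ℂ → S} (hφ : IsOpenEmbedding φ) (a b : ℂ) :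
    ∃ (H : S ≃ₜ S) (D : Set S), IsCompact D ∧ D ⊆ range φ ∧ H (φ a) = φ b ∧ ∀ x ∉ D, H x = x := by
  obtain ⟨g, R, hg, hgR⟩ := exists_homeomorph_move a b
  have hK := isCompact_closedBall a R
  have hgR' : ∀ z ∉ Metric.closedBall a R, g.symm z = z := fun z hz => by
    rw [Homeomorph.symm_apply_eq, hgR z hz]
  have hinv : ∀ {g g' : ℂ → ℂ}, Function.LeftInverse g' g →
      Function.LeftInverse (extendChart φ g') (extendChart φ g) := fun {g g'} h x => by
    by_cases hx : x ∈ range φ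
    · obtain ⟨z, rfl⟩ := hx
      rw [extendChart_apply hφ.injective, extendChart_apply hφ.injective, h]
    · rw [extendChart_of_notMem g hx, extendChart_of_notMem g' hx]
  refine ⟨⟨⟨extendChart φ g, extendChart φ g.symm, hinv g.left_inv, hinv g.right_inv⟩,
    continuous_extendChart hφ g.continuous hK hgR,
    continuous_extendChart hφ g.symm.continuous hK hgR'⟩, φ '' Metric.closedBall a R,
    hK.image hφ.continuous, image_subset_range _ _, ?_, fun x hx => ?_⟩
  · change extendChart φ g (φ a) = φ b
    rw [extendChart_apply hφ.injective, hg]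
  · change extendChart φ g x = x
    by_cases hx' : x ∈ range φ
    · obtain ⟨z, rfl⟩ := hx'
      rw [extendChart_apply hφ.injective, hgR z fun h => hx (mem_image_of_mem _ h)]
    · exact extendChart_of_notMem g hx'

theorem IsLoop.homeomorph {c : ℝ → S} (h : IsLoop c) (H : S ≃ₜ S) : IsLoop fun t => H (c t) :=
  ⟨⟨H.continuous.comp_continuousOn h.edge.1, fun s hs t ht hst e =>
    h.edge.2 s hs t ht hst (H.injective e)⟩, congrArg H h.closed⟩

theorem IsSide.homeomorph {E X : Set S} (h : IsSide E X) (H : S ≃ₜ S) :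
    IsSide (H '' E) (H '' X) :=
  ⟨H.isOpenMap _ h.1, (disjoint_image_iff H.injective).2 h.2.1,
    image_union H E X ▸ H.isClosedMap _ h.2.2⟩

end Moving

section Loops

variable {S : Type*}

theorem support_option (γ : ι → ℝ → S) (δ : ℝ → S) :
    support (fun o : Option ι => o.elim δ γ) = support γ ∪ δ '' Icc 0 1 := by
  simp only [support, iUnion_option, Option.elim_none, Option.elim_some, union_comm]

variable [TopologicalSpace S]

/-- A family of disjoint loops in `V`. -/
structure IsLoopSystem {ι : Type*} (V : Set S) (γ : ι → ℝ → S) : Prop where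
  loop : ∀ i, IsLoop (γ i)
  subset : ∀ i, γ i '' Icc 0 1 ⊆ V
  disj : ∀ i j, i ≠ j → Disjoint (γ i '' Icc 0 1) (γ j '' Icc 0 1)

namespace IsLoopSystem

variable {ι : Type*} {V : Set S} {γ : ι → ℝ → S}

theorem isSystem (h : IsLoopSystem V γ) : IsSystem V γ := by
  refine ⟨fun i => (h.loop i).edge, h.subset, fun i j hij s hs t ht e =>
    absurd (mem_image_of_mem _ ht) (e ▸ disjoint_left.1 (h.disj i j hij) (mem_image_of_mem _ hs)),
    fun v => ?_⟩
  have hend : ∀ e : ι × Bool, endp γ e ∈ γ e.1 '' Icc 0 1 := fun e =>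
    mem_image_of_mem _ (by split_ifs <;> simp)
  rcases {e : ι × Bool | endp γ e = v}.eq_empty_or_nonempty with h0 | ⟨e, he⟩
  · rw [h0]
    simp
  · have hsub : {e : ι × Bool | endp γ e = v} ⊆ {(e.1, true), (e.1, false)} := fun e' he' => by
      have h1 : e'.1 = e.1 := by
        by_contra hne
        have he1 : endp γ e = v := he
        have he2 : endp γ e' = v := he'
        exact disjoint_left.1 (h.disj _ _ hne) (hend e') (he2.trans he1.symm ▸ hend e)
      obtain ⟨i, b⟩ := e'
      obtain rfl : i = e.1 := h1
      cases b <;> simp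
    exact (ncard_le_ncard hsub (toFinite _)).trans ((ncard_pair (by simp)).trans_le (by norm_num))

theorem comp {κ : Type*} (h : IsLoopSystem V γ) {f : κ → ι} (hf : Function.Injective f) :
    IsLoopSystem V fun k => γ (f k) :=
  ⟨fun _ => h.loop _, fun _ => h.subset _, fun _ _ hij => h.disj _ _ (hf.ne hij)⟩

theorem disjoint_support (h : IsLoopSystem V γ) (i : ι) :
    Disjoint (γ i '' Icc 0 1) (support fun j : {j // j ≠ i} => γ j) :=
  disjoint_iUnion_right.2 fun j => h.disj i j j.2.symm

theorem option (h : IsLoopSystem V γ) {δ : ℝ → S} (hδ : IsLoop δ) (hδV : δ '' Icc 0 1 ⊆ V)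
    (hδγ : Disjoint (δ '' Icc 0 1) (support γ)) :
    IsLoopSystem V fun o : Option ι => o.elim δ γ := by
  have hd : ∀ i, Disjoint (δ '' Icc 0 1) (γ i '' Icc 0 1) := disjoint_iUnion_right.1 hδγ
  refine ⟨?_, ?_, ?_⟩
  · rintro (_ | i)
    exacts [hδ, h.loop i]
  · rintro (_ | i)
    exacts [hδV, h.subset i]
  · rintro (_ | i) (_ | j) hij
    exacts [absurd rfl hij, hd j, (hd i).symm, h.disj i j fun e => hij (e ▸ rfl)]

end IsLoopSystem

end Loops

section Existence

variable {S : Type*} [TopologicalSpace S] [T2Space S]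

/-- The points which lie on a loop that separates `V` together with a fixed set `A`. -/
def sepLoci (V A : Set S) (c : S) : Set S :=
  {x | ∃ (τ : ℝ → S) (E : Set S), IsLoop τ ∧ τ '' Icc 0 1 ⊆ V ∧ Disjoint (τ '' Icc 0 1) A ∧
    IsSep V c E (A ∪ τ '' Icc 0 1) ∧ x ∈ τ '' Icc 0 1}

theorem mem_sepLoci_of_chart {V A : Set S} {c : S} (hc : c ∉ V) {φ : ℂ → S} (hφ : IsOpenEmbedding φ)
    (hφV : range φ ⊆ V) (hφA : Disjoint (range φ) A) {x y : S} (hx : x ∈ sepLoci V A c)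
    (hxφ : x ∈ range φ) (hyφ : y ∈ range φ) : y ∈ sepLoci V A c := by
  obtain ⟨a, rfl⟩ := hxφ
  obtain ⟨b, rfl⟩ := hyφ
  obtain ⟨τ, E, hτ, hτV, hτA, hE, hx⟩ := hx
  obtain ⟨H, D, hD, hDφ, hab, hH⟩ := exists_homeomorph_chart hφ a b
  have hHA : H '' A = A := by
    have : EqOn H id A := fun x hx => hH x fun h => disjoint_left.1 hφA (hDφ h) hx
    rw [this.image_eq, image_id]
  have hHD : ∀ x, H x ∈ D → x ∈ D := fun x h => by
    by_contra hx
    exact hx (hH x hx ▸ h)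
  have hHi : (fun t => H (τ t)) '' Icc 0 1 = H '' (τ '' Icc 0 1) := (image_image H τ _).symm
  have hDV := hDφ.trans hφV
  refine ⟨fun t => H (τ t), H '' E, hτ.homeomorph H, ?_, ?_, ?_, ?_⟩
  · rw [hHi]
    rintro _ ⟨x, hx, rfl⟩
    by_cases h : x ∈ D
    · by_cases h' : H x ∈ D
      · exact hDV h'
      · refine absurd ?_ h'
        rw [H.injective (hH _ h')]
        exact h
    · exact (hH x h).symm ▸ hτV hx
  · rw [hHi, ← hHA]
    exact (disjoint_image_iff H.injective).2 hτA
  · refine hE.of_sameOff hc (E' := H '' E) ?_ ⟨D, hD, hDV, fun x hx => ?_⟩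
    · have := hE.side.homeomorph H
      rwa [image_union, hHA, ← hHi] at this
    · conv_lhs => rw [← hH x hx]
      exact H.injective.mem_set_image
  · rw [hHi, ← hab]
    exact mem_image_of_mem _ hx

/-- A separating family of at least two disjoint loops can be replaced by a smaller one. -/
theorem IsLoopSystem.merge {V : Set S} {c : S} (hV : IsOpen V) (hVB : Disjoint V (Bd S))
    (hVp : IsPreconnected V) (hc : c ∉ V) {κ : Type*} [Finite κ] [Nonempty κ] {γ : κ → ℝ → S}
    (h : IsLoopSystem V γ) {τ : ℝ → S} (hτ : IsLoop τ) (hτV : τ '' Icc 0 1 ⊆ V)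
    (hτγ : Disjoint (τ '' Icc 0 1) (support γ)) {E : Set S}
    (hE : IsSep V c E (support γ ∪ τ '' Icc 0 1)) : HasSep V c (Nat.card κ) := by
  set A := support γ with hA
  have hAc : IsClosed A := h.isSystem.isClosed_support
  by_cases hex : ∃ φ : ℂ → S, IsOpenEmbedding φ ∧ range φ ⊆ V ∧ (range φ ∩ sepLoci V A c).Nonempty ∧
      (range φ ∩ A).Nonempty
  · obtain ⟨φ, hφ, hφV, ⟨_, ⟨a, rfl⟩, ρ, E', hρ, hρV, hρA, hE', ha⟩, _, ⟨b, rfl⟩, hb⟩ := hex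
    obtain ⟨z, hz, w, hw, hzw, hseg⟩ := exists_disjoint_nearest
      (P := φ ⁻¹' (ρ '' Icc 0 1)) (Q := φ ⁻¹' A) (hρ.edge.isClosed_image.preimage hφ.continuous)
      (hAc.preimage hφ.continuous) (hρA.preimage φ) ⟨a, ha⟩ ⟨b, hb⟩
    obtain ⟨c₁, hc₁, hc₁0, hc₁i⟩ := hρ.exists_rebase hz
    obtain ⟨k, hk⟩ := mem_iUnion.1 hw
    obtain ⟨c₂, hc₂, hc₂0, hc₂i⟩ := (h.loop k).exists_rebase hk
    set γ' : {j // j ≠ k} → ℝ → S := fun j => γ j with hγ'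
    have hγ's : IsLoopSystem V γ' := h.comp Subtype.val_injective
    have hAe : A = support γ' ∪ c₂ '' Icc 0 1 := by rw [hc₂i]; exact support_eq_union γ k
    have hc₂Y : Disjoint (c₂ '' Icc 0 1) (support γ') := hc₂i ▸ h.disjoint_support k
    have hYA : support γ' ⊆ A := hAe ▸ subset_union_left
    have hc₂A : c₂ '' Icc 0 1 ⊆ A := hAe ▸ subset_union_right
    obtain ⟨δ, E'', hδ, hδV, hδY, hE'', hs⟩ := exists_loop_of_segment hV hVB
      hγ's.isSystem.isClosed_support hφ hφV hc₁ hc₂ (hc₁i ▸ hρA.mono_right hc₂A) (hc₁i ▸ hρV)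
      (hc₂i ▸ h.subset k) (hc₁i ▸ hρA.mono_right hYA) hc₂Y hzw hc₁0 hc₂0
      (fun x hx hx' => (hseg x hx).1 (hc₁i ▸ hx')) (fun x hx hx' => (hseg x hx).2 (hc₂A hx'))
      (fun x hx hx' => by
        have hxw := (hseg x hx).2 (hYA hx')
        refine disjoint_left.1 hc₂Y (hc₂i ▸ hk) ?_
        rwa [← hxw])
      (E := E') (by
        convert hE'.side using 1
        rw [hAe, hc₁i]
        ac_rfl)
    have := HasSep.of_system (hγ's.option hδ hδV hδY).isSystem
      (by rw [support_option]; exact hE'.of_sameOff hc hE'' hs)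
    classical
    rwa [Nat.card_congr (Equiv.optionSubtypeNe k)] at this
  · exfalso
    push Not at hex
    have hloc : ∀ y ∈ V, y ∈ interior (sepLoci V A c) ∪ interior (sepLoci V A c)ᶜ := fun y hy => by
      obtain ⟨φ, hφ, hφy, hφV⟩ := exists_chart (disjoint_left.1 hVB hy) (hV.mem_nhds hy)
      have hyφ : y ∈ range φ := ⟨0, hφy⟩
      rcases (range φ ∩ sepLoci V A c).eq_empty_or_nonempty with h0 | hne
      · exact Or.inr (mem_interior.2 ⟨range φ, subset_compl_iff_disjoint_right.2
          (disjoint_iff_inter_eq_empty.2 h0), hφ.isOpen_range, hyφ⟩)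
      · obtain ⟨x, hxφ, hx⟩ := hne
        have hφA := disjoint_iff_inter_eq_empty.2 (hex φ hφ hφV ⟨x, hxφ, hx⟩)
        exact Or.inl (mem_interior.2 ⟨range φ, fun z hz =>
          mem_sepLoci_of_chart hc hφ hφV hφA hx hxφ hz, hφ.isOpen_range, hyφ⟩)
    have hx : τ 0 ∈ sepLoci V A c :=
      ⟨τ, E, hτ, hτV, hτγ, hE, mem_image_of_mem _ (by simp)⟩
    obtain ⟨k⟩ := ‹Nonempty κ›
    have hkA : γ k 0 ∈ A := mem_iUnion.2 ⟨k, mem_image_of_mem _ (by simp)⟩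
    have hk : γ k 0 ∉ sepLoci V A c := by
      rintro ⟨ρ, E', -, -, hρA, -, h'⟩
      exact disjoint_left.1 hρA h' hkA
    have hτ0V : τ 0 ∈ V := hτV (mem_image_of_mem _ (by simp))
    have hkV : γ k 0 ∈ V := h.subset k (mem_image_of_mem _ (by simp))
    obtain ⟨y, -, hy, hy'⟩ := hVp _ _ isOpen_interior isOpen_interior hloc
      ⟨_, hτ0V, (hloc _ hτ0V).resolve_right fun h => interior_subset h hx⟩
      ⟨_, hkV, (hloc _ hkV).resolve_left fun h => hk (interior_subset h)⟩
    exact interior_subset hy' (interior_subset hy)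

/-- A connected open set with one end separated from a point is separated by a single loop. -/
theorem exists_isSep_loop [PreconnectedSpace S] {V : Set S} {c : S} (hV : IsOpen V)
    (hVB : Disjoint V (Bd S)) (hVp : IsPreconnected V) (hc : c ∉ V) (hVc : ¬ IsCompact (closure V))
    (hsep : ∃ n, HasSep V c n) :
    ∃ τ E, IsLoop τ ∧ τ '' Icc 0 1 ⊆ V ∧ IsSep V c E (τ '' Icc 0 1) := by
  classical
  let n := Nat.find hsep
  obtain ⟨γ, E, hγ, hE⟩ : HasSep V c n := Nat.find_spec hsep
  have hmin : ∀ m < Nat.card (Fin n), ¬ HasSep V c m := fun m hm =>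
    Nat.find_min hsep (by rwa [Nat.card_fin] at hm)
  have hloop : IsLoopSystem V γ :=
    ⟨fun i => ⟨hγ.edge i, hγ.loop_of_minimal hV hVB hc hE hmin i⟩, hγ.subset,
      fun i j hij => hγ.disjoint_of_minimal hV hVB hc hE hmin hij⟩
  rcases isEmpty_or_nonempty (Fin n) with h0 | ⟨⟨i⟩⟩
  · exfalso
    have hs : support γ = ∅ := iUnion_of_empty _
    rw [hs] at hE
    obtain ⟨K, hK, hVK⟩ := hE.exhaust
    have hEcl : IsClopen E := ⟨by simpa using hE.side.2.2, hE.side.1⟩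
    rcases isClopen_iff.1 hEcl with h | h
    · rw [h] at hVK
      have hVK' : V ⊆ K := fun x hx => by_contra fun h => hVK ⟨hx, h⟩
      exact hVc (hK.of_isClosed_subset isClosed_closure (closure_minimal hVK' hK.isClosed))
    · exact hE.notMem (h ▸ mem_univ c)
  · rcases isEmpty_or_nonempty {j // j ≠ i} with h1 | h1
    · refine ⟨γ i, E, hloop.loop i, hloop.subset i, ?_⟩
      have : support γ = γ i '' Icc 0 1 := by
        rw [support_eq_union γ i, support, iUnion_of_empty, empty_union]
      rwa [← this]
    · refine absurd ?_ (hmin _ (card_ne i))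
      exact (hloop.comp Subtype.val_injective).merge hV hVB hVp hc (hloop.loop i) (hloop.subset i)
        (hloop.disjoint_support i) (E := E) (by rwa [← support_eq_union])

theorem exists_isBoundaryIsolating [PreconnectedSpace S] [WeaklyLocallyCompactSpace S]
    (hBd : (Bd S).Nonempty) {U B : Set S} (hU : IsClosed U) (hUB : B = frontier U ∪ (U ∩ Bd S))
    (hUc : ¬ IsCompact U) (hBc : IsConnected B) (hB : IsCompact B) :
    ∃ α : Set S, IsBoundaryIsolating α := by
  obtain ⟨c, hc⟩ := hBc.nonempty
  obtain ⟨V, hV, hVp, hVB, hBV, hVfr, hVc, hsep⟩ := exists_region hU hUB hUc hB hc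
  obtain ⟨τ, E, hτ, hτV, hE⟩ :=
    exists_isSep_loop hV hVB hVp (disjoint_left.1 hBV hc) hVc hsep
  exact ⟨_, hτ.isBoundaryIsolating hτV hVB hE hV hBc.isPreconnected hc hVfr hBV hVc hBd⟩

end Existence

/-- A surface `S` has a boundary isolating curve if and only if `S` has
nonempty boundary and there exist a compact set `K ⊆ S` and a connected component `Z` of
`S ∖ K` such that `U := closure Z` is noncompact and the boundary of `U` — the union of the
topological frontier of `U` in `S` with `U ∩ ∂S` — consists of exactly one connected
component, and that component is compact. -/
theorem boundaryIsolating_iff_isolated_end_neighborhood (S : Type*) [TopologicalSpace S]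
    (hS : IsSurface S) :
    (∃ α : Set S, IsBoundaryIsolating α) ↔
      ((Bd S).Nonempty ∧ ∃ K : Set S, IsCompact K ∧ ∃ x ∈ Kᶜ,
        ∃ U BU : Set S, U = closure (connectedComponentIn Kᶜ x) ∧
          BU = frontier U ∪ (U ∩ Bd S) ∧
          ¬ IsCompact U ∧ IsConnected BU ∧ IsCompact BU) := by
  have := hS.connected
  have := hS.t2
  have := hS.weaklyLocallyCompactSpace
  constructor
  · rintro ⟨α, hα⟩
    exact hα.exists_isolated_end
  · rintro ⟨hBd, K, -, x, -, U, BU, hU, hBU, hUc, hconn, hcomp⟩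
    exact exists_isBoundaryIsolating hBd (hU ▸ isClosed_closure) hBU hUc hconn hcomp
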